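/- arXiv:math/0406368 — 3 statements merged into one kernel-verified Lean document; each statement's English description precedes it below -/
import Mathlib

section
/- Let ν be a C^∞-smooth real-valued function on the closed unit disk such that z ↦ ν(z)/(1−|z|²) is subharmonic in the open unit disk D, and suppose ν is reproducing at the origin, i.e. h(0) = ∫_D h(z)ν(z) dΣ(z) for every harmonic polynomial h. Then for every function u that is C^∞-smooth on the closed unit disk and subharmonic in D, one has ∫_D u(z)·2(1−|z|²) dΣ(z) ≤ ∫_D u(z)ν(z) dΣ(z). -/
open Complex MeasureTheory Metric Set ComplexConjugate
noncomputable section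

/-- The normalized area measure `dΣ = dx dy / π` on `ℂ`. -/
def areaM : Measure ℂ := (ENNReal.ofReal Real.pi)⁻¹ • (volume : Measure ℂ)

/-- The normalized Laplacian `Δ = ∂²/∂z∂z̄ = (1/4)(∂²/∂x² + ∂²/∂y²)`. -/
def lap (u : ℂ → ℝ) (z : ℂ) : ℝ :=
  (1/4) * (fderiv ℝ (fun w => fderiv ℝ u w 1) z 1
    + fderiv ℝ (fun w => fderiv ℝ u w Complex.I) z Complex.I)

/-- A harmonic polynomial: a real-valued polynomial in `x` and `y` with vanishing Laplacian,
equivalently of the form `p(z) + conj (q(z))` for complex polynomials `p, q`. -/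
def IsHarmonicPolynomial (h : ℂ → ℝ) : Prop :=
  ∃ p q : Polynomial ℂ, ∀ z : ℂ, (h z : ℂ) = p.eval z + conj (q.eval z)

/-- `f` is real differentiable at `z` with Wirtinger derivatives `∂f = p` and `∂̄f = q`. -/
def HasWirt (f : ℂ → ℂ) (p q z : ℂ) : Prop :=
  HasFDerivAt f (p • (1 : ℂ →L[ℝ] ℂ) + q • (conjCLE : ℂ →L[ℝ] ℂ)) z

namespace HasWirt

variable {f g : ℂ → ℂ} {p q p' q' z : ℂ}

lemma congr_deriv (hf : HasWirt f p q z) (hp : p = p') (hq : q = q') : HasWirt f p' q' z := by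
  subst hp hq; exact hf

lemma congr (hf : HasWirt f p q z) (hfg : ∀ w, g w = f w) : HasWirt g p q z := by
  rwa [show g = f from funext hfg]

lemma continuousAt (hf : HasWirt f p q z) : ContinuousAt f z := HasFDerivAt.continuousAt hf

lemma const (c z : ℂ) : HasWirt (fun _ => c) 0 0 z :=
  (hasFDerivAt_const c z).congr_fderiv <| ContinuousLinearMap.ext fun w => by simp

lemma id (z : ℂ) : HasWirt (fun w => w) 1 0 z :=
  (hasFDerivAt_id (𝕜 := ℝ) z).congr_fderiv <| ContinuousLinearMap.ext fun w => by simp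

lemma conj_id (z : ℂ) : HasWirt (fun w => conj w) 0 1 z :=
  ((conjCLE : ℂ →L[ℝ] ℂ).hasFDerivAt (x := z)).congr_fderiv <|
    ContinuousLinearMap.ext fun w => by simp

lemma add (hf : HasWirt f p q z) (hg : HasWirt g p' q' z) :
    HasWirt (fun w => f w + g w) (p + p') (q + q') z :=
  (HasFDerivAt.add hf hg).congr_fderiv <| ContinuousLinearMap.ext fun w => by simp; ring

lemma sub (hf : HasWirt f p q z) (hg : HasWirt g p' q' z) :
    HasWirt (fun w => f w - g w) (p - p') (q - q') z :=
  (HasFDerivAt.sub hf hg).congr_fderiv <| ContinuousLinearMap.ext fun w => by simp; ring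

lemma mul (hf : HasWirt f p q z) (hg : HasWirt g p' q' z) :
    HasWirt (fun w => f w * g w) (p * g z + f z * p') (q * g z + f z * q') z :=
  (HasFDerivAt.mul hf hg).congr_fderiv <| ContinuousLinearMap.ext fun w => by simp; ring

lemma const_mul (c : ℂ) (hf : HasWirt f p q z) : HasWirt (fun w => c * f w) (c * p) (c * q) z :=
  ((const c z).mul hf).congr_deriv (by ring) (by ring)

lemma pow (hf : HasWirt f p q z) (n : ℕ) :
    HasWirt (fun w => f w ^ n) (n * f z ^ (n - 1) * p) (n * f z ^ (n - 1) * q) z := by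
  have := (HasDerivAt.hasFDerivAt (hasDerivAt_pow n (f z))).restrictScalars ℝ
  exact (HasFDerivAt.comp z this hf).congr_fderiv <| ContinuousLinearMap.ext fun w => by
    simp; ring

lemma inv (hf : HasWirt f p q z) (h : f z ≠ 0) :
    HasWirt (fun w => (f w)⁻¹) (-p / (f z) ^ 2) (-q / (f z) ^ 2) z := by
  have := (HasDerivAt.hasFDerivAt (hasDerivAt_inv h)).restrictScalars ℝ
  exact (HasFDerivAt.comp z this hf).congr_fderiv <| ContinuousLinearMap.ext fun w => by
    simp; ring

lemma star (hf : HasWirt f p q z) :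
    HasWirt (fun w => conj (f w)) (conj q) (conj p) z := by
  have := (conjCLE : ℂ →L[ℝ] ℂ).hasFDerivAt (x := f z)
  exact (HasFDerivAt.comp z this hf).congr_fderiv <| ContinuousLinearMap.ext fun w => by
    simp; ring

lemma real_comp {g : ℂ → ℝ} {φ : ℝ → ℝ} {φ' : ℝ} (hg : HasWirt (fun w => (g w : ℂ)) p q z)
    (hφ : HasDerivAt φ φ' (g z)) : HasWirt (fun w => (φ (g w) : ℂ)) (φ' * p) (φ' * q) z := by
  have h1 : HasFDerivAt g (reCLM ∘L (p • (1 : ℂ →L[ℝ] ℂ) + q • (conjCLE : ℂ →L[ℝ] ℂ))) z := by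
    have := HasFDerivAt.comp (f := fun w => (g w : ℂ)) z (reCLM.hasFDerivAt (x := (g z : ℂ))) hg
    exact this
  have h2 := HasFDerivAt.unique hg (HasFDerivAt.comp z (ofRealCLM.hasFDerivAt (x := g z)) h1)
  have h3 := HasFDerivAt.comp z (ofRealCLM.hasFDerivAt (x := φ (g z)))
    (hφ.comp_hasFDerivAt z h1)
  refine h3.congr_fderiv (ContinuousLinearMap.ext fun w => ?_)
  have h4 := congr($h2 w)
  simp at h4 ⊢
  linear_combination (-φ' : ℂ) * h4

lemma conj_eq {g : ℂ → ℝ} (hg : HasWirt (fun w => (g w : ℂ)) p q z) : conj p = q := by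
  have h2 := HasFDerivAt.unique hg (hg.star.congr fun w => (conj_ofReal _).symm)
  have e1 := congr($h2 1)
  have e2 := congr($h2 I)
  simp at e1 e2
  linear_combination (-e1 - I * e2) / 2 + (p - q - conj q + conj p) / 2 * I_sq

lemma normSq (hf : HasWirt f p q z) :
    HasWirt (fun w => (Complex.normSq (f w) : ℂ)) (p * conj (f z) + f z * conj q)
      (q * conj (f z) + f z * conj p) z :=
  (hf.mul hf.star).congr fun _ => (mul_conj _).symm

lemma log_normSq (hf : HasWirt f p q z) (h : f z ≠ 0) :
    HasWirt (fun w => ((Real.log (Complex.normSq (f w)) : ℝ) : ℂ))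
      (p / f z + conj q / conj (f z)) (q / f z + conj p / conj (f z)) z := by
  have h0 : Complex.normSq (f z) ≠ 0 := by simpa using h
  have h' : conj (f z) ≠ 0 := by simpa using h
  refine (hf.normSq.real_comp (Real.hasDerivAt_log h0)).congr_deriv ?_ ?_ <;>
  · push_cast
    rw [← mul_conj]
    field_simp

end HasWirt

/-- The Wirtinger derivative `∂f`. -/
def dz (f : ℂ → ℂ) (z : ℂ) : ℂ := (fderiv ℝ f z 1 - I * fderiv ℝ f z I) / 2

/-- The Wirtinger derivative `∂̄f`. -/
def dzb (f : ℂ → ℂ) (z : ℂ) : ℂ := (fderiv ℝ f z 1 + I * fderiv ℝ f z I) / 2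

lemma HasFDerivAt.hasWirt {f : ℂ → ℂ} {L : ℂ →L[ℝ] ℂ} {z : ℂ} (h : HasFDerivAt f L z) :
    HasWirt f ((L 1 - I * L I) / 2) ((L 1 + I * L I) / 2) z := by
  refine h.congr_fderiv (ContinuousLinearMap.ext fun w => ?_)
  have : L w = w.re * L 1 + w.im * L I := by
    conv_lhs => rw [← re_add_im w, map_add]
    have e1 := L.map_smul w.re 1
    have e2 := L.map_smul w.im I
    simp only [real_smul, mul_one] at e1 e2
    rw [e1, e2]
  rw [this]
  simp only [re_eq_add_conj, im_eq_sub_conj]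
  simp
  field_simp
  ring_nf
  simp
  ring

lemma DifferentiableAt.hasWirt {f : ℂ → ℂ} {z : ℂ} (h : DifferentiableAt ℝ f z) :
    HasWirt f (dz f z) (dzb f z) z := h.hasFDerivAt.hasWirt

/-- A continuous function which is differentiable off a countable set and vanishes off a disk has
`∫ ∂̄f = 0`. -/
lemma integral_dzb_eq_zero {f p q : ℂ → ℂ} {s : Set ℂ} {R : ℝ} (hs : s.Countable)
    (hc : Continuous f) (hd : ∀ z ∉ s, HasWirt f (p z) (q z) z)
    (hR : ∀ z, R ≤ ‖z‖ → f z = 0) (hR' : ∀ z, R ≤ ‖z‖ → q z = 0) (hq : Integrable q) :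
    ∫ z, q z = 0 := by
  set T : ℝ := |R| + 1
  have hRT : R ≤ T := (le_abs_self R).trans (by simp [T])
  have hT : 0 ≤ T := by positivity
  have key := integral_boundary_rect_of_hasFDerivAt_real_off_countable f
    (fun z => p z • (1 : ℂ →L[ℝ] ℂ) + q z • (conjCLE : ℂ →L[ℝ] ℂ)) (⟨-T, -T⟩) (⟨T, T⟩) s hs
    hc.continuousOn (fun x hx => hd x hx.2) ?_
  · have e : ∀ z : ℂ, I • ((p z • (1 : ℂ →L[ℝ] ℂ) + q z • (conjCLE : ℂ →L[ℝ] ℂ)) 1)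
        - (p z • (1 : ℂ →L[ℝ] ℂ) + q z • (conjCLE : ℂ →L[ℝ] ℂ)) I = 2 * I * q z := by
      intro z; simp; ring
    simp only [e] at key
    have b1 : ∀ x : ℝ, f (x + ((-T : ℝ) : ℂ) * I) = 0 := fun x => hR _ <| hRT.trans <| by
      have := abs_im_le_norm (x + ((-T : ℝ) : ℂ) * I)
      simpa [abs_of_nonneg hT] using this
    have b2 : ∀ x : ℝ, f (x + (T : ℂ) * I) = 0 := fun x => hR _ <| hRT.trans <| by
      have := abs_im_le_norm (x + (T : ℂ) * I)
      simpa [abs_of_nonneg hT] using this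
    have b3 : ∀ x : ℝ, f (T + (x : ℂ) * I) = 0 := fun x => hR _ <| hRT.trans <| by
      have := abs_re_le_norm (T + (x : ℂ) * I)
      simpa [abs_of_nonneg hT] using this
    have b4 : ∀ x : ℝ, f (((-T : ℝ) : ℂ) + (x : ℂ) * I) = 0 := fun x => hR _ <| hRT.trans <| by
      have := abs_re_le_norm (((-T : ℝ) : ℂ) + (x : ℂ) * I)
      simpa [abs_of_nonneg hT] using this
    simp only [b1, b2, b3, b4] at key
    simp only [intervalIntegral.integral_zero, smul_zero, sub_zero, add_zero] at key
    have q0 : ∀ x y : ℝ, (x ∉ Ioc (-T) T ∨ y ∉ Ioc (-T) T) → q (x + y * I) = 0 := by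
      intro x y h
      apply hR' _ (hRT.trans _)
      rcases h with h | h
      · have := abs_re_le_norm ((x : ℂ) + (y : ℂ) * I)
        simp at this
        refine le_trans ?_ this
        by_contra! hh
        exact h ⟨(abs_lt.1 hh).1, (abs_lt.1 hh).2.le⟩
      · have := abs_im_le_norm ((x : ℂ) + (y : ℂ) * I)
        simp at this
        refine le_trans ?_ this
        by_contra! hh
        exact h ⟨(abs_lt.1 hh).1, (abs_lt.1 hh).2.le⟩
    have hint : Integrable (fun x : ℝ × ℝ => q (x.1 + x.2 * I)) (volume.prod volume) := by
      have := (volume_preserving_equiv_real_prod.symm).integrable_comp_emb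
        (measurableEquivRealProd.symm.measurableEmbedding) (g := q)
      have := this.2 hq
      rw [← Measure.volume_eq_prod]
      refine this.congr (.of_forall fun x => ?_)
      simp [measurableEquivRealProd, equivRealProdCLM_symm_apply]
    have : ∫ z, q z = ∫ x : ℝ, ∫ y : ℝ, q (x + y * I) := by
      rw [← integral_prod (f := fun x : ℝ × ℝ => q (x.1 + x.2 * I)) hint,
        ← (volume_preserving_equiv_real_prod.symm).integral_comp
          measurableEquivRealProd.symm.measurableEmbedding]
      congr 1; ext x
      simp [measurableEquivRealProd, equivRealProdCLM_symm_apply]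
    rw [this]
    have e2 : ∀ x : ℝ, ∫ y : ℝ, q (x + y * I) = ∫ y in (-T)..T, q (x + y * I) := by
      intro x
      rw [intervalIntegral.integral_of_le (by linarith),
        setIntegral_eq_integral_of_forall_compl_eq_zero]
      exact fun y hy => q0 x y (Or.inr hy)
    have e3 : ∫ x : ℝ, ∫ y : ℝ, q (x + y * I)
        = ∫ x in (-T)..T, ∫ y in (-T)..T, q (x + y * I) := by
      simp only [e2]
      rw [intervalIntegral.integral_of_le (by linarith),
        setIntegral_eq_integral_of_forall_compl_eq_zero]
      intro x hx
      simp [q0 x _ (Or.inl hx)]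
    rw [e3]
    simp only [intervalIntegral.integral_const_mul] at key
    simpa using key.symm
  · have e : ∀ z : ℂ, I • ((p z • (1 : ℂ →L[ℝ] ℂ) + q z • (conjCLE : ℂ →L[ℝ] ℂ)) 1)
        - (p z • (1 : ℂ →L[ℝ] ℂ) + q z • (conjCLE : ℂ →L[ℝ] ℂ)) I = 2 * I * q z := by
      intro z; simp; ring
    simp only [e]
    exact (hq.const_mul _).integrableOn

/-- The divergence theorem on the unit disk for fields vanishing to second order on the circle. -/
lemma setIntegral_ball_dzb_eq_zero {f p q : ℂ → ℂ} {s : Set ℂ} (hs : s.Countable)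
    (hsb : s ⊆ ball 0 1)
    (hc : ∀ z ∈ s, ContinuousAt f z)
    (hd : ∀ z ∈ closedBall (0 : ℂ) 1, z ∉ s → HasWirt f (p z) (q z) z)
    (h0 : ∀ z ∈ sphere (0 : ℂ) 1, f z = 0 ∧ p z = 0 ∧ q z = 0)
    (hq : IntegrableOn q (ball 0 1)) :
    ∫ z in ball (0 : ℂ) 1, q z = 0 := by
  rw [← integral_indicator measurableSet_ball]
  have hd' : ∀ z ∉ s, HasWirt (indicator (ball 0 1) f) (indicator (ball 0 1) p z)
      (indicator (ball 0 1) q z) z := by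
    intro z hz
    rcases lt_trichotomy ‖z‖ 1 with h | h | h
    · have hz1 : z ∈ ball (0 : ℂ) 1 := by simpa using h
      rw [indicator_of_mem hz1, indicator_of_mem hz1]
      refine HasFDerivAt.congr_of_eventuallyEq (hd z (ball_subset_closedBall hz1) hz) ?_
      filter_upwards [isOpen_ball.mem_nhds hz1] with w hw
      rw [indicator_of_mem hw]
    · have hz1 : z ∉ ball (0 : ℂ) 1 := by simp [h]
      obtain ⟨f0, p0, q0⟩ := h0 z (by simpa using h)
      rw [indicator_of_notMem hz1, indicator_of_notMem hz1]
      have := hd z (by simp [h]) hz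
      rw [p0, q0] at this
      unfold HasWirt at this ⊢
      have e0 : (0 : ℂ) • (1 : ℂ →L[ℝ] ℂ) + (0 : ℂ) • (conjCLE : ℂ →L[ℝ] ℂ) = 0 :=
        ContinuousLinearMap.ext fun w => by simp
      rw [e0] at this ⊢
      rw [hasFDerivAt_iff_isLittleO] at this ⊢
      refine Asymptotics.IsBigO.trans_isLittleO ?_ this
      refine Asymptotics.IsBigO.of_bound 1 (.of_forall fun w => ?_)
      simp only [f0, sub_zero, indicator_of_notMem hz1, zero_apply]
      rw [one_mul]
      exact norm_indicator_le_norm_self _ _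
    · have hz1 : z ∉ ball (0 : ℂ) 1 := by simp [h.le]
      rw [indicator_of_notMem hz1, indicator_of_notMem hz1]
      refine HasFDerivAt.congr_of_eventuallyEq (HasWirt.const 0 z) ?_
      filter_upwards [(isOpen_lt continuous_const continuous_norm).mem_nhds h] with w hw
      rw [indicator_of_notMem]
      simpa using le_of_lt hw
  refine integral_dzb_eq_zero (R := 1) hs ?_ hd' ?_ ?_ ?_
  · rw [continuous_iff_continuousAt]
    intro z
    by_cases hz : z ∈ s
    · refine (hc z hz).congr ?_
      filter_upwards [isOpen_ball.mem_nhds (hsb hz)] with w hw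
      rw [indicator_of_mem hw]
    · exact (hd' z hz).continuousAt
  · intro z hz; rw [indicator_of_notMem]; simpa using hz
  · intro z hz; rw [indicator_of_notMem]; simpa using hz
  · rwa [integrable_indicator_iff measurableSet_ball]

lemma ContDiff.dz {f : ℂ → ℂ} (hf : ContDiff ℝ (⊤ : ℕ∞) f) : ContDiff ℝ (⊤ : ℕ∞) (dz f) := by
  have : ContDiff ℝ (⊤ : ℕ∞) (fderiv ℝ f) := hf.fderiv_right (by simp)
  unfold _root_.dz
  fun_prop

lemma ContDiff.dzb {f : ℂ → ℂ} (hf : ContDiff ℝ (⊤ : ℕ∞) f) : ContDiff ℝ (⊤ : ℕ∞) (dzb f) := by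
  have : ContDiff ℝ (⊤ : ℕ∞) (fderiv ℝ f) := hf.fderiv_right (by simp)
  unfold _root_.dzb
  fun_prop

lemma tsupport_dz_subset (f : ℂ → ℂ) : tsupport (dz f) ⊆ tsupport f := by
  refine closure_minimal (fun z hz => ?_) (isClosed_tsupport f)
  by_contra h
  apply hz
  have : fderiv ℝ f z = 0 := by
    by_contra h'
    exact h (support_fderiv_subset ℝ h')
  simp [dz, this]

lemma tsupport_dzb_subset (f : ℂ → ℂ) : tsupport (dzb f) ⊆ tsupport f := by
  refine closure_minimal (fun z hz => ?_) (isClosed_tsupport f)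
  by_contra h
  apply hz
  have : fderiv ℝ f z = 0 := by
    by_contra h'
    exact h (support_fderiv_subset ℝ h')
  simp [dzb, this]

section real
variable {K : ℂ → ℝ} (hK : ContDiff ℝ (⊤ : ℕ∞) K)
include hK

lemma contDiff_ofReal_comp : ContDiff ℝ (⊤ : ℕ∞) (fun z => (K z : ℂ)) :=
  ofRealCLM.contDiff.comp hK

lemma hasWirt_ofReal_comp (z : ℂ) : HasWirt (fun z => (K z : ℂ))
    (dz (fun z => (K z : ℂ)) z) (conj (dz (fun z => (K z : ℂ)) z)) z := by
  have h := ((contDiff_ofReal_comp hK).differentiable (by simp) z).hasWirt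
  exact h.congr_deriv rfl h.conj_eq.symm

lemma hasWirt_dz_ofReal_comp (z : ℂ) : HasWirt (dz (fun z => (K z : ℂ)))
    (dz (dz (fun z => (K z : ℂ))) z) (dzb (dz (fun z => (K z : ℂ))) z) z :=
  ((contDiff_ofReal_comp hK).dz.differentiable (by simp) z).hasWirt

lemma re_dzb_dz_ofReal_comp (z : ℂ) : (dzb (dz (fun z => (K z : ℂ))) z).re = lap K z := by
  have hKd : ContDiff ℝ (⊤ : ℕ∞) (fderiv ℝ K) := hK.fderiv_right (by simp)
  have e : dz (fun z => (K z : ℂ)) =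
      fun z => ((fderiv ℝ K z 1 : ℂ) - I * (fderiv ℝ K z I : ℂ)) / 2 := by
    ext w
    have := (ofRealCLM.hasFDerivAt (x := K w)).comp w (hK.differentiable (by simp) w).hasFDerivAt
    have e2 : fderiv ℝ (fun z => (K z : ℂ)) w = ofRealCLM ∘SL fderiv ℝ K w := this.fderiv
    simp [dz, e2]
  have d : ∀ v : ℂ, HasFDerivAt (fun z => (fderiv ℝ K z v : ℂ))
      (ofRealCLM ∘SL fderiv ℝ (fun w => fderiv ℝ K w v) z) z := fun v => by
    have hd : DifferentiableAt ℝ (fun w => fderiv ℝ K w v) z :=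
      (hKd.differentiable (by simp) z).clm_apply (by fun_prop)
    exact (ofRealCLM.hasFDerivAt (x := fderiv ℝ K z v)).comp z hd.hasFDerivAt
  have d3 := (((d 1).sub ((d I).const_mul I)).mul_const (2⁻¹ : ℂ)).fderiv
  have e3 : fderiv ℝ (dz (fun z => (K z : ℂ))) z = (2⁻¹ : ℂ) •
      (ofRealCLM ∘SL fderiv ℝ (fun w => (fderiv ℝ K w) 1) z
        - I • ofRealCLM ∘SL fderiv ℝ (fun w => (fderiv ℝ K w) I) z) := by
    rw [e]; exact d3
  simp only [dzb, e3, lap]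
  simp
  ring

lemma continuous_lap : Continuous (lap K) := by
  have : lap K = fun z => (dzb (dz (fun z => (K z : ℂ))) z).re :=
    funext fun z => (re_dzb_dz_ofReal_comp hK z).symm
  rw [this]
  exact continuous_re.comp (contDiff_ofReal_comp hK).dz.dzb.continuous

lemma tsupport_lap_subset : tsupport (lap K) ⊆ tsupport K := by
  refine closure_minimal (fun z hz => ?_) (isClosed_tsupport K)
  have e : tsupport (fun z => (K z : ℂ)) = tsupport K := by
    simp [tsupport, Function.support]
  rw [← e]
  apply tsupport_dz_subset
  apply tsupport_dzb_subset
  apply subset_tsupport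
  intro h
  apply hz
  rw [← re_dzb_dz_ofReal_comp hK, h, zero_re]

end real

lemma integrableOn_log_normSq (R : ℝ) :
    IntegrableOn (fun z : ℂ => Real.log (normSq z)) (ball 0 R) := by
  have := (integrableOn_fun_norm_addHaar (E := ℂ) volume
    (f := fun y => Real.log (y ^ 2)) (r := R)).2 ?_
  · simpa [normSq_eq_norm_sq] using this
  · have hc : Continuous fun y : ℝ => 2 * (y * Real.log y) :=
      continuous_const.mul Real.continuous_mul_log
    refine ((hc.continuousOn (s := Icc 0 R)).integrableOn_Icc.mono_set
      Ioo_subset_Icc_self).congr_fun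
      (fun y _ => ?_) measurableSet_Ioo
    simp [Complex.finrank_real_complex]
    ring

lemma integrableOn_log_normSq_sub (s : ℂ) (R : ℝ) :
    IntegrableOn (fun z : ℂ => Real.log (normSq (z - s))) (ball 0 R) := by
  have h := (integrable_indicator_iff measurableSet_ball).2 (integrableOn_log_normSq (R + ‖s‖))
  have h2 := (h.comp_sub_right s).integrableOn (s := ball 0 R)
  refine h2.congr_fun (fun z hz => ?_) measurableSet_ball
  simp only
  rw [indicator_of_mem]
  simp only [mem_ball, dist_zero_right] at hz ⊢
  exact (norm_sub_le _ _).trans_lt (by linarith)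

/-- The normalizing constant of the logarithmic potential. -/
def logConst : ℝ := ∫ w : ℂ, ((1 + normSq w) ^ 2)⁻¹

lemma integrable_logConst : Integrable fun w : ℂ => ((1 + normSq w) ^ 2)⁻¹ := by
  have := integrable_rpow_neg_one_add_norm_sq (E := ℂ) (μ := volume) (r := 4)
    (by simp [Complex.finrank_real_complex]; norm_num)
  refine this.congr (.of_forall fun w => ?_)
  simp only [normSq_eq_norm_sq]
  rw [show (-4 / 2 : ℝ) = -((2 : ℕ) : ℝ) by norm_num, Real.rpow_neg (by positivity),
    Real.rpow_natCast]

lemma logConst_pos : 0 < logConst := by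
  refine (integral_pos_iff_support_of_nonneg (fun w => ?_) integrable_logConst).2 ?_
  · have := normSq_nonneg w; simp only [Pi.zero_apply]; positivity
  · have : Function.support (fun w : ℂ => ((1 + normSq w) ^ 2)⁻¹) = univ := by
      ext w; have := normSq_nonneg w; simp; positivity
    rw [this]; simp

/-- Green's identity for the regularized logarithm. -/
lemma integral_log_add_mul_lap {K : ℂ → ℝ} (hK : ContDiff ℝ (⊤ : ℕ∞) K)
    (hc : HasCompactSupport K) {e : ℝ} (he : 0 < e) :
    ∫ z, Real.log (normSq z + e ^ 2) * lap K z
      = ∫ z, e ^ 2 / (normSq z + e ^ 2) ^ 2 * K z := by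
  have pos : ∀ z, 0 < normSq z + e ^ 2 := fun z => by
    have := normSq_nonneg z; positivity
  have hne : ∀ z, ((normSq z + e ^ 2 : ℝ) : ℂ) ≠ 0 := fun z => by exact_mod_cast (pos z).ne'
  set E : ℂ → ℂ := fun z => ((Real.log (normSq z + e ^ 2) : ℝ) : ℂ) with hE
  set E1 : ℂ → ℂ := fun z => conj z * ((normSq z + e ^ 2 : ℝ) : ℂ)⁻¹ with hE1
  set Kc : ℂ → ℂ := fun z => (K z : ℂ) with hKc
  have hn : ∀ z, HasWirt (fun z => ((normSq z + e ^ 2 : ℝ) : ℂ)) (conj z) z z := fun z => by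
    refine (((HasWirt.id z).normSq.add (HasWirt.const (e ^ 2 : ℂ) z)).congr
      (fun w => by push_cast; rfl)).congr_deriv ?_ ?_ <;> simp
  have wE : ∀ z, HasWirt E (E1 z) (conj (E1 z)) z := fun z => by
    have := (hn z).real_comp (Real.hasDerivAt_log (pos z).ne')
    refine this.congr_deriv ?_ ?_ <;> simp [hE1, mul_comm]
  have wE1 : ∀ z, HasWirt E1 (-(conj z) ^ 2 / ((normSq z + e ^ 2 : ℝ) : ℂ) ^ 2)
      ((e ^ 2 / (normSq z + e ^ 2) ^ 2 : ℝ) : ℂ) z := fun z => by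
    refine ((HasWirt.conj_id z).mul ((hn z).inv (hne z))).congr_deriv ?_ ?_
    · ring
    · have := hne z
      push_cast at this ⊢
      field_simp
      rw [← mul_conj]; ring
  have wK := hasWirt_ofReal_comp hK
  have wK1 := hasWirt_dz_ofReal_comp hK
  have hKcC := contDiff_ofReal_comp hK
  have cE : Continuous E := continuous_iff_continuousAt.2 fun z => (wE z).continuousAt
  have cE1 : Continuous E1 := continuous_iff_continuousAt.2 fun z => (wE1 z).continuousAt
  have cφ : Continuous fun z : ℂ => e ^ 2 / (normSq z + e ^ 2) ^ 2 := by
    have := continuous_normSq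
    exact continuous_const.div (by fun_prop) fun z => (pow_pos (pos z) 2).ne'
  have wf := fun z => ((wE z).mul (wK1 z)).sub ((wK z).mul (wE1 z))
  have tK : tsupport Kc = tsupport K := by simp [tsupport, Function.support, hKc]
  obtain ⟨R, hR⟩ := hc.isBounded.subset_ball 0
  have out : ∀ z, R ≤ ‖z‖ → z ∉ tsupport K := fun z hz h => by
    have := hR h; simp at this; linarith
  have z0 : ∀ z, z ∉ tsupport K → K z = 0 := fun z hz => image_eq_zero_of_notMem_tsupport hz
  have z1 : ∀ z, z ∉ tsupport K → dz Kc z = 0 := fun z hz =>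
    image_eq_zero_of_notMem_tsupport fun h => hz (tK ▸ tsupport_dz_subset _ h)
  have z2 : ∀ z, z ∉ tsupport K → dzb (dz Kc) z = 0 := fun z hz =>
    image_eq_zero_of_notMem_tsupport fun h => hz
      (tK ▸ tsupport_dz_subset _ (tsupport_dzb_subset _ h))
  set q : ℂ → ℂ := fun z => conj (E1 z) * dz Kc z + E z * dzb (dz Kc) z
    - (conj (dz Kc z) * E1 z + Kc z * ((e ^ 2 / (normSq z + e ^ 2) ^ 2 : ℝ) : ℂ)) with hq
  have cq : Continuous q := by
    have := hKcC.continuous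
    have := hKcC.dz.continuous
    have := hKcC.dz.dzb.continuous
    have := continuous_conj
    fun_prop
  have zq : ∀ z, z ∉ tsupport K → q z = 0 := fun z hz => by
    simp only [hq, z1 z hz, z2 z hz]; simp [hKc, z0 z hz]
  have iq : Integrable q := cq.integrable_of_hasCompactSupport
    (HasCompactSupport.intro hc fun z hz => zq z hz)
  have key := integral_dzb_eq_zero (R := R) countable_empty
    (continuous_iff_continuousAt.2 fun z => (wf z).continuousAt) (fun z _ => wf z)
    (fun z hz => by
      have a := z1 z (out z hz)
      simp only [hKc] at a
      simp [a, z0 z (out z hz)]) (fun z hz => zq z (out z hz)) iq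
  have key2 : ∫ z, (q z).re = 0 := by
    have := congr_arg re key
    rw [zero_re] at this
    rw [← this]
    exact integral_re iq
  have e1 : ∀ z, (q z).re = Real.log (normSq z + e ^ 2) * lap K z
      - e ^ 2 / (normSq z + e ^ 2) ^ 2 * K z := fun z => by
    rw [← re_dzb_dz_ofReal_comp hK]
    simp only [hq, hE, hKc, sub_re, add_re, mul_re, conj_re, conj_im, ofReal_re, ofReal_im]
    ring
  simp only [e1] at key2
  rw [integral_sub] at key2
  · linarith
  · refine Continuous.integrable_of_hasCompactSupport ?_ (HasCompactSupport.intro hc fun z hz => ?_)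
    · have := continuous_lap hK
      have : Continuous fun z : ℂ => Real.log (normSq z + e ^ 2) :=
        (continuous_normSq.add continuous_const).log fun z => (pos z).ne'
      fun_prop
    · rw [image_eq_zero_of_notMem_tsupport fun h => hz (tsupport_lap_subset hK h), mul_zero]
  · exact Continuous.integrable_of_hasCompactSupport (cφ.mul hK.continuous)
      (HasCompactSupport.intro hc fun z hz => by rw [z0 z hz, mul_zero])

/-- The logarithmic potential representation of a test function. -/
lemma integral_log_mul_lap {K : ℂ → ℝ} (hK : ContDiff ℝ (⊤ : ℕ∞) K)
    (hc : HasCompactSupport K) :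
    ∫ z, Real.log (normSq z) * lap K z = logConst * K 0 := by
  set e : ℕ → ℝ := fun n => 1 / ((n : ℝ) + 1) with he
  have epos : ∀ n, 0 < e n := fun n => by positivity
  have ele : ∀ n, e n ≤ 1 := fun n => by
    simp only [he]; rw [div_le_one (by positivity)]; linarith [(Nat.cast_nonneg n : (0 : ℝ) ≤ n)]
  have et : Filter.Tendsto e Filter.atTop (nhds 0) := tendsto_one_div_add_atTop_nhds_zero_nat
  have cl := continuous_lap hK
  obtain ⟨R, hR⟩ := hc.isBounded.subset_ball 0
  have zl : ∀ z, z ∉ ball (0 : ℂ) R → lap K z = 0 := fun z hz =>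
    image_eq_zero_of_notMem_tsupport fun h => hz (hR (tsupport_lap_subset hK h))
  have clc : HasCompactSupport (lap K) := hc.of_isClosed_subset (isClosed_tsupport _)
    (tsupport_lap_subset hK)
  obtain ⟨C, hC⟩ := clc.exists_bound_of_continuous cl
  obtain ⟨C', hC'⟩ := hc.exists_bound_of_continuous hK.continuous
  have t1 : Filter.Tendsto (fun n => ∫ z, Real.log (normSq z + e n ^ 2) * lap K z) Filter.atTop
      (nhds (∫ z, Real.log (normSq z) * lap K z)) := by
    refine tendsto_integral_of_dominated_convergence
      (indicator (ball 0 R) fun z => (|Real.log (normSq z)| + Real.log (R ^ 2 + 1)) * C)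
      (fun n => ?_) ?_ (fun n => ?_) ?_
    · refine (Continuous.mul (Continuous.log ?_ fun z => ?_) cl).aestronglyMeasurable
      · have := continuous_normSq; fun_prop
      · have := normSq_nonneg z; have := epos n; positivity
    · rw [integrable_indicator_iff measurableSet_ball]
      refine Integrable.mul_const (Integrable.add (integrableOn_log_normSq R).abs ?_) _
      exact integrableOn_const measure_ball_lt_top.ne
    · have : ∀ᵐ z : ℂ, z ≠ 0 := by simp [ae_iff]
      filter_upwards [this] with z hz
      by_cases hzR : z ∈ ball (0 : ℂ) R
      · rw [indicator_of_mem hzR, norm_mul]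
        have hn : 0 < normSq z := normSq_pos.2 hz
        have hzR' : normSq z ≤ R ^ 2 := by
          rw [normSq_eq_norm_sq]
          have : ‖z‖ < R := by simpa using hzR
          have := norm_nonneg z
          gcongr
        have e2 : e n ^ 2 ≤ 1 := pow_le_one₀ (epos n).le (ele n)
        have l1 := Real.log_le_log hn (by nlinarith [epos n] : normSq z ≤ normSq z + e n ^ 2)
        have l2 := Real.log_le_log (by nlinarith [epos n] : 0 < normSq z + e n ^ 2)
          (by linarith : _ ≤ R ^ 2 + 1)
        have l3 : 0 ≤ Real.log (R ^ 2 + 1) := Real.log_nonneg (by nlinarith)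
        refine mul_le_mul ?_ (hC z) (norm_nonneg _) (by positivity)
        rw [Real.norm_eq_abs, abs_le]
        have := neg_abs_le (Real.log (normSq z))
        have := abs_nonneg (Real.log (normSq z))
        constructor <;> linarith
      · simp [zl z hzR, indicator_of_notMem hzR]
    · have : ∀ᵐ z : ℂ, z ≠ 0 := by simp [ae_iff]
      filter_upwards [this] with z hz
      refine Filter.Tendsto.mul_const _ (Filter.Tendsto.log ?_ (normSq_pos.2 hz).ne')
      simpa using (et.pow 2).const_add (normSq z)
  have t2 : Filter.Tendsto (fun n => ∫ z, e n ^ 2 / (normSq z + e n ^ 2) ^ 2 * K z) Filter.atTop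
      (nhds (logConst * K 0)) := by
    have r : ∀ n, ∫ z, e n ^ 2 / (normSq z + e n ^ 2) ^ 2 * K z
        = ∫ w, ((1 + normSq w) ^ 2)⁻¹ * K (e n * w) := fun n => by
      have := Measure.integral_comp_smul (volume : Measure ℂ)
        (fun z => e n ^ 2 / (normSq z + e n ^ 2) ^ 2 * K z) (e n)
      rw [Complex.finrank_real_complex, abs_of_pos (by have := epos n; positivity),
        smul_eq_mul] at this
      rw [← mul_inv_cancel_left₀ (pow_pos (epos n) 2).ne' (∫ z, _), ← this, ← integral_const_mul]
      congr 1; ext w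
      have h0 := (epos n).ne'
      have h1 : 1 + normSq w ≠ 0 := by have := normSq_nonneg w; positivity
      have h2 : e n ^ 2 * normSq w + e n ^ 2 = e n ^ 2 * (1 + normSq w) := by ring
      rw [real_smul, map_mul, normSq_ofReal, ← sq, h2]
      field_simp
    simp only [r]
    rw [logConst, ← integral_mul_const]
    refine tendsto_integral_of_dominated_convergence
      (fun w => ((1 + normSq w) ^ 2)⁻¹ * C') (fun n => ?_) (integrable_logConst.mul_const _)
      (fun n => .of_forall fun w => ?_) (.of_forall fun w => ?_)
    · exact integrable_logConst.aestronglyMeasurable.mul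
        (hK.continuous.comp (by fun_prop)).aestronglyMeasurable
    · have := normSq_nonneg w
      rw [norm_mul, Real.norm_of_nonneg (by positivity)]
      gcongr
      exact hC' _
    · refine Filter.Tendsto.const_mul _ ((hK.continuous.tendsto 0).comp ?_)
      have := ((continuous_ofReal.tendsto 0).comp et).mul_const w
      simpa using this
  refine tendsto_nhds_unique t1 (t2.congr fun n => ?_)
  rw [integral_log_add_mul_lap hK hc (epos n)]

lemma integral_log_sub_mul_lap {K : ℂ → ℝ} (hK : ContDiff ℝ (⊤ : ℕ∞) K)
    (hc : HasCompactSupport K) (z : ℂ) :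
    ∫ s, Real.log (normSq (z - s)) * lap K s = logConst * K z := by
  have e1 : ∀ w, lap (fun w => K (w + z)) w = lap K (w + z) := fun w => by
    simp only [lap, fderiv_comp_add_right]
    rw [fderiv_comp_add_right (f := fun w => fderiv ℝ K w 1) z,
      fderiv_comp_add_right (f := fun w => fderiv ℝ K w I) z]
  have := integral_log_mul_lap (K := fun w => K (w + z)) (hK.comp (by fun_prop))
    (hc.comp_homeomorph (Homeomorph.addRight z))
  simp only [e1, zero_add] at this
  rw [← this, ← integral_add_right_eq_self _ z]
  congr 1; ext w
  rw [sub_add_cancel_right, normSq_neg]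

/-- The Green function of the Laplacian on the unit disk. -/
def greenLog (s z : ℂ) : ℝ := Real.log (normSq (z - s)) - Real.log (normSq (1 - z * conj s))

/-- The Green function of `Δ (1 - |z|²)⁻¹ Δ` on the unit disk. -/
def weightedGreen (s z : ℂ) : ℝ :=
  (1 - normSq (z + s) / 4) * (normSq (z - s) * greenLog s z
      + (1 - normSq z) * (1 - normSq s)
      - ((1 - normSq z) * (1 - normSq s)) ^ 2 / (2 * normSq (1 - z * conj s)))
    + ((1 - normSq z) * (1 - normSq s)) ^ 3 / (8 * normSq (1 - z * conj s))

/-- A holomorphic function whose real part is the harmonic part of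
`Δ weightedGreen / (1 - |z|²)`. -/
def greenHol (s z : ℂ) : ℂ :=
  (1 - s * conj s) * (2 * (1 - z * conj s)⁻¹ - 1)
    + (1 - s * conj s) ^ 2 / 2 * (2 * (1 - z * conj s)⁻¹ ^ 2 - 1)

/-- The smooth part of `∂ weightedGreen`, as a function of `z` and `w = conj z`. -/
def greenS (s t z w : ℂ) : ℂ :=
  (1 - s * t) * ((w - t) * (1 - (z + s) * (w + t) / 4) * (1 - z * t)⁻¹)
  + (1 - s * t) / 8 * ((1 - z * w) * (-(1 + s * t) * w - 2 * t)
      - w * (7 - s * t - (1 + s * t) * (z * w) - 2 * t * z - 2 * s * w))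
  - (1 - s * t) ^ 2 / 4 *
    ((-2 * (1 - z * w) * (1 - s * t * (z * w)) - s * t * (1 - z * w) ^ 2) * w *
        ((1 - z * t)⁻¹ * (1 - w * s)⁻¹)
      + (1 - z * w) ^ 2 * (1 - s * t * (z * w)) * t * ((1 - z * t)⁻¹ ^ 2 * (1 - w * s)⁻¹))

/-- The derivative of `greenS` in `z`. -/
def greenSz (s t z w : ℂ) : ℂ :=
  (1 - s * t) * (w - t) * (-(w + t) / 4 * (1 - z * t)⁻¹
      + (1 - (z + s) * (w + t) / 4) * t * (1 - z * t)⁻¹ ^ 2)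
  + (1 - s * t) / 4 * w * ((1 + s * t) * w + 2 * t)
  - (1 - s * t) ^ 2 / 4 *
    ((2 * (1 - s * t * (z * w)) + 4 * (s * t) * (1 - z * w)) * w ^ 2 *
        ((1 - z * t)⁻¹ * (1 - w * s)⁻¹)
      + 2 * (-2 * (1 - z * w) * (1 - s * t * (z * w)) - s * t * (1 - z * w) ^ 2) * w * t *
        ((1 - z * t)⁻¹ ^ 2 * (1 - w * s)⁻¹)
      + 2 * ((1 - z * w) ^ 2 * (1 - s * t * (z * w))) * t ^ 2 *
        ((1 - z * t)⁻¹ ^ 3 * (1 - w * s)⁻¹))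

/-- `∂ weightedGreen`. -/
def weightedGreenDz (s z : ℂ) : ℂ :=
  greenLog s z * ((conj z - conj s) * (1 - z * (conj z + conj s) / 2))
    + greenS s (conj s) z (conj z)

/-- `∂² weightedGreen`. -/
def weightedGreenDzz (s z : ℂ) : ℂ :=
  (1 / (z - s) + conj s / (1 - z * conj s)) * ((conj z - conj s) * (1 - z * (conj z + conj s) / 2))
    + greenLog s z * (-(conj z - conj s) * (conj z + conj s) / 2)
    + greenSz s (conj s) z (conj z)

section WeightedGreen

variable {s z : ℂ}

lemma conj_one_sub_mul_conj_ne (hb : 1 - z * conj s ≠ 0) : 1 - conj z * s ≠ 0 := by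
  have : conj (1 - z * conj s) ≠ 0 := by simpa only [ne_eq, map_eq_zero] using hb
  simpa using this

lemma hasWirt_greenLog (hz : z ≠ s) (hb : 1 - z * conj s ≠ 0) :
    HasWirt (fun z => (greenLog s z : ℂ)) (1 / (z - s) + conj s / (1 - z * conj s))
      (1 / (conj z - conj s) + s / (1 - conj z * s)) z := by
  have h1 := ((HasWirt.id z).sub (HasWirt.const s z)).log_normSq (sub_ne_zero.2 hz)
  have h2 := ((HasWirt.const 1 z).sub ((HasWirt.id z).mul (HasWirt.const (conj s) z))).log_normSq hb
  refine ((h1.sub h2).congr fun w => ?_).congr_deriv ?_ ?_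
  · simp [greenLog]
  · simp; ring
  · simp; ring

lemma hasWirt_greenS (hb : 1 - z * conj s ≠ 0) :
    HasWirt (fun z => greenS s (conj s) z (conj z)) (greenSz s (conj s) z (conj z))
      ((1 - z * conj z) * ((1 - s * conj s) * ((1 - z * conj s)⁻¹ + (1 - conj z * s)⁻¹ - 1)
        + (1 - s * conj s) ^ 2 / 2 * ((1 - z * conj s)⁻¹ ^ 2 + (1 - conj z * s)⁻¹ ^ 2 - 1))
        - (1 - s * conj s) * (1 - z * (conj z + conj s) / 2) * (1 - conj z * s)⁻¹) z := by
  have hb' := conj_one_sub_mul_conj_ne hb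
  have hz := HasWirt.id z
  have hw := HasWirt.conj_id z
  have c := fun a => HasWirt.const a z
  have hu := ((c 1).sub (hz.mul (c (conj s)))).inv hb
  have hv := ((c 1).sub (hw.mul (c s))).inv hb'
  have h1 := (((hw.sub (c (conj s))).mul ((c 1).sub
    (((hz.add (c s)).mul (hw.add (c (conj s)))).mul (c (1 / 4))))).mul hu).const_mul
    (1 - s * conj s)
  have hm := (c 1).sub (hz.mul hw)
  have hk := (c 1).sub ((hz.mul hw).const_mul (s * conj s))
  have h2 := ((hm.mul ((hw.const_mul (-(1 + s * conj s))).sub (c (2 * conj s)))).sub (hw.mul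
    ((((c (7 - s * conj s)).sub ((hz.mul hw).const_mul (1 + s * conj s))).sub
      (hz.const_mul (2 * conj s))).sub (hw.const_mul (2 * s))))).const_mul ((1 - s * conj s) / 8)
  have h3 := (((((hm.const_mul (-2)).mul hk).sub ((hm.pow 2).const_mul (s * conj s))).mul hw).mul
    (hu.mul hv)).add ((((hm.pow 2).mul hk).mul (c (conj s))).mul ((hu.pow 2).mul hv))
  refine (((h1.add h2).sub (h3.const_mul ((1 - s * conj s) ^ 2 / 4))).congr
    fun w => ?_).congr_deriv ?_ ?_
  · simp only [greenS]; ring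
  · simp only [greenSz]
    clear h1 h2 h3 hm hk hu hv c hw hz
    generalize conj z = w at *
    generalize conj s = t at *
    push_cast
    simp only [div_eq_mul_inv, ← inv_pow, pow_one]
    generalize (1 - z * t)⁻¹ = u at *
    generalize (1 - w * s)⁻¹ = v at *
    ring
  · clear h1 h2 h3 hm hk hu hv c hw hz
    generalize conj z = w at *
    generalize conj s = t at *
    push_cast
    simp only [pow_one]
    obtain ⟨P, hP⟩ : ∃ P, P = 1 - z * t := ⟨_, rfl⟩
    obtain ⟨Q, hQ⟩ : ∃ Q, Q = 1 - w * s := ⟨_, rfl⟩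
    rw [← hP] at hb
    rw [← hQ] at hb'
    simp only [← hP, ← hQ]
    field_simp
    rw [hP, hQ]
    ring

lemma hasWirt_weightedGreen (hz : z ≠ s) (hb : 1 - z * conj s ≠ 0) :
    HasWirt (fun z => (weightedGreen s z : ℂ)) (weightedGreenDz s z)
      (conj (weightedGreenDz s z)) z := by
  suffices h : ∃ q, HasWirt (fun z => (weightedGreen s z : ℂ)) (weightedGreenDz s z) q z by
    obtain ⟨q, h⟩ := h
    rwa [h.conj_eq]
  have hb' := conj_one_sub_mul_conj_ne hb
  have hG := hasWirt_greenLog hz hb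
  have hZ := HasWirt.id z
  have hw := HasWirt.conj_id z
  have c := fun a => HasWirt.const a z
  have hu := ((c 1).sub (hZ.mul (c (conj s)))).inv hb
  have hv := ((c 1).sub (hw.mul (c s))).inv hb'
  have hc := (c 1).sub (((hZ.add (c s)).mul (hw.add (c (conj s)))).mul (c (1 / 4)))
  have ha := (hZ.sub (c s)).mul (hw.sub (c (conj s)))
  have hd := ((c 1).sub (hZ.mul hw)).const_mul (1 - s * conj s)
  have h1 := hc.mul (((ha.mul hG).add hd).sub (((hd.pow 2).mul (hu.mul hv)).const_mul (1 / 2)))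
  have h2 := ((hd.pow 3).mul (hu.mul hv)).const_mul (1 / 8)
  refine ⟨_, ((h1.add h2).congr fun w => ?_).congr_deriv ?_ rfl⟩
  · simp only [weightedGreen]
    push_cast
    simp only [← mul_conj, map_sub, map_add, map_mul, map_one, conj_conj, div_eq_mul_inv, mul_inv]
    ring
  · simp only [weightedGreenDz, greenS]
    clear h1 h2 hd ha hc hu hv c hw hZ hG
    have hz' : z - s ≠ 0 := sub_ne_zero.2 hz
    generalize (greenLog s z : ℂ) = G at *
    generalize conj z = w at *
    generalize conj s = t at *
    push_cast
    simp only [pow_one]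
    obtain ⟨P, hP⟩ : ∃ P, P = 1 - z * t := ⟨_, rfl⟩
    obtain ⟨Q, hQ⟩ : ∃ Q, Q = 1 - w * s := ⟨_, rfl⟩
    obtain ⟨D, hD⟩ : ∃ D, D = z - s := ⟨_, rfl⟩
    rw [← hP] at hb
    rw [← hQ] at hb'
    rw [← hD] at hz'
    simp only [← hP, ← hQ, ← hD]
    field_simp
    rw [hP, hQ, hD]
    ring

lemma hasWirt_weightedGreenDz (hz : z ≠ s) (hb : 1 - z * conj s ≠ 0) :
    HasWirt (weightedGreenDz s) (weightedGreenDzz s z)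
      (((1 - normSq z) * (greenLog s z + (greenHol s z).re) : ℝ) : ℂ) z := by
  have hb' := conj_one_sub_mul_conj_ne hb
  have hG := hasWirt_greenLog hz hb
  have hS := hasWirt_greenS hb
  have hZ := HasWirt.id z
  have hw := HasWirt.conj_id z
  have c := fun a => HasWirt.const a z
  have hA := (hw.sub (c (conj s))).mul ((c 1).sub ((hZ.mul (hw.add (c (conj s)))).mul (c (1 / 2))))
  refine (((hG.mul hA).add hS).congr fun w => ?_).congr_deriv ?_ ?_
  · simp only [weightedGreenDz]; ring
  · simp only [weightedGreenDzz]; ring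
  · have hz' : conj z - conj s ≠ 0 := by
      rw [← map_sub]; exact (map_ne_zero _).2 (sub_ne_zero.2 hz)
    push_cast
    rw [re_eq_add_conj, ← mul_conj]
    simp only [greenHol, map_add, map_sub, map_mul, map_pow, map_inv₀, map_one, conj_conj, map_div₀,
      map_ofNat]
    clear hA c hw hZ hS hG
    generalize (greenLog s z : ℂ) = G at *
    generalize conj z = w at *
    generalize conj s = t at *
    obtain ⟨P, hP⟩ : ∃ P, P = 1 - z * t := ⟨_, rfl⟩
    obtain ⟨Q, hQ⟩ : ∃ Q, Q = 1 - w * s := ⟨_, rfl⟩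
    obtain ⟨D, hD⟩ : ∃ D, D = w - t := ⟨_, rfl⟩
    rw [← hP] at hb
    rw [← hQ] at hb'
    rw [← hD] at hz'
    simp only [← hP, ← hQ, ← hD]
    field_simp
    rw [hP, hQ, hD]
    ring

end WeightedGreen

lemma one_sub_mul_conj_ne_zero {s z : ℂ} (hs : ‖s‖ < 1) (hz : ‖z‖ ≤ 1) : 1 - z * conj s ≠ 0 := by
  intro h
  have h1 : z * conj s = 1 := (sub_eq_zero.1 h).symm
  have h2 : ‖z‖ * ‖s‖ = 1 := by simpa using congr(‖$h1‖)
  nlinarith [norm_nonneg s, norm_nonneg z]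

lemma normSq_one_sub_mul_conj (s z : ℂ) :
    normSq (1 - z * conj s) = normSq (z - s) + (1 - normSq z) * (1 - normSq s) := by
  simp [normSq_apply]; ring

lemma weightedGreen_eq_zero {s z : ℂ} (hz : ‖z‖ = 1) : weightedGreen s z = 0 := by
  have h1 : normSq z = 1 := by rw [normSq_eq_norm_sq, hz]; norm_num
  have h2 := normSq_one_sub_mul_conj s z
  rw [h1] at h2
  simp [weightedGreen, greenLog, h1, h2]

lemma weightedGreenDz_eq_zero {s z : ℂ} (hs : ‖s‖ < 1) (hz : ‖z‖ = 1) :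
    weightedGreenDz s z = 0 := by
  have h1 : normSq z = 1 := by rw [normSq_eq_norm_sq, hz]; norm_num
  have h2 := normSq_one_sub_mul_conj s z
  rw [h1] at h2
  have h3 : z * conj z = 1 := by rw [mul_conj, h1]; simp
  have hb := one_sub_mul_conj_ne_zero hs hz.le
  have hb' := conj_one_sub_mul_conj_ne hb
  have hG : greenLog s z = 0 := by simp [greenLog, h2]
  simp only [weightedGreenDz, greenS, hG]
  have hw : conj z = z⁻¹ := eq_inv_of_mul_eq_one_right h3
  have hz0 : z ≠ 0 := by rintro rfl; simp at hz
  rw [hw] at hb' ⊢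
  generalize conj s = t at *
  simp only [mul_inv_cancel₀ hz0]
  have h4 : z - s ≠ 0 := by
    intro h; apply hb'; rw [← sub_eq_zero.1 h]; simp [hz0]
  have hv : (1 - z⁻¹ * s)⁻¹ = z * (z - s)⁻¹ := by field_simp
  rw [hv]
  obtain ⟨P, hP⟩ : ∃ P, P = 1 - z * t := ⟨_, rfl⟩
  obtain ⟨D, hD⟩ : ∃ D, D = z - s := ⟨_, rfl⟩
  rw [← hP] at hb
  rw [← hD] at h4
  simp only [← hP, ← hD]
  field_simp
  rw [hP, hD]
  push_cast
  ring

lemma weightedGreenDzz_eq_zero {s z : ℂ} (hs : ‖s‖ < 1) (hz : ‖z‖ = 1) :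
    weightedGreenDzz s z = 0 := by
  have h1 : normSq z = 1 := by rw [normSq_eq_norm_sq, hz]; norm_num
  have h2 := normSq_one_sub_mul_conj s z
  rw [h1] at h2
  have h3 : z * conj z = 1 := by rw [mul_conj, h1]; simp
  have hb := one_sub_mul_conj_ne_zero hs hz.le
  have hb' := conj_one_sub_mul_conj_ne hb
  have hG : greenLog s z = 0 := by simp [greenLog, h2]
  simp only [weightedGreenDzz, greenSz, hG]
  have hw : conj z = z⁻¹ := eq_inv_of_mul_eq_one_right h3
  have hz0 : z ≠ 0 := by rintro rfl; simp at hz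
  rw [hw] at hb' ⊢
  generalize conj s = t at *
  simp only [mul_inv_cancel₀ hz0]
  have h4 : z - s ≠ 0 := by
    intro h; apply hb'; rw [← sub_eq_zero.1 h]; simp [hz0]
  have hv : (1 - z⁻¹ * s)⁻¹ = z * (z - s)⁻¹ := by field_simp
  rw [hv]
  obtain ⟨P, hP⟩ : ∃ P, P = 1 - z * t := ⟨_, rfl⟩
  obtain ⟨D, hD⟩ : ∃ D, D = z - s := ⟨_, rfl⟩
  rw [← hP] at hb
  rw [← hD] at h4
  simp only [← hP, ← hD]
  field_simp
  rw [hP, hD]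
  push_cast
  ring

lemma two_mul_log_ge {x : ℝ} (h0 : 0 < x) (h1 : x ≤ 1) : x ^ 2 - 1 ≤ 2 * (x * Real.log x) := by
  have hy : 0 ≤ Real.log x⁻¹ := Real.log_nonneg ((one_le_inv₀ h0).2 h1)
  have h := Real.self_le_sinh_iff.2 hy
  rw [Real.sinh_log (inv_pos.2 h0), inv_inv, Real.log_inv] at h
  have h2 := mul_le_mul_of_nonneg_left h h0.le
  have h3 : x * ((x⁻¹ - x) / 2) = (1 - x ^ 2) / 2 := by field_simp
  linarith

lemma weightedGreen_nonneg {s z : ℂ} (hs : ‖s‖ < 1) (hz : ‖z‖ < 1) : 0 ≤ weightedGreen s z := by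
  have hb := one_sub_mul_conj_ne_zero hs hz.le
  have hab := normSq_one_sub_mul_conj s z
  have hc : 0 ≤ 1 - normSq (z + s) / 4 := by
    have : normSq (z + s) ≤ 2 ^ 2 := by
      rw [normSq_eq_norm_sq]
      have := norm_add_le z s
      gcongr; linarith
    linarith
  have hm : 0 < 1 - normSq z := by rw [normSq_eq_norm_sq]; nlinarith [norm_nonneg z]
  have he : 0 < 1 - normSq s := by rw [normSq_eq_norm_sq]; nlinarith [norm_nonneg s]
  have hd : 0 < (1 - normSq z) * (1 - normSq s) := mul_pos hm he
  have ha : 0 ≤ normSq (z - s) := normSq_nonneg _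
  simp only [weightedGreen, greenLog]
  generalize normSq (1 - z * conj s) = b at *
  generalize normSq (z - s) = a at *
  generalize (1 - normSq z) * (1 - normSq s) = d at *
  have hb0 : 0 < b := by linarith
  refine add_nonneg (mul_nonneg hc ?_) (by positivity)
  have key : a ^ 2 - b ^ 2 ≤ 2 * b * (a * (Real.log a - Real.log b)) := by
    rcases ha.eq_or_lt with rfl | ha
    · simp; positivity
    · have := two_mul_log_ge (x := a / b) (by positivity) (by rw [div_le_one hb0]; linarith)
      rw [Real.log_div ha.ne' hb0.ne'] at this
      have h2 := mul_le_mul_of_nonneg_left this (sq_nonneg b)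
      have e1 : b ^ 2 * ((a / b) ^ 2 - 1) = a ^ 2 - b ^ 2 := by field_simp
      have e2 : b ^ 2 * (2 * (a / b * (Real.log a - Real.log b)))
        = 2 * b * (a * (Real.log a - Real.log b)) := by field_simp
      linarith
  have : d = b - a := by linarith
  subst this
  have e : a * (Real.log a - Real.log b) + (b - a) - (b - a) ^ 2 / (2 * b)
    = (2 * b * (a * (Real.log a - Real.log b)) - (a ^ 2 - b ^ 2)) / (2 * b) := by
    field_simp; ring
  rw [e]
  exact div_nonneg (by linarith) (by positivity)

lemma continuousAt_greenLog_sub {s : ℂ} (hs : ‖s‖ < 1) :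
    ContinuousAt (fun z => Real.log (normSq (1 - z * conj s))) s := by
  have hb := one_sub_mul_conj_ne_zero hs hs.le
  refine ContinuousAt.log ?_ (by simpa using hb)
  exact (continuous_normSq.comp (by fun_prop)).continuousAt

lemma continuousAt_conj_mul_log_normSq :
    ContinuousAt (fun z => conj z * (Real.log (normSq z) : ℂ)) 0 := by
  have h : ContinuousAt (fun z : ℂ => 2 * (‖z‖ * Real.log ‖z‖)) 0 :=
    ((Real.continuous_mul_log.comp continuous_norm).const_mul 2).continuousAt
  unfold ContinuousAt at h ⊢
  simp only [map_zero, zero_mul, norm_zero, mul_zero] at h ⊢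
  rw [tendsto_zero_iff_norm_tendsto_zero] at h ⊢
  refine h.congr fun z => ?_
  rw [normSq_eq_norm_sq, Real.log_pow]
  simp
  ring

lemma continuousAt_weightedGreenDz {s : ℂ} (hs : ‖s‖ < 1) :
    ContinuousAt (weightedGreenDz s) s := by
  have hb := one_sub_mul_conj_ne_zero hs hs.le
  have h1 : ContinuousAt (fun z => conj (z - s) * (Real.log (normSq (z - s)) : ℂ)) s := by
    have := continuousAt_conj_mul_log_normSq
    rw [← sub_self s] at this
    exact this.comp (f := fun z => z - s) (by fun_prop)
  have h2 : ContinuousAt (fun z => ((Real.log (normSq (1 - z * conj s)) : ℝ) : ℂ)) s :=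
    continuous_ofReal.continuousAt.comp (continuousAt_greenLog_sub hs)
  have h3 := ((h1.sub (h2.mul (f := _) (g := fun z => conj z - conj s) (by fun_prop))).mul (f := _)
    (g := fun z => 1 - z * (conj z + conj s) / 2) (by fun_prop)).add
    (hasWirt_greenS hb).continuousAt
  refine h3.congr (.of_forall fun z => ?_)
  simp [weightedGreenDz, greenLog]
  ring

lemma continuousAt_weightedGreen {s : ℂ} (hs : ‖s‖ < 1) :
    ContinuousAt (weightedGreen s) s := by
  have hb := one_sub_mul_conj_ne_zero hs hs.le
  have hn : Continuous normSq := continuous_normSq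
  have h1 : ContinuousAt (fun z => normSq (z - s) * Real.log (normSq (z - s))) s :=
    (Real.continuous_mul_log.comp (hn.comp (continuous_id.sub continuous_const))).continuousAt
  have h2 := continuousAt_greenLog_sub hs
  have ha : Continuous fun z => normSq (z - s) := hn.comp (by fun_prop)
  have hp : Continuous fun z => normSq (z + s) := hn.comp (by fun_prop)
  have hb' : Continuous fun z => normSq (1 - z * conj s) := hn.comp (by fun_prop)
  have hb0 : normSq (1 - s * conj s) ≠ 0 := by simpa using hb
  have e : weightedGreen s = fun z => (1 - normSq (z + s) / 4)
      * (normSq (z - s) * Real.log (normSq (z - s))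
        - normSq (z - s) * Real.log (normSq (1 - z * conj s))
      + (1 - normSq z) * (1 - normSq s)
      - ((1 - normSq z) * (1 - normSq s)) ^ 2 / (2 * normSq (1 - z * conj s)))
    + ((1 - normSq z) * (1 - normSq s)) ^ 3 / (8 * normSq (1 - z * conj s)) := by
    ext z; simp only [weightedGreen, greenLog]; ring
  rw [e]
  have key : ∀ p l k b n : ℂ → ℝ, ContinuousAt p s → ContinuousAt l s → ContinuousAt k s →
      ContinuousAt b s → ContinuousAt n s → b s ≠ 0 →
      ContinuousAt (fun z => (1 - p z / 4) * (l z - k z + (1 - n z) * (1 - normSq s)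
        - ((1 - n z) * (1 - normSq s)) ^ 2 / (2 * b z))
        + ((1 - n z) * (1 - normSq s)) ^ 3 / (8 * b z)) s := by
    intro p l k b n hp hl hk hb hn h0
    fun_prop (disch := simp [h0])
  exact key _ _ _ _ _ hp.continuousAt h1 (ha.continuousAt.mul h2) hb'.continuousAt
    hn.continuousAt hb0

lemma continuousOn_log_normSq_one_sub {s : ℂ} (hs : ‖s‖ < 1) :
    ContinuousOn (fun z => Real.log (normSq (1 - z * conj s))) (closedBall 0 1) := by
  refine ContinuousOn.log ?_ fun z hz => ?_
  · exact (continuous_normSq.comp (by fun_prop)).continuousOn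
  · simpa using one_sub_mul_conj_ne_zero hs (by simpa using hz)

lemma integrableOn_log_normSq_sub_mul (s : ℂ) {φ : ℂ → ℝ}
    (hφ : ContinuousOn φ (closedBall 0 1)) :
    IntegrableOn (fun z => Real.log (normSq (z - s)) * φ z) (ball 0 1) := by
  have h := (integrableOn_log_normSq_sub s 2).mono_set
    (closedBall_subset_ball (x := (0 : ℂ)) (by norm_num : (1 : ℝ) < 2))
  exact (h.mul_continuousOn hφ (isCompact_closedBall _ _)).mono_set ball_subset_closedBall

lemma integrableOn_ball_of_continuousOn {E : Type*} [NormedAddCommGroup E] {φ : ℂ → E}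
    (hφ : ContinuousOn φ (closedBall 0 1)) : IntegrableOn φ (ball 0 1) :=
  (hφ.integrableOn_compact (isCompact_closedBall _ _)).mono_set ball_subset_closedBall

lemma continuousOn_greenHol {s : ℂ} (hs : ‖s‖ < 1) :
    ContinuousOn (greenHol s) (closedBall 0 1) := by
  have h : ContinuousOn (fun z => (1 - z * conj s)⁻¹) (closedBall 0 1) :=
    ContinuousOn.inv₀ (by fun_prop) fun z hz => one_sub_mul_conj_ne_zero hs (by simpa using hz)
  unfold greenHol
  fun_prop

lemma integrableOn_greenLog_add_greenHol_mul {s : ℂ} (hs : ‖s‖ < 1) {φ : ℂ → ℝ}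
    (hφ : ContinuousOn φ (closedBall 0 1)) :
    IntegrableOn (fun z => (greenLog s z + (greenHol s z).re) * φ z) (ball 0 1) := by
  have h1 := integrableOn_log_normSq_sub_mul s hφ
  have h2 := integrableOn_ball_of_continuousOn
    (((continuousOn_log_normSq_one_sub hs).sub
      (continuous_re.comp_continuousOn (continuousOn_greenHol hs))).mul hφ)
  refine (h1.sub h2).congr_fun (fun z _ => ?_) measurableSet_ball
  simp [greenLog]
  ring

lemma continuousOn_weightedGreen {s : ℂ} (hs : ‖s‖ < 1) :
    ContinuousOn (weightedGreen s) (closedBall 0 1) := by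
  intro z hz
  refine ContinuousAt.continuousWithinAt ?_
  rcases eq_or_ne z s with rfl | h
  · exact continuousAt_weightedGreen hs
  · have := (hasWirt_weightedGreen h (one_sub_mul_conj_ne_zero hs (by simpa using hz))).continuousAt
    exact continuous_re.continuousAt.comp this

lemma continuousOn_weightedGreenDz {s : ℂ} (hs : ‖s‖ < 1) :
    ContinuousOn (weightedGreenDz s) (closedBall 0 1) := by
  intro z hz
  refine ContinuousAt.continuousWithinAt ?_
  rcases eq_or_ne z s with rfl | h
  · exact continuousAt_weightedGreenDz hs
  · exact (hasWirt_weightedGreenDz h (one_sub_mul_conj_ne_zero hs (by simpa using hz))).continuousAt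

lemma setIntegral_weightedGreen_mul_lap {s : ℂ} (hs : ‖s‖ < 1) {K : ℂ → ℝ}
    (hK : ContDiff ℝ (⊤ : ℕ∞) K) :
    ∫ z in ball (0 : ℂ) 1, weightedGreen s z * lap K z
      = ∫ z in ball (0 : ℂ) 1, (greenLog s z + (greenHol s z).re) * ((1 - normSq z) * K z) := by
  set k : ℂ → ℂ := fun z => (K z : ℂ)
  have hk : ContDiff ℝ (⊤ : ℕ∞) k := contDiff_ofReal_comp hK
  have hn : Continuous normSq := continuous_normSq
  have hΓ : ContinuousOn (fun z => (weightedGreen s z : ℂ)) (closedBall 0 1) :=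
    continuous_ofReal.comp_continuousOn (continuousOn_weightedGreen hs)
  have hD := continuousOn_weightedGreenDz hs
  have hDc : ContinuousOn (fun z => conj (weightedGreenDz s z)) (closedBall 0 1) :=
    continuous_conj.comp_continuousOn hD
  have hdk := hk.dz.continuous.continuousOn (s := closedBall 0 1)
  have hdkc : ContinuousOn (fun z => conj (dz k z)) (closedBall 0 1) :=
    continuous_conj.comp_continuousOn hdk
  have hddk := hk.dz.dzb.continuous.continuousOn (s := closedBall 0 1)
  have hI := integrableOn_greenLog_add_greenHol_mul hs (φ := fun z => (1 - normSq z) * K z)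
    ((continuous_const.sub hn).mul hK.continuous).continuousOn
  have hint1 := integrableOn_ball_of_continuousOn
    (((hDc.mul hdk).add (hΓ.mul hddk)).sub (hdkc.mul hD))
  have hint : IntegrableOn (fun z => (conj (weightedGreenDz s z) * dz k z
      + weightedGreen s z * dzb (dz k) z) - (conj (dz k z) * weightedGreenDz s z
      + k z * (((1 - normSq z) * (greenLog s z + (greenHol s z).re) : ℝ) : ℂ))) (ball 0 1) := by
    refine (hint1.sub hI.ofReal).congr_fun (fun z _ => ?_) measurableSet_ball
    simp [k]
    ring
  have key := setIntegral_ball_dzb_eq_zero (s := {s})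
    (f := fun z => weightedGreen s z * dz k z - k z * weightedGreenDz s z)
    (p := fun z => (weightedGreenDz s z * dz k z + weightedGreen s z * dz (dz k) z)
      - (dz k z * weightedGreenDz s z + k z * weightedGreenDzz s z))
    (countable_singleton s) (by simpa using hs) ?_ ?_ ?_ hint
  · have h0 := congr(re $key)
    rw [← reCLM_apply, ← ContinuousLinearMap.integral_comp_comm _ hint] at h0
    rw [← sub_eq_zero, ← integral_sub _ hI]
    · refine Eq.trans (integral_congr_ae (.of_forall fun z => ?_)) h0
      simp only [reCLM_apply, ← re_dzb_dz_ofReal_comp hK]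
      simp [k]
      ring
    · exact integrableOn_ball_of_continuousOn
        ((continuousOn_weightedGreen hs).mul (continuous_lap hK).continuousOn)
  · intro z hz
    obtain rfl : z = s := hz
    have h1 : ContinuousAt (fun w => (weightedGreen z w : ℂ)) z :=
      continuous_ofReal.continuousAt.comp (continuousAt_weightedGreen hs)
    exact (h1.mul hk.dz.continuous.continuousAt).sub
      (hk.continuous.continuousAt.mul (continuousAt_weightedGreenDz hs))
  · intro z hz hzs
    have hb := one_sub_mul_conj_ne_zero hs (z := z) (by simpa using hz)
    exact ((hasWirt_weightedGreen hzs hb).mul (hasWirt_dz_ofReal_comp hK z)).sub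
      ((hasWirt_ofReal_comp hK z).mul (hasWirt_weightedGreenDz hzs hb))
  · intro z hz
    have hz1 : ‖z‖ = 1 := by simpa using hz
    have h1 : normSq z = 1 := by rw [normSq_eq_norm_sq, hz1]; norm_num
    simp [weightedGreen_eq_zero hz1, weightedGreenDz_eq_zero hs hz1,
      weightedGreenDzz_eq_zero hs hz1, h1]

lemma lap_congr {f g : ℂ → ℝ} {z : ℂ} (h : f =ᶠ[nhds z] g) : lap f z = lap g z := by
  simp only [lap]
  congr 2
  · rw [Filter.EventuallyEq.fderiv_eq]
    filter_upwards [h.fderiv (𝕜 := ℝ)] with w hw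
    rw [hw]
  · rw [Filter.EventuallyEq.fderiv_eq]
    filter_upwards [h.fderiv (𝕜 := ℝ)] with w hw
    rw [hw]

lemma lap_comp_smul (f : ℂ → ℝ) (ρ : ℝ) (z : ℂ) :
    lap (fun w => f (ρ • w)) z = ρ ^ 2 * lap f (ρ • z) := by
  have h : ∀ v z, fderiv ℝ (fun w => fderiv ℝ (fun w => f (ρ • w)) w v) z v
      = ρ ^ 2 * fderiv ℝ (fun w => fderiv ℝ f w v) (ρ • z) v := by
    intro v z
    have h1 : (fun w => fderiv ℝ (fun w => f (ρ • w)) w v)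
        = fun w => ρ • (fun w => fderiv ℝ f w v) (ρ • w) := by
      ext w
      rw [fderiv_comp_smul]
      rfl
    rw [h1]
    rw [show (fun w => ρ • (fun w => fderiv ℝ f w v) (ρ • w))
      = ρ • (fun w => (fun w => fderiv ℝ f w v) (ρ • w)) from rfl]
    rw [fderiv_const_smul_field, Pi.smul_apply,
      fderiv_comp_smul (f := fun w => fderiv ℝ f w v)]
    simp
    ring
  simp only [lap, h]
  ring

lemma exists_contDiff_extension {f : ℂ → ℝ} (hf : ContDiffOn ℝ (⊤ : ℕ∞) f (ball 0 1))
    (hl : ∀ z ∈ ball (0 : ℂ) 1, 0 ≤ lap f z) {ρ : ℝ} (h0 : 0 < ρ) (h1 : ρ < 1) :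
    ∃ K : ℂ → ℝ, ContDiff ℝ (⊤ : ℕ∞) K ∧ HasCompactSupport K ∧
      (∀ z ∈ closedBall (0 : ℂ) 1, K z = f (ρ • z)) ∧ ∀ z ∈ ball (0 : ℂ) 1, 0 ≤ lap K z := by
  have hρ : 1 < 1 / ρ := by rw [lt_div_iff₀ h0]; linarith
  let χ : ContDiffBump (0 : ℂ) := ⟨1, (1 + 1 / ρ) / 2, one_pos, by linarith⟩
  have hK1 : ∀ z ∈ closedBall (0 : ℂ) 1, χ z * f (ρ • z) = f (ρ • z) := fun z hz => by
    rw [χ.one_of_mem_closedBall hz, one_mul]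
  refine ⟨fun z => χ z * f (ρ • z), ?_, χ.hasCompactSupport.mul_right, hK1, ?_⟩
  · rw [contDiff_iff_contDiffAt]
    intro z
    rcases lt_or_ge ‖z‖ (1 / ρ) with h | h
    · have hm : ρ • z ∈ ball (0 : ℂ) 1 := by
        rw [lt_div_iff₀ h0] at h
        simpa [abs_of_pos h0, mul_comm] using h
      have hfz : ContDiffAt ℝ (⊤ : ℕ∞) f (ρ • z) := hf.contDiffAt (isOpen_ball.mem_nhds hm)
      exact χ.contDiffAt.mul (hfz.comp z (contDiffAt_id.const_smul ρ))
    · have hz : z ∉ tsupport χ := by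
        rw [χ.tsupport_eq]
        simp only [mem_closedBall, dist_zero_right, not_le]
        change (1 + 1 / ρ) / 2 < ‖z‖
        linarith
      refine (contDiffAt_const (c := (0 : ℝ))).congr_of_eventuallyEq ?_
      filter_upwards [notMem_tsupport_iff_eventuallyEq.1 hz] with w hw
      simp [hw]
  · intro z hz
    have e : (fun z => χ z * f (ρ • z)) =ᶠ[nhds z] fun z => f (ρ • z) := by
      filter_upwards [isOpen_ball.mem_nhds hz] with w hw
      exact hK1 w (ball_subset_closedBall hw)
    rw [lap_congr e, lap_comp_smul]
    refine mul_nonneg (sq_nonneg _) (hl _ ?_)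
    simp only [mem_ball, dist_zero_right, norm_smul, Real.norm_eq_abs, abs_of_pos h0] at hz ⊢
    nlinarith [norm_nonneg z]

lemma setIntegral_areaM (f : ℂ → ℝ) (s : Set ℂ) :
    ∫ z in s, f z ∂areaM = Real.pi⁻¹ * ∫ z in s, f z := by
  rw [areaM, Measure.restrict_smul, integral_smul_measure, ENNReal.toReal_inv,
    ENNReal.toReal_ofReal Real.pi_pos.le, smul_eq_mul]

lemma setIntegral_ball_one_sub_normSq :
    ∫ z in ball (0 : ℂ) 1, (1 - normSq z) = Real.pi / 2 := by
  have h := integral_fun_norm_addHaar (volume : Measure ℂ)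
    (fun r => indicator (Iio (1 : ℝ)) (fun r => 1 - r ^ 2) r)
  rw [← integral_indicator measurableSet_ball]
  have e : (indicator (ball (0 : ℂ) 1) fun z => 1 - normSq z)
      = fun z => indicator (Iio (1 : ℝ)) (fun r => 1 - r ^ 2) ‖z‖ := by
    ext z
    by_cases hz : ‖z‖ < 1
    · rw [indicator_of_mem (by simpa using hz), indicator_of_mem (by simpa using hz),
        normSq_eq_norm_sq]
    · rw [indicator_of_notMem (by simpa using hz), indicator_of_notMem (by simpa using hz)]
  rw [e, h]
  have e2 : ∫ y in Ioi (0 : ℝ), y ^ (Module.finrank ℝ ℂ - 1) •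
      indicator (Iio (1 : ℝ)) (fun r => 1 - r ^ 2) y = ∫ y in (0 : ℝ)..1, (y - y ^ 3) := by
    rw [intervalIntegral.integral_of_le zero_le_one, integral_Ioc_eq_integral_Ioo,
      ← integral_indicator measurableSet_Ioi, ← integral_indicator measurableSet_Ioo]
    congr 1
    ext y
    simp only [indicator, mem_Ioi, mem_Iio, mem_Ioo, finrank_real_complex]
    split_ifs <;> first | (exfalso; tauto) | simp <;> ring
  rw [e2]
  simp [Measure.real]
  norm_num
  ring

lemma setIntegral_ball_mul_polynomial (P : Polynomial ℂ) :
    ∫ z in ball (0 : ℂ) 1, z * ((1 - normSq z : ℝ) : ℂ) * P.eval z = 0 := by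
  have hd : ∀ z ∈ closedBall (0 : ℂ) 1, z ∉ (∅ : Set ℂ) →
      HasWirt (fun z => (1 - z * conj z) ^ 2 * P.eval z)
        (-2 * (1 - z * conj z) * conj z * P.eval z
          + (1 - z * conj z) ^ 2 * (Polynomial.derivative P).eval z)
        (-2 * (z * ((1 - normSq z : ℝ) : ℂ) * P.eval z)) z := by
    intro z _ _
    have hP : HasWirt (fun z => P.eval z) ((Polynomial.derivative P).eval z) 0 z :=
      (P.hasDerivAt z).hasFDerivAt.restrictScalars ℝ |>.congr_fderiv <|
        ContinuousLinearMap.ext fun w => by simp [mul_comm]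
    refine ((((HasWirt.const 1 z).sub ((HasWirt.id z).mul (HasWirt.conj_id z))).pow 2).mul
      hP).congr_deriv ?_ ?_
    · simp
    · push_cast; rw [← mul_conj]; simp; ring
  have h := setIntegral_ball_dzb_eq_zero countable_empty (by simp) (by simp) hd ?_ ?_
  · rw [integral_const_mul] at h
    simpa using h
  · intro z hz
    have hz1 : ‖z‖ = 1 := by simpa using hz
    have h1 : normSq z = 1 := by rw [normSq_eq_norm_sq, hz1]; norm_num
    simp [mul_conj, h1]
  · apply integrableOn_ball_of_continuousOn
    have hn : Continuous normSq := continuous_normSq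
    have hP : Continuous fun z => P.eval z := P.continuous
    fun_prop

lemma setIntegral_ball_re_polynomial (p : Polynomial ℂ) :
    ∫ z in ball (0 : ℂ) 1, (p.eval z).re * (2 * (1 - normSq z)) = Real.pi * (p.eval 0).re := by
  have h := setIntegral_ball_mul_polynomial p.divX
  have hn : Continuous normSq := continuous_normSq
  have hi : IntegrableOn (fun z : ℂ => z * ((1 - normSq z : ℝ) : ℂ) * p.divX.eval z)
      (ball 0 1) := by
    apply integrableOn_ball_of_continuousOn
    have hP : Continuous fun z => p.divX.eval z := p.divX.continuous
    fun_prop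
  have h0 := congr(re $h)
  rw [← reCLM_apply, ← ContinuousLinearMap.integral_comp_comm _ hi] at h0
  have e : ∀ z, (p.eval z).re * (2 * (1 - normSq z))
      = 2 * reCLM (z * ((1 - normSq z : ℝ) : ℂ) * p.divX.eval z)
        + 2 * (p.eval 0).re * (1 - normSq z) := by
    intro z
    have : p.eval z = z * p.divX.eval z + p.eval 0 := by
      conv_lhs => rw [← p.divX_mul_X_add]
      simp [mul_comm, Polynomial.coeff_zero_eq_eval_zero]
    rw [this, mul_right_comm, reCLM_apply, re_mul_ofReal, add_re]
    ring
  simp only [e]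
  rw [integral_add ((reCLM.integrable_comp hi).const_mul 2), integral_const_mul, h0,
    integral_const_mul, setIntegral_ball_one_sub_normSq]
  · simp; ring
  · apply integrableOn_ball_of_continuousOn
    fun_prop

lemma exists_polynomial_norm_sub_lt {q : ℂ → ℂ} {R : ℝ} (hR : 1 < R)
    (hq : DifferentiableOn ℂ q (ball 0 R)) {ε : ℝ} (hε : 0 < ε) :
    ∃ p : Polynomial ℂ, ∀ z ∈ closedBall (0 : ℂ) 1, ‖q z - p.eval z‖ < ε := by
  obtain ⟨r, hr1, hrR⟩ := exists_between hR
  obtain ⟨r', hr1', hr'⟩ := exists_between hr1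
  lift r to NNReal using by linarith
  lift r' to NNReal using by linarith
  have h := (hq.mono (closedBall_subset_ball hrR)).hasFPowerSeriesOnBall (by
    have : (0 : ℝ) < r := by linarith
    exact_mod_cast this)
  have hu := h.tendstoUniformlyOn (r' := r') (by exact_mod_cast hr')
  rw [Metric.tendstoUniformlyOn_iff] at hu
  obtain ⟨n, hn⟩ := (hu ε hε).exists
  refine ⟨∑ k ∈ Finset.range n, Polynomial.C ((cauchyPowerSeries q 0 r).coeff k)
    * Polynomial.X ^ k, fun z hz => ?_⟩
  have := hn z (closedBall_subset_ball hr1' hz)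
  rw [dist_eq_norm, zero_add] at this
  rw [FormalMultilinearSeries.partialSum] at this
  rw [Polynomial.eval_finsetSum]
  refine lt_of_eq_of_lt (congrArg (‖q z - ·‖) (Finset.sum_congr rfl fun k _ => ?_)) this
  rw [Polynomial.eval_mul, Polynomial.eval_C, Polynomial.eval_pow, Polynomial.eval_X,
    FormalMultilinearSeries.apply_eq_pow_smul_coeff, smul_eq_mul, mul_comm]

/-- A continuous function on the closed disk which annihilates harmonic polynomials annihilates
the real parts of functions holomorphic on a larger disk. -/
lemma setIntegral_ball_re_mul_eq_zero {F : ℂ → ℝ} (hF : ContinuousOn F (closedBall 0 1))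
    (h : ∀ p : Polynomial ℂ, ∫ z in ball (0 : ℂ) 1, (p.eval z).re * F z = 0)
    {q : ℂ → ℂ} {R : ℝ} (hR : 1 < R) (hq : DifferentiableOn ℂ q (ball 0 R)) :
    ∫ z in ball (0 : ℂ) 1, (q z).re * F z = 0 := by
  have hqc : ContinuousOn (fun z => (q z).re) (closedBall 0 1) :=
    continuous_re.comp_continuousOn (hq.continuousOn.mono (closedBall_subset_ball hR))
  have hi : IntegrableOn (fun z => (q z).re * F z) (ball 0 1) :=
    integrableOn_ball_of_continuousOn (hqc.mul hF)
  have hFi := (integrableOn_ball_of_continuousOn hF).abs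
  have hle : ∀ ε > 0, |∫ z in ball (0 : ℂ) 1, (q z).re * F z|
      ≤ ε * ∫ z in ball (0 : ℂ) 1, |F z| := by
    intro ε hε
    obtain ⟨p, hp⟩ := exists_polynomial_norm_sub_lt hR hq hε
    have hpc : Continuous fun z => (p.eval z).re := continuous_re.comp p.continuous
    have hpi : IntegrableOn (fun z => (p.eval z).re * F z) (ball 0 1) :=
      integrableOn_ball_of_continuousOn (hpc.continuousOn.mul hF)
    rw [← sub_zero (∫ z in ball (0 : ℂ) 1, (q z).re * F z), ← h p, ← integral_sub hi hpi,
      ← integral_const_mul, ← Real.norm_eq_abs]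
    refine norm_integral_le_of_norm_le (hFi.const_mul ε) ?_
    filter_upwards [ae_restrict_mem measurableSet_ball] with z hz
    rw [← sub_mul, norm_mul, Real.norm_eq_abs, Real.norm_eq_abs, ← sub_re]
    gcongr
    exact (abs_re_le_norm _).trans (hp z (ball_subset_closedBall hz)).le
  have hpos : 0 ≤ ∫ z in ball (0 : ℂ) 1, |F z| := integral_nonneg fun z => abs_nonneg _
  have : |∫ z in ball (0 : ℂ) 1, (q z).re * F z| ≤ 0 := by
    refine le_of_forall_pos_le_add fun ε hε => ?_
    refine (hle (ε / (1 + ∫ z in ball (0 : ℂ) 1, |F z|)) (by positivity)).trans ?_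
    rw [zero_add, div_mul_eq_mul_div, div_le_iff₀ (by positivity)]
    nlinarith
  exact abs_eq_zero.1 (le_antisymm this (abs_nonneg _))

lemma setIntegral_ball_re_polynomial_mul_sub {ν : ℂ → ℝ} (hν : ContinuousOn ν (closedBall 0 1))
    (hrep : ∀ h : ℂ → ℝ, IsHarmonicPolynomial h →
      h 0 = ∫ z in ball (0:ℂ) 1, h z * ν z ∂areaM) (p : Polynomial ℂ) :
    ∫ z in ball (0 : ℂ) 1, (p.eval z).re * (ν z - 2 * (1 - normSq z)) = 0 := by
  have hpc : Continuous fun z => (p.eval z).re := continuous_re.comp p.continuous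
  have hn : Continuous normSq := continuous_normSq
  have h := hrep (fun z => (p.eval z).re)
    ⟨Polynomial.C (1 / 2) * p, Polynomial.C (1 / 2) * p, fun z => by
      simp [re_eq_add_conj, map_ofNat]; ring⟩
  rw [setIntegral_areaM, eq_inv_mul_iff_mul_eq₀ Real.pi_pos.ne'] at h
  simp only [mul_sub]
  rw [integral_sub, ← h, ← setIntegral_ball_re_polynomial]
  · simp [mul_sub]
  · exact integrableOn_ball_of_continuousOn (hpc.continuousOn.mul hν)
  · apply integrableOn_ball_of_continuousOn
    fun_prop

lemma log_normSq_eq_re (w : ℂ) : Real.log (normSq w) = (2 * Complex.log w).re := by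
  rw [normSq_eq_norm_sq, Real.log_pow, ← ofReal_ofNat, re_ofReal_mul, Complex.log_re]
  simp

lemma one_sub_mem_slitPlane {w : ℂ} (h : ‖w‖ < 1) : 1 - w ∈ slitPlane := by
  rw [sub_eq_add_neg]
  exact mem_slitPlane_of_norm_lt_one (by simpa using h)

lemma lap_sub_const (f : ℂ → ℝ) (c : ℝ) (z : ℂ) : lap (fun w => f w - c) z = lap f z := by
  simp only [lap, fderiv_sub_const]

lemma one_sub_normSq_smul_pos {ρ : ℝ} (h0 : 0 < ρ) (h1 : ρ < 1) {z : ℂ} (hz : ‖z‖ < 1) :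
    0 < 1 - normSq z ∧ 1 - normSq z ≤ 1 - normSq (ρ • z) := by
  simp only [normSq_eq_norm_sq, norm_smul, Real.norm_eq_abs, abs_of_pos h0]
  constructor
  · nlinarith [norm_nonneg z]
  · have : ρ * ‖z‖ ≤ ‖z‖ := by nlinarith [norm_nonneg z]
    have h2 : (ρ * ‖z‖) ^ 2 ≤ ‖z‖ ^ 2 := by gcongr
    linarith

section Potential

variable {ν : ℂ → ℝ}

lemma setIntegral_greenLog_mul_nonneg (hν : ContDiffOn ℝ (⊤ : ℕ∞) ν (closedBall (0:ℂ) 1))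
    (hsub : ∀ z ∈ ball (0:ℂ) 1, 0 ≤ lap (fun w => ν w / (1 - normSq w)) z) {s : ℂ}
    (hs : ‖s‖ < 1) :
    0 ≤ ∫ z in ball (0 : ℂ) 1, (greenLog s z + (greenHol s z).re) * (ν z - 2 * (1 - normSq z)) := by
  set f : ℂ → ℝ := fun w => ν w / (1 - normSq w) - 2 with hfdef
  have hn : Continuous normSq := continuous_normSq
  have hns : ContDiff ℝ (⊤ : ℕ∞) normSq := by
    have : (normSq : ℂ → ℝ) = fun z => ‖z‖ ^ 2 := funext normSq_eq_norm_sq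
    rw [this]
    exact contDiff_norm_sq ℝ
  have hf : ContDiffOn ℝ (⊤ : ℕ∞) f (ball 0 1) := by
    refine ((hν.mono ball_subset_closedBall).div (contDiff_const.sub hns).contDiffOn
      fun z hz => ?_).sub contDiffOn_const
    have hz' : ‖z‖ < 1 := by simpa using hz
    have := (one_sub_normSq_smul_pos (ρ := 1 / 2) (by norm_num) (by norm_num) hz').1
    exact this.ne'
  have hl : ∀ z ∈ ball (0 : ℂ) 1, 0 ≤ lap f z := fun z hz => by
    rw [hfdef, lap_sub_const]
    exact hsub z hz
  have hstep : ∀ ρ ∈ Ioo (0 : ℝ) 1,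
      IntegrableOn (fun z => (greenLog s z + (greenHol s z).re)
        * ((1 - normSq z) * f (ρ • z))) (ball 0 1) ∧
      0 ≤ ∫ z in ball (0 : ℂ) 1, (greenLog s z + (greenHol s z).re)
        * ((1 - normSq z) * f (ρ • z)) := by
    intro ρ hρ
    obtain ⟨K, hK, -, hKf, hKl⟩ := exists_contDiff_extension hf hl hρ.1 hρ.2
    have e : ∀ z ∈ ball (0 : ℂ) 1, (greenLog s z + (greenHol s z).re) * ((1 - normSq z) * K z)
        = (greenLog s z + (greenHol s z).re) * ((1 - normSq z) * f (ρ • z)) := fun z hz => by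
      rw [hKf z (ball_subset_closedBall hz)]
    constructor
    · refine (integrableOn_greenLog_add_greenHol_mul hs (φ := fun z => (1 - normSq z) * K z)
        ((continuous_const.sub hn).mul hK.continuous).continuousOn).congr_fun e measurableSet_ball
    · rw [← setIntegral_congr_fun measurableSet_ball e, ← setIntegral_weightedGreen_mul_lap hs hK]
      refine setIntegral_nonneg measurableSet_ball fun z hz => ?_
      exact mul_nonneg (weightedGreen_nonneg hs (by simpa using hz)) (hKl z hz)
  obtain ⟨M, hM⟩ := (isCompact_closedBall (0 : ℂ) 1).exists_bound_of_continuousOn hν.continuousOn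
  have hI := integrableOn_greenLog_add_greenHol_mul hs (φ := fun _ => M + 2) continuousOn_const
  have hev : ∀ᶠ ρ in nhdsWithin (1 : ℝ) (Iio 1), ρ ∈ Ioo (0 : ℝ) 1 := Ioo_mem_nhdsLT zero_lt_one
  refine ge_of_tendsto (tendsto_integral_filter_of_dominated_convergence
    (l := nhdsWithin (1 : ℝ) (Iio 1))
    (F := fun ρ z => (greenLog s z + (greenHol s z).re) * ((1 - normSq z) * f (ρ • z)))
    _ ?_ ?_ hI.norm ?_) ?_
  · filter_upwards [hev] with ρ hρ
    exact (hstep ρ hρ).1.aestronglyMeasurable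
  · filter_upwards [hev] with ρ hρ
    filter_upwards [ae_restrict_mem measurableSet_ball] with z hz
    have hz' : ‖z‖ < 1 := by simpa using hz
    obtain ⟨h1, h2⟩ := one_sub_normSq_smul_pos hρ.1 hρ.2 hz'
    rw [norm_mul (greenLog s z + _), norm_mul (greenLog s z + _)]
    refine mul_le_mul_of_nonneg_left ?_ (norm_nonneg (greenLog s z + (greenHol s z).re))
    have hνz : |ν (ρ • z)| ≤ M := hM _ (by
      simp only [mem_closedBall, dist_zero_right, norm_smul, Real.norm_eq_abs, abs_of_pos hρ.1]
      nlinarith [norm_nonneg z, hρ.1, hρ.2])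
    have e : (1 - normSq z) * f (ρ • z)
        = (1 - normSq z) / (1 - normSq (ρ • z)) * ν (ρ • z) - 2 * (1 - normSq z) := by
      simp only [hfdef]; ring
    have hq : (1 - normSq z) / (1 - normSq (ρ • z)) ≤ 1 := by
      rw [div_le_one (by linarith)]; exact h2
    have hq0 : 0 ≤ (1 - normSq z) / (1 - normSq (ρ • z)) := div_nonneg h1.le (by linarith)
    have h3 : |(1 - normSq z) / (1 - normSq (ρ • z)) * ν (ρ • z)| ≤ 1 * M := by
      rw [abs_mul, abs_of_nonneg hq0]
      exact mul_le_mul hq hνz (abs_nonneg _) zero_le_one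
    have h4 : |2 * (1 - normSq z)| ≤ 2 := by
      rw [abs_of_nonneg (by linarith)]
      linarith [normSq_nonneg z]
    rw [e, Real.norm_eq_abs, Real.norm_eq_abs]
    calc _ ≤ _ := abs_sub _ _
      _ ≤ M + 2 := by linarith
      _ ≤ _ := le_abs_self _
  · filter_upwards [ae_restrict_mem measurableSet_ball] with z hz
    have hz' : ‖z‖ < 1 := by simpa using hz
    have hm := (one_sub_normSq_smul_pos (ρ := 1 / 2) (by norm_num) (by norm_num) hz').1
    have hc : ContinuousAt (fun ρ : ℝ => (greenLog s z + (greenHol s z).re)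
        * ((1 - normSq z) * f (ρ • z))) 1 := by
      have hfc : ContinuousAt f ((1 : ℝ) • z) := by
        rw [one_smul]
        exact hf.continuousOn.continuousAt (isOpen_ball.mem_nhds hz)
      have : ContinuousAt (fun ρ : ℝ => f (ρ • z)) 1 :=
        ContinuousAt.comp (g := f) (f := fun ρ : ℝ => ρ • z) hfc (by fun_prop)
      fun_prop
    have := hc.tendsto.mono_left (nhdsWithin_le_nhds (s := Iio 1))
    convert this using 2
    simp only [one_smul, hfdef]
    field_simp
  · filter_upwards [hev] with ρ hρ
    exact (hstep ρ hρ).2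

lemma setIntegral_log_mul_nonneg (hν : ContDiffOn ℝ (⊤ : ℕ∞) ν (closedBall (0:ℂ) 1))
    (hsub : ∀ z ∈ ball (0:ℂ) 1, 0 ≤ lap (fun w => ν w / (1 - normSq w)) z)
    (hrep : ∀ h : ℂ → ℝ, IsHarmonicPolynomial h →
      h 0 = ∫ z in ball (0:ℂ) 1, h z * ν z ∂areaM) {s : ℂ} (hs : ‖s‖ < 1) :
    0 ≤ ∫ z in ball (0 : ℂ) 1, Real.log (normSq (z - s)) * (ν z - 2 * (1 - normSq z)) := by
  have hn : Continuous normSq := continuous_normSq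
  have hF : ContinuousOn (fun z => ν z - 2 * (1 - normSq z)) (closedBall 0 1) :=
    hν.continuousOn.sub (by fun_prop)
  have h1 := setIntegral_greenLog_mul_nonneg hν hsub hs
  have hlt : ∀ z ∈ ball (0 : ℂ) (2 / (1 + ‖s‖)), ‖z * conj s‖ < 1 := fun z hz => by
    have hs0 := norm_nonneg s
    rw [mem_ball, dist_zero_right, lt_div_iff₀ (by positivity)] at hz
    rw [norm_mul, norm_conj]
    nlinarith [norm_nonneg z]
  have hR : 1 < 2 / (1 + ‖s‖) := by
    rw [lt_div_iff₀ (by positivity)]; linarith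
  have hq : DifferentiableOn ℂ (fun z => 2 * Complex.log (1 - z * conj s) - greenHol s z)
      (ball 0 (2 / (1 + ‖s‖))) := by
    have hne : ∀ z ∈ ball (0 : ℂ) (2 / (1 + ‖s‖)), 1 - z * conj s ≠ 0 := fun z hz =>
      slitPlane_ne_zero (one_sub_mem_slitPlane (hlt z hz))
    have hd : DifferentiableOn ℂ (fun z => 1 - z * conj s) (ball 0 (2 / (1 + ‖s‖))) := by fun_prop
    have hinv := hd.inv hne
    have hlog := hd.clog fun z hz => one_sub_mem_slitPlane (hlt z hz)
    unfold greenHol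
    fun_prop
  have h2 := setIntegral_ball_re_mul_eq_zero hF
    (setIntegral_ball_re_polynomial_mul_sub hν.continuousOn hrep) hR hq
  have hi1 := integrableOn_greenLog_add_greenHol_mul hs hF
  have hi2 : IntegrableOn (fun z => (2 * Complex.log (1 - z * conj s) - greenHol s z).re
      * (ν z - 2 * (1 - normSq z))) (ball 0 1) :=
    integrableOn_ball_of_continuousOn ((continuous_re.comp_continuousOn
      (hq.continuousOn.mono (closedBall_subset_ball hR))).mul hF)
  have h3 := add_nonneg h1 h2.ge
  rw [← integral_add hi1 hi2] at h3
  refine h3.trans_eq (integral_congr_ae (.of_forall fun z => ?_))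
  simp only [greenLog, log_normSq_eq_re (1 - z * conj s), sub_re]
  ring

lemma setIntegral_log_mul_eq_zero (hν : ContDiffOn ℝ (⊤ : ℕ∞) ν (closedBall (0:ℂ) 1))
    (hrep : ∀ h : ℂ → ℝ, IsHarmonicPolynomial h →
      h 0 = ∫ z in ball (0:ℂ) 1, h z * ν z ∂areaM) {s : ℂ} (hs : 1 < ‖s‖) :
    ∫ z in ball (0 : ℂ) 1, Real.log (normSq (z - s)) * (ν z - 2 * (1 - normSq z)) = 0 := by
  have hn : Continuous normSq := continuous_normSq
  have hF : ContinuousOn (fun z => ν z - 2 * (1 - normSq z)) (closedBall 0 1) :=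
    hν.continuousOn.sub (by fun_prop)
  have hs0 : 0 < ‖s‖ := by linarith
  have hmem : ∀ z ∈ ball (0 : ℂ) ‖s‖, 1 - z / s ∈ slitPlane := fun z hz => by
    refine one_sub_mem_slitPlane ?_
    rw [norm_div, div_lt_one hs0]
    simpa using hz
  have hq : DifferentiableOn ℂ (fun z => 2 * Complex.log (1 - z / s) + Real.log (normSq s))
      (ball 0 ‖s‖) := by
    have hd : DifferentiableOn ℂ (fun z => 1 - z / s) (ball 0 ‖s‖) := by fun_prop
    have hlog := hd.clog hmem
    fun_prop
  rw [← setIntegral_ball_re_mul_eq_zero hF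
    (setIntegral_ball_re_polynomial_mul_sub hν.continuousOn hrep) hs hq]
  refine setIntegral_congr_fun measurableSet_ball fun z hz => ?_
  have hz' : z ∈ ball (0 : ℂ) ‖s‖ := ball_subset_ball hs.le hz
  have hs1 : s ≠ 0 := norm_pos_iff.1 hs0
  have e : z - s = -s * (1 - z / s) := by field_simp; ring
  rw [e, normSq_mul, normSq_neg, Real.log_mul (by simpa using hs1)
    (by simpa using slitPlane_ne_zero (hmem z hz')), log_normSq_eq_re (1 - z / s), add_re,
    ofReal_re]
  ring

lemma integrable_log_normSq_sub_mul_lap_mul {K F : ℂ → ℝ} (hK : ContDiff ℝ (⊤ : ℕ∞) K)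
    (hc : HasCompactSupport K) (hF : ContinuousOn F (closedBall 0 1)) :
    Integrable (Function.uncurry fun z s =>
      Real.log (normSq (z - s)) * lap K s * indicator (ball 0 1) F z) (volume.prod volume) := by
  have hlc : HasCompactSupport (lap K) := hc.mono' (subset_closure.trans (tsupport_lap_subset hK))
  obtain ⟨T, hT⟩ := hlc.isCompact.isBounded.subset_ball 0
  have hg := (integrable_indicator_iff (measurableSet_ball (x := (0 : ℂ)) (ε := T + 1))).2
    (integrableOn_log_normSq (T + 1))
  have hl : Integrable (lap K) := (continuous_lap hK).integrable_of_hasCompactSupport hlc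
  have hconv := Integrable.convolution_integrand (ContinuousLinearMap.mul ℝ ℝ) hl hg
  obtain ⟨M, hM⟩ := (isCompact_closedBall (0 : ℂ) 1).exists_bound_of_continuousOn hF
  have hFm : AEStronglyMeasurable (indicator (ball 0 1) F) volume :=
    ((integrable_indicator_iff measurableSet_ball).2
      (integrableOn_ball_of_continuousOn hF)).aestronglyMeasurable
  have hFm' : AEStronglyMeasurable (fun p : ℂ × ℂ => indicator (ball 0 1) F p.1)
    (volume.prod volume) := hFm.comp_fst
  refine (hconv.bdd_mul (c := |M|) hFm' (.of_forall fun p => ?_)).congr (.of_forall fun p => ?_)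
  · by_cases hp : p.1 ∈ ball (0 : ℂ) 1
    · rw [indicator_of_mem hp]
      exact (hM _ (ball_subset_closedBall hp)).trans (le_abs_self M)
    · rw [indicator_of_notMem hp]; simp
  · obtain ⟨z, s⟩ := p
    simp only [Function.uncurry_apply_pair, ContinuousLinearMap.mul_apply']
    by_cases hz : z ∈ ball (0 : ℂ) 1
    · by_cases hs : s ∈ tsupport (lap K)
      · have hs' := hT hs
        have : z - s ∈ ball (0 : ℂ) (T + 1) := by
          simp only [mem_ball, dist_zero_right] at hz hs' ⊢
          have := norm_sub_le z s
          linarith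
        rw [indicator_of_mem this]
        ring
      · rw [image_eq_zero_of_notMem_tsupport hs]; simp
    · rw [indicator_of_notMem hz]; simp

lemma setIntegral_mul_sub_nonneg (hν : ContDiffOn ℝ (⊤ : ℕ∞) ν (closedBall (0:ℂ) 1))
    (hsub : ∀ z ∈ ball (0:ℂ) 1, 0 ≤ lap (fun w => ν w / (1 - normSq w)) z)
    (hrep : ∀ h : ℂ → ℝ, IsHarmonicPolynomial h →
      h 0 = ∫ z in ball (0:ℂ) 1, h z * ν z ∂areaM) {K : ℂ → ℝ} (hK : ContDiff ℝ (⊤ : ℕ∞) K)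
    (hc : HasCompactSupport K) (hl : ∀ z ∈ ball (0 : ℂ) 1, 0 ≤ lap K z) :
    0 ≤ ∫ z in ball (0 : ℂ) 1, K z * (ν z - 2 * (1 - normSq z)) := by
  have hn : Continuous normSq := continuous_normSq
  have hF : ContinuousOn (fun z => ν z - 2 * (1 - normSq z)) (closedBall 0 1) :=
    hν.continuousOn.sub (by fun_prop)
  refine nonneg_of_mul_nonneg_right (a := logConst) ?_ logConst_pos
  have e1 : logConst * ∫ z in ball (0 : ℂ) 1, K z * (ν z - 2 * (1 - normSq z))
      = ∫ z, ∫ s, Real.log (normSq (z - s)) * lap K s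
        * indicator (ball 0 1) (fun z => ν z - 2 * (1 - normSq z)) z := by
    rw [← integral_indicator measurableSet_ball, ← integral_const_mul]
    congr 1
    ext z
    rw [integral_mul_const, integral_log_sub_mul_lap hK hc, indicator_mul_right]
    ring
  rw [e1, integral_integral_swap (integrable_log_normSq_sub_mul_lap_mul hK hc hF)]
  have e2 : ∀ s, ∫ z, Real.log (normSq (z - s)) * lap K s
        * indicator (ball 0 1) (fun z => ν z - 2 * (1 - normSq z)) z
      = lap K s * ∫ z in ball (0 : ℂ) 1, Real.log (normSq (z - s))
        * (ν z - 2 * (1 - normSq z)) := by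
    intro s
    rw [← integral_indicator measurableSet_ball, ← integral_const_mul]
    congr 1
    ext z
    rw [indicator_mul_right]
    ring
  simp only [e2]
  refine integral_nonneg_of_ae ?_
  have hsph : ∀ᵐ s : ℂ, s ∉ sphere (0 : ℂ) 1 :=
    measure_eq_zero_iff_ae_notMem.1 (Measure.addHaar_sphere _ _ _)
  filter_upwards [hsph] with s hs
  rcases lt_trichotomy ‖s‖ 1 with h | h | h
  · exact mul_nonneg (hl s (by simpa using h)) (setIntegral_log_mul_nonneg hν hsub hrep h)
  · exact absurd (by simpa using h) hs
  · simp [setIntegral_log_mul_eq_zero hν hrep h]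

lemma setIntegral_subharmonic_mul_sub_nonneg
    (hν : ContDiffOn ℝ (⊤ : ℕ∞) ν (closedBall (0:ℂ) 1))
    (hsub : ∀ z ∈ ball (0:ℂ) 1, 0 ≤ lap (fun w => ν w / (1 - normSq w)) z)
    (hrep : ∀ h : ℂ → ℝ, IsHarmonicPolynomial h →
      h 0 = ∫ z in ball (0:ℂ) 1, h z * ν z ∂areaM) {u : ℂ → ℝ}
    (hu : ContDiffOn ℝ (⊤ : ℕ∞) u (closedBall (0:ℂ) 1))
    (hl : ∀ z ∈ ball (0 : ℂ) 1, 0 ≤ lap u z) :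
    0 ≤ ∫ z in ball (0 : ℂ) 1, u z * (ν z - 2 * (1 - normSq z)) := by
  have hn : Continuous normSq := continuous_normSq
  have hF : ContinuousOn (fun z => ν z - 2 * (1 - normSq z)) (closedBall 0 1) :=
    hν.continuousOn.sub (by fun_prop)
  have hstep : ∀ ρ ∈ Ioo (0 : ℝ) 1,
      IntegrableOn (fun z => u (ρ • z) * (ν z - 2 * (1 - normSq z))) (ball 0 1) ∧
      0 ≤ ∫ z in ball (0 : ℂ) 1, u (ρ • z) * (ν z - 2 * (1 - normSq z)) := by
    intro ρ hρ
    obtain ⟨K, hK, hc, hKu, hKl⟩ :=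
      exists_contDiff_extension (hu.mono ball_subset_closedBall) hl hρ.1 hρ.2
    have e : ∀ z ∈ ball (0 : ℂ) 1, K z * (ν z - 2 * (1 - normSq z))
        = u (ρ • z) * (ν z - 2 * (1 - normSq z)) := fun z hz => by
      rw [hKu z (ball_subset_closedBall hz)]
    constructor
    · exact (integrableOn_ball_of_continuousOn (φ := fun z => K z * (ν z - 2 * (1 - normSq z)))
        (hK.continuous.continuousOn.mul hF)).congr_fun e measurableSet_ball
    · rw [← setIntegral_congr_fun measurableSet_ball e]
      exact setIntegral_mul_sub_nonneg hν hsub hrep hK hc hKl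
  obtain ⟨M, hM⟩ := (isCompact_closedBall (0 : ℂ) 1).exists_bound_of_continuousOn hu.continuousOn
  have hI := (integrableOn_ball_of_continuousOn hF).norm.const_mul M
  have hev : ∀ᶠ ρ in nhdsWithin (1 : ℝ) (Iio 1), ρ ∈ Ioo (0 : ℝ) 1 := Ioo_mem_nhdsLT zero_lt_one
  refine ge_of_tendsto (tendsto_integral_filter_of_dominated_convergence
    (l := nhdsWithin (1 : ℝ) (Iio 1))
    (F := fun ρ z => u (ρ • z) * (ν z - 2 * (1 - normSq z))) _ ?_ ?_ hI ?_) ?_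
  · filter_upwards [hev] with ρ hρ
    exact (hstep ρ hρ).1.aestronglyMeasurable
  · filter_upwards [hev] with ρ hρ
    filter_upwards [ae_restrict_mem measurableSet_ball] with z hz
    rw [norm_mul]
    gcongr
    refine hM _ ?_
    simp only [mem_ball, mem_closedBall, dist_zero_right, norm_smul, Real.norm_eq_abs,
      abs_of_pos hρ.1] at hz ⊢
    nlinarith [norm_nonneg z, hρ.1, hρ.2]
  · filter_upwards [ae_restrict_mem measurableSet_ball] with z hz
    have huc : ContinuousAt u ((1 : ℝ) • z) := by
      rw [one_smul]
      exact (hu.continuousOn.mono ball_subset_closedBall).continuousAt (isOpen_ball.mem_nhds hz)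
    have hc : ContinuousAt (fun ρ : ℝ => u (ρ • z) * (ν z - 2 * (1 - normSq z))) 1 := by
      have : ContinuousAt (fun ρ : ℝ => u (ρ • z)) 1 :=
        ContinuousAt.comp (g := u) (f := fun ρ : ℝ => ρ • z) huc (by fun_prop)
      fun_prop
    have := hc.tendsto.mono_left (nhdsWithin_le_nhds (s := Iio 1))
    rwa [one_smul] at this
  · filter_upwards [hev] with ρ hρ
    exact (hstep ρ hρ).2

end Potential

/-- If `ν` is smooth on the closed disk, `ν(z)/(1-|z|²)` is subharmonic in the open disk, and
`ν` reproduces at the origin for harmonic polynomials, then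
`∫_D u·2(1-|z|²) dΣ ≤ ∫_D u·ν dΣ` for every `u` smooth on the closed disk and subharmonic in `D`. -/
theorem statement1 (ν : ℂ → ℝ)
    (hν : ContDiffOn ℝ (⊤ : ℕ∞) ν (closedBall (0:ℂ) 1))
    (hsub : ∀ z ∈ ball (0:ℂ) 1, 0 ≤ lap (fun w => ν w / (1 - normSq w)) z)
    (hrep : ∀ h : ℂ → ℝ, IsHarmonicPolynomial h →
      h 0 = ∫ z in ball (0:ℂ) 1, h z * ν z ∂areaM) :
    ∀ u : ℂ → ℝ, ContDiffOn ℝ (⊤ : ℕ∞) u (closedBall (0:ℂ) 1) →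
      (∀ z ∈ ball (0:ℂ) 1, 0 ≤ lap u z) →
      (∫ z in ball (0:ℂ) 1, u z * (2 * (1 - normSq z)) ∂areaM)
        ≤ ∫ z in ball (0:ℂ) 1, u z * ν z ∂areaM := by
  intro u hu hl
  have hn : Continuous normSq := continuous_normSq
  have h := setIntegral_subharmonic_mul_sub_nonneg hν hsub hrep hu hl
  simp only [mul_sub (u _) (ν _)] at h
  rw [integral_sub, sub_nonneg] at h
  · rw [setIntegral_areaM, setIntegral_areaM]
    exact mul_le_mul_of_nonneg_left h (inv_nonneg.2 Real.pi_pos.le)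
  · exact integrableOn_ball_of_continuousOn (hu.continuousOn.mul hν.continuousOn)
  · exact integrableOn_ball_of_continuousOn (φ := fun z => u z * (2 * (1 - normSq z)))
      (hu.continuousOn.mul (by fun_prop))
end
end

section
/- Let ν be a nonnegative C^∞-smooth function on the closed unit disk such that z ↦ ν(z)/(1−|z|²) is subharmonic in the open unit disk D and such that h(0) = ∫_D h(z)ν(z) dΣ(z) for every harmonic polynomial h. Then for every point e^{iθ} on the unit circle, either ν(e^{iθ}) > 0, or ν(e^{iθ}) = 0 and the inward normal derivative ∂ₙν(e^{iθ}) > 0. In particular, for no point ζ₀ on the unit circle does there exist a constant C with ν(z) ≤ C|z−ζ₀|² for all z ∈ D. -/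
open Complex MeasureTheory Metric Set ComplexConjugate
noncomputable section

/-- Inward normal derivative at a boundary point `z` of the unit disk. -/
def dnD (u : ℂ → ℝ) (z : ℂ) : ℝ := fderivWithin ℝ u (closedBall (0:ℂ) 1) z (-z)

lemma hasDerivAt_max_zero_pow (n : ℕ) (t : ℝ) :
    HasDerivAt (fun s : ℝ => max s 0 ^ (n + 2)) ((n + 2) * max t 0 ^ (n + 1)) t := by
  rcases lt_trichotomy t 0 with ht | rfl | ht
  · rw [max_eq_right ht.le]
    have : (fun s : ℝ => max s 0 ^ (n + 2)) =ᶠ[nhds t] fun _ => 0 := by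
      filter_upwards [Iio_mem_nhds ht] with s hs
      rw [max_eq_right (mem_Iio.1 hs).le]
      simp
    simpa using (hasDerivAt_const t (0 : ℝ)).congr_of_eventuallyEq this
  · rw [hasDerivAt_iff_isLittleO_nhds_zero]
    have h : (fun x : ℝ => x ^ (n + 2)) =o[nhds 0] fun x => x := by
      simpa using Asymptotics.isLittleO_pow_pow (𝕜 := ℝ) (show 1 < n + 2 by omega)
    refine Asymptotics.IsBigO.trans_isLittleO (Asymptotics.IsBigO.of_bound 1 ?_) h
    filter_upwards with x
    simp only [zero_add, max_self, ne_eq, Nat.add_eq_zero_iff, OfNat.ofNat_ne_zero, and_false,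
      not_false_eq_true, zero_pow, sub_zero, one_ne_zero, mul_zero, smul_zero, norm_pow, one_mul]
    gcongr
    rw [Real.norm_eq_abs, Real.norm_eq_abs, abs_of_nonneg (le_max_right _ _)]
    exact max_le (le_abs_self x) (abs_nonneg x)
  · rw [max_eq_left ht.le]
    have : (fun s : ℝ => max s 0 ^ (n + 2)) =ᶠ[nhds t] fun s => s ^ (n + 2) := by
      filter_upwards [Ioi_mem_nhds ht] with s hs
      rw [max_eq_left (mem_Ioi.1 hs).le]
    simpa using (hasDerivAt_pow (n + 2) t).congr_of_eventuallyEq this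

lemma contDiff_max_zero_pow (n : ℕ) :
    ContDiff ℝ n (fun s : ℝ => max s 0 ^ (n + 1)) := by
  induction n with
  | zero => exact contDiff_zero.2 (by fun_prop)
  | succ n ih =>
    have h : ContDiff ℝ ((n : WithTop ℕ∞) + 1) (fun s : ℝ => max s 0 ^ (n + 1 + 1)) := by
      refine contDiff_succ_iff_deriv.2
        ⟨fun t => (hasDerivAt_max_zero_pow n t).differentiableAt, by simp, ?_⟩
      rw [show deriv (fun s : ℝ => max s 0 ^ (n + 1 + 1)) =
        fun t => ((n : ℝ) + 2) * max t 0 ^ (n + 1) from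
          funext fun t => (hasDerivAt_max_zero_pow n t).deriv]
      exact contDiff_const.mul ih
    exact_mod_cast h

lemma contDiff_normSq {n : WithTop ℕ∞} : ContDiff ℝ n (normSq : ℂ → ℝ) := by
  have : (normSq : ℂ → ℝ) = fun z => reCLM z * reCLM z + imCLM z * imCLM z := by
    ext z; simp [normSq_apply]
  rw [this]
  fun_prop

lemma integrable_mul_of_tsupport {a b : ℂ → ℝ} {K U : Set ℂ} (hK : IsCompact K) (hKU : K ⊆ U)
    (ha : ContinuousOn a U) (hb : Continuous b) (hbK : tsupport b ⊆ K) :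
    Integrable (fun z => a z * b z) := by
  rw [← integrableOn_iff_integrable_of_support_subset (s := K)]
  · exact ((ha.mono hKU).mul hb.continuousOn).integrableOn_compact hK
  · refine subset_trans (fun z hz => ?_) ((subset_tsupport b).trans hbK)
    exact right_ne_zero_of_mul hz

lemma integral_mul_fderiv_fderiv {u φ : ℂ → ℝ} {U : Set ℂ} (hU : IsOpen U)
    (hu : ContDiffOn ℝ 2 u U) (hφ : ContDiff ℝ 2 φ) (hc : HasCompactSupport φ)
    (hs : tsupport φ ⊆ U) (v : ℂ) :
    Integrable (fun z => u z * fderiv ℝ (fun w => fderiv ℝ φ w v) z v) ∧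
    Integrable (fun z => fderiv ℝ (fun w => fderiv ℝ u w v) z v * φ z) ∧
    ∫ z, u z * fderiv ℝ (fun w => fderiv ℝ φ w v) z v =
      ∫ z, fderiv ℝ (fun w => fderiv ℝ u w v) z v * φ z := by
  have hu1 : ContDiffOn ℝ 1 (fun w => fderiv ℝ u w v) U :=
    (hu.fderiv_of_isOpen hU (by norm_num)).clm_apply contDiffOn_const
  have hu2 : ContinuousOn (fun z => fderiv ℝ (fun w => fderiv ℝ u w v) z v) U :=
    ((hu1.fderiv_of_isOpen (m := 0) hU (by norm_num)).clm_apply contDiffOn_const).continuousOn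
  have hφ1 : ContDiff ℝ 1 (fun w => fderiv ℝ φ w v) :=
    (hφ.fderiv_right (by norm_num)).clm_apply contDiff_const
  have hφ2 : Continuous (fun z => fderiv ℝ (fun w => fderiv ℝ φ w v) z v) :=
    ((hφ1.fderiv_right (m := 0) (by norm_num)).clm_apply contDiff_const).continuous
  have hs1 : tsupport (fun w => fderiv ℝ φ w v) ⊆ tsupport φ :=
    tsupport_fderiv_apply_subset ℝ v
  have hs2 : tsupport (fun z => fderiv ℝ (fun w => fderiv ℝ φ w v) z v) ⊆ tsupport φ :=
    (tsupport_fderiv_apply_subset ℝ v).trans hs1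
  have hud : ∀ z ∈ U, DifferentiableAt ℝ u z := fun z hz =>
    (hu.differentiableOn (by norm_num)).differentiableAt (hU.mem_nhds hz)
  have hud1 : ∀ z ∈ U, DifferentiableAt ℝ (fun w => fderiv ℝ u w v) z := fun z hz =>
    (hu1.differentiableOn (by norm_num)).differentiableAt (hU.mem_nhds hz)
  have i1 := integrable_mul_of_tsupport hc hs hu.continuousOn hφ2 hs2
  have i2 := integrable_mul_of_tsupport hc hs hu1.continuousOn hφ1.continuous hs1
  have i3 := integrable_mul_of_tsupport hc hs hu2 hφ.continuous subset_rfl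
  have i4 := integrable_mul_of_tsupport hc hs hu.continuousOn hφ1.continuous hs1
  have i5 := integrable_mul_of_tsupport hc hs hu1.continuousOn hφ.continuous subset_rfl
  refine ⟨i1, i3, ?_⟩
  rw [integral_mul_fderiv_eq_neg_fderiv_mul_of_integrable i2 i1 i4
      (fun z hz => hud z (hs (hs1 hz)))
      (fun z _ => (hφ1.differentiable (by norm_num)) z),
    integral_mul_fderiv_eq_neg_fderiv_mul_of_integrable i3 i2 i5
      (fun z hz => hud1 z (hs hz))
      (fun z _ => (hφ.differentiable (by norm_num)) z), neg_neg]

/-- Green's identity against a compactly supported function. -/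
lemma integral_mul_lap {u φ : ℂ → ℝ} {U : Set ℂ} (hU : IsOpen U)
    (hu : ContDiffOn ℝ 2 u U) (hφ : ContDiff ℝ 2 φ) (hc : HasCompactSupport φ)
    (hs : tsupport φ ⊆ U) : ∫ z, u z * lap φ z = ∫ z, lap u z * φ z := by
  obtain ⟨a1, b1, c1⟩ := integral_mul_fderiv_fderiv hU hu hφ hc hs 1
  obtain ⟨a2, b2, c2⟩ := integral_mul_fderiv_fderiv hU hu hφ hc hs I
  have h1 : ∀ z, u z * lap φ z = (1 / 4) * (u z * fderiv ℝ (fun w => fderiv ℝ φ w 1) z 1 +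
      u z * fderiv ℝ (fun w => fderiv ℝ φ w I) z I) := fun z => by unfold lap; ring
  have h2 : ∀ z, lap u z * φ z = (1 / 4) * (fderiv ℝ (fun w => fderiv ℝ u w 1) z 1 * φ z +
      fderiv ℝ (fun w => fderiv ℝ u w I) z I * φ z) := fun z => by unfold lap; ring
  simp_rw [h1, h2]
  rw [integral_const_mul, integral_const_mul, integral_add a1 a2, integral_add b1 b2, c1, c2]

lemma lap_eq_zero_of_notMem_tsupport {φ : ℂ → ℝ} {z : ℂ} (hz : z ∉ tsupport φ) :
    lap φ z = 0 := by
  have h : ∀ v : ℂ, fderiv ℝ (fun w => fderiv ℝ φ w v) z v = 0 := fun v =>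
    image_eq_zero_of_notMem_tsupport (f := fun z => fderiv ℝ (fun w => fderiv ℝ φ w v) z v)
      fun h => hz (tsupport_fderiv_apply_subset ℝ v (tsupport_fderiv_apply_subset ℝ v h))
  simp [lap, h]

/-- A subharmonic function pairs nonnegatively with the Laplacian of a nonnegative test
function. -/
lemma setIntegral_mul_lap_nonneg {u φ : ℂ → ℝ} {U : Set ℂ} (hU : IsOpen U)
    (hu : ContDiffOn ℝ 2 u U) (hsub : ∀ z ∈ U, 0 ≤ lap u z) (hφ : ContDiff ℝ 2 φ)
    (hc : HasCompactSupport φ) (hs : tsupport φ ⊆ U) (hnn : ∀ z, 0 ≤ φ z) :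
    0 ≤ ∫ z in U, u z * lap φ z := by
  rw [setIntegral_eq_integral_of_forall_compl_eq_zero fun z hz => by
    rw [lap_eq_zero_of_notMem_tsupport fun h => hz (hs h), mul_zero],
    integral_mul_lap hU hu hφ hc hs]
  refine integral_nonneg fun z => ?_
  by_cases hz : z ∈ U
  · exact mul_nonneg (hsub z hz) (hnn z)
  · rw [image_eq_zero_of_notMem_tsupport fun h => hz (hs h)]
    simp

/-- For `ε = 0` and `|ζ| = 1`, the Laplacian of this function is `1 - |z|²` times a harmonic
function; for `ε > 0` it is supported in `|z|² ≤ 1 - ε`. -/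
def truncKernel (ζ : ℂ) (ε : ℝ) (z : ℂ) : ℝ :=
  max (1 - ε - normSq z) 0 ^ 4 / normSq (z - ζ) ^ 2 +
    2 * max (1 - ε - normSq z) 0 ^ 3 / normSq (z - ζ)

/-- The derivative of `truncKernel ζ ε` at `z` in the direction `v`. -/
def truncKernelDeriv (ζ : ℂ) (ε : ℝ) (v z : ℂ) : ℝ :=
  -8 * max (1 - ε - normSq z) 0 ^ 3 * (z * conj v).re / normSq (z - ζ) ^ 2
    - 4 * max (1 - ε - normSq z) 0 ^ 4 * ((z - ζ) * conj v).re / normSq (z - ζ) ^ 3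
    - 12 * max (1 - ε - normSq z) 0 ^ 2 * (z * conj v).re / normSq (z - ζ)
    - 4 * max (1 - ε - normSq z) 0 ^ 3 * ((z - ζ) * conj v).re / normSq (z - ζ) ^ 2

lemma hasDerivAt_normSq_line (z v : ℂ) :
    HasDerivAt (fun t : ℝ => normSq (z + t • v)) (2 * (z * conj v).re) 0 := by
  have h : (fun t : ℝ => normSq (z + t • v)) =
      fun t : ℝ => normSq z + t * (2 * (z * conj v).re) + t ^ 2 * normSq v := by
    ext t; simp [normSq_apply]; ring
  rw [h]
  have := (((hasDerivAt_id (0 : ℝ)).mul_const (2 * (z * conj v).re)).const_add (normSq z)).add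
    (((hasDerivAt_id (0 : ℝ)).pow 2).mul_const (normSq v))
  exact this.congr_deriv (by simp)

lemma hasDerivAt_re_mul_conj_line (z v : ℂ) :
    HasDerivAt (fun t : ℝ => ((z + t • v) * conj v).re) (normSq v) 0 := by
  have h : (fun t : ℝ => ((z + t • v) * conj v).re) =
      fun t : ℝ => (z * conj v).re + t * normSq v := by
    ext t; simp [normSq_apply]; ring
  rw [h]
  simpa using ((hasDerivAt_id (0 : ℝ)).mul_const (normSq v)).const_add ((z * conj v).re)

lemma hasDerivAt_max_pow_line (c : ℝ) (n : ℕ) (z v : ℂ) :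
    HasDerivAt (fun t : ℝ => max (c - normSq (z + t • v)) 0 ^ (n + 2))
      ((n + 2) * max (c - normSq z) 0 ^ (n + 1) * -(2 * (z * conj v).re)) 0 := by
  have h := (hasDerivAt_normSq_line z v).const_sub c
  have h2 := hasDerivAt_max_zero_pow n (c - normSq (z + (0 : ℝ) • v))
  have := h2.comp (0 : ℝ) h
  simpa [Function.comp_def] using this

lemma fderiv_apply_of_hasDerivAt_line {f : ℂ → ℝ} {z v : ℂ} {c : ℝ}
    (hf : DifferentiableAt ℝ f z) (h : HasDerivAt (fun t : ℝ => f (z + t • v)) c 0) :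
    fderiv ℝ f z v = c :=
  (hf.hasFDerivAt.hasLineDerivAt v).unique h

lemma hasDerivAt_truncKernel_line {ζ z : ℂ} (ε : ℝ) (v : ℂ) (hz : z ≠ ζ) :
    HasDerivAt (fun t : ℝ => truncKernel ζ ε (z + t • v)) (truncKernelDeriv ζ ε v z) 0 := by
  have hE0 : normSq (z - ζ) ≠ 0 := by simpa [sub_eq_zero] using hz
  have hE : HasDerivAt (fun t : ℝ => normSq (z + t • v - ζ)) (2 * ((z - ζ) * conj v).re) 0 := by
    simpa only [add_sub_right_comm] using hasDerivAt_normSq_line (z - ζ) v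
  have m4 := hasDerivAt_max_pow_line (1 - ε) 2 z v
  have m3 := hasDerivAt_max_pow_line (1 - ε) 1 z v
  have := (m4.div (hE.pow 2) (by simpa using hE0)).add
    ((m3.const_mul 2).div hE (by simpa using hE0))
  refine this.congr_deriv ?_
  simp only [Pi.pow_apply, zero_smul, add_zero, truncKernelDeriv]
  push_cast
  generalize normSq (z - ζ) = E at *
  generalize max (1 - ε - normSq z) 0 = m
  generalize (z * conj v).re = a
  generalize ((z - ζ) * conj v).re = b
  field_simp
  ring

lemma hasDerivAt_truncKernelDeriv_line {ζ z : ℂ} (ε : ℝ) (v : ℂ) (hz : z ≠ ζ) :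
    HasDerivAt (fun t : ℝ => truncKernelDeriv ζ ε v (z + t • v))
      (48 * max (1 - ε - normSq z) 0 ^ 2 * (z * conj v).re ^ 2 / normSq (z - ζ) ^ 2
        - 8 * max (1 - ε - normSq z) 0 ^ 3 * normSq v / normSq (z - ζ) ^ 2
        + 64 * max (1 - ε - normSq z) 0 ^ 3 * (z * conj v).re * ((z - ζ) * conj v).re
          / normSq (z - ζ) ^ 3
        - 4 * max (1 - ε - normSq z) 0 ^ 4 * normSq v / normSq (z - ζ) ^ 3
        + 24 * max (1 - ε - normSq z) 0 ^ 4 * ((z - ζ) * conj v).re ^ 2 / normSq (z - ζ) ^ 4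
        + 48 * max (1 - ε - normSq z) 0 * (z * conj v).re ^ 2 / normSq (z - ζ)
        - 12 * max (1 - ε - normSq z) 0 ^ 2 * normSq v / normSq (z - ζ)
        + 48 * max (1 - ε - normSq z) 0 ^ 2 * (z * conj v).re * ((z - ζ) * conj v).re
          / normSq (z - ζ) ^ 2
        - 4 * max (1 - ε - normSq z) 0 ^ 3 * normSq v / normSq (z - ζ) ^ 2
        + 16 * max (1 - ε - normSq z) 0 ^ 3 * ((z - ζ) * conj v).re ^ 2 / normSq (z - ζ) ^ 3)
      0 := by
  have hE0 : normSq (z - ζ) ≠ 0 := by simpa [sub_eq_zero] using hz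
  have hE : HasDerivAt (fun t : ℝ => normSq (z + t • v - ζ)) (2 * ((z - ζ) * conj v).re) 0 := by
    simpa only [add_sub_right_comm] using hasDerivAt_normSq_line (z - ζ) v
  have ha := hasDerivAt_re_mul_conj_line z v
  have hb : HasDerivAt (fun t : ℝ => ((z + t • v - ζ) * conj v).re) (normSq v) 0 := by
    simpa only [add_sub_right_comm] using hasDerivAt_re_mul_conj_line (z - ζ) v
  have m4 := hasDerivAt_max_pow_line (1 - ε) 2 z v
  have m3 := hasDerivAt_max_pow_line (1 - ε) 1 z v
  have m2 := hasDerivAt_max_pow_line (1 - ε) 0 z v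
  have := (((((m3.const_mul (-8)).mul ha).div (hE.pow 2) (by simpa using hE0)).sub
    (((m4.const_mul 4).mul hb).div (hE.pow 3) (by simpa using hE0))).sub
    (((m2.const_mul 12).mul ha).div hE (by simpa using hE0))).sub
    (((m3.const_mul 4).mul hb).div (hE.pow 2) (by simpa using hE0))
  refine this.congr_deriv ?_
  simp only [Pi.pow_apply, Pi.mul_apply, zero_smul, add_zero]
  push_cast
  generalize normSq (z - ζ) = E at *
  generalize max (1 - ε - normSq z) 0 = m
  generalize (z * conj v).re = a
  generalize ((z - ζ) * conj v).re = b
  field_simp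
  ring

lemma tsupport_truncKernel_subset (ζ : ℂ) (ε : ℝ) :
    tsupport (truncKernel ζ ε) ⊆ {z | normSq z ≤ 1 - ε} := by
  refine closure_minimal (fun z hz => ?_) (isClosed_le continuous_normSq continuous_const)
  by_contra h
  rw [mem_ofPred_eq, not_le] at h
  exact hz (by simp [truncKernel, max_eq_right (show 1 - ε - normSq z ≤ 0 by linarith)])

lemma contDiff_truncKernel {ζ : ℂ} {ε : ℝ} (hζ : normSq ζ = 1) (hε : 0 < ε) :
    ContDiff ℝ 2 (truncKernel ζ ε) := by
  rw [← contMDiff_iff_contDiff]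
  refine contMDiff_of_tsupport fun z hz => ContDiffAt.contMDiffAt ?_
  have hz' := tsupport_truncKernel_subset ζ ε hz
  have hE0 : normSq (z - ζ) ≠ 0 := by
    intro h
    rw [normSq_eq_zero, sub_eq_zero] at h
    rw [mem_ofPred_eq, h, hζ] at hz'
    linarith
  have hR : ContDiff ℝ 2 (fun z : ℂ => 1 - ε - normSq z) := contDiff_const.sub contDiff_normSq
  have m3 : ContDiff ℝ 2 (fun z : ℂ => max (1 - ε - normSq z) 0 ^ 3) :=
    (contDiff_max_zero_pow 2).comp hR
  have m4 : ContDiff ℝ 2 (fun z : ℂ => max (1 - ε - normSq z) 0 ^ 4) :=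
    ((contDiff_max_zero_pow 3).of_le (by norm_cast)).comp hR
  have hE : ContDiff ℝ 2 (fun z : ℂ => normSq (z - ζ)) :=
    contDiff_normSq.comp (contDiff_id.sub contDiff_const)
  unfold truncKernel
  exact (m4.contDiffAt.div (hE.pow 2).contDiffAt (pow_ne_zero 2 hE0)).add
    ((contDiff_const.mul m3).contDiffAt.div hE.contDiffAt hE0)

lemma lap_truncKernel {ζ z : ℂ} {ε : ℝ} (hζ : normSq ζ = 1) (hε : 0 < ε) (hz : z ≠ ζ) :
    lap (truncKernel ζ ε) z =
      12 * max (1 - ε - normSq z) 0 ^ 2 * normSq z / normSq (z - ζ) ^ 2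
        + 6 * max (1 - ε - normSq z) 0 ^ 3 / normSq (z - ζ) ^ 2
        - 8 * max (1 - ε - normSq z) 0 ^ 3 * (1 - normSq z) / normSq (z - ζ) ^ 3
        + 4 * max (1 - ε - normSq z) 0 ^ 4 / normSq (z - ζ) ^ 3
        + 12 * max (1 - ε - normSq z) 0 * normSq z / normSq (z - ζ)
        - 6 * max (1 - ε - normSq z) 0 ^ 2 * (1 - normSq z) / normSq (z - ζ) ^ 2 := by
  have hd := contDiff_truncKernel hζ hε
  have hE0 : normSq (z - ζ) ≠ 0 := by simpa [sub_eq_zero] using hz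
  have h1 : ∀ v : ℂ, (fun w => fderiv ℝ (truncKernel ζ ε) w v) =ᶠ[nhds z]
      truncKernelDeriv ζ ε v := fun v => by
    filter_upwards [isOpen_ne.mem_nhds hz] with w hw
    exact fderiv_apply_of_hasDerivAt_line (hd.differentiable (by norm_num) w)
      (hasDerivAt_truncKernel_line ε v hw)
  have hd1 : ∀ v : ℂ, DifferentiableAt ℝ (truncKernelDeriv ζ ε v) z := fun v =>
    ((((hd.fderiv_right (m := 1) (by norm_num)).clm_apply
      (contDiff_const (c := v))).differentiable (by norm_num)) z).congr_of_eventuallyEq (h1 v).symm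
  unfold lap
  rw [(h1 1).fderiv_eq, (h1 I).fderiv_eq,
    fderiv_apply_of_hasDerivAt_line (hd1 1) (hasDerivAt_truncKernelDeriv_line ε 1 hz),
    fderiv_apply_of_hasDerivAt_line (hd1 I) (hasDerivAt_truncKernelDeriv_line ε I hz)]
  generalize max (1 - ε - normSq z) 0 = m
  have hN : (z * conj 1).re ^ 2 + (z * conj I).re ^ 2 = normSq z := by
    simp [normSq_apply]; ring
  have hD : ((z - ζ) * conj 1).re ^ 2 + ((z - ζ) * conj I).re ^ 2 = normSq (z - ζ) := by
    simp [normSq_apply]; ring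
  have hX : (z * conj 1).re * ((z - ζ) * conj 1).re + (z * conj I).re * ((z - ζ) * conj I).re =
      (normSq (z - ζ) - (1 - normSq z)) / 2 := by
    rw [← hζ]; simp [normSq_apply]; ring
  rw [map_one normSq, normSq_I]
  generalize normSq (z - ζ) = E at *
  generalize normSq z = N at *
  generalize (z * conj 1).re = a at *
  generalize (z * conj I).re = b at *
  generalize ((z - ζ) * conj 1).re = c at *
  generalize ((z - ζ) * conj I).re = d at *
  have e1 : b ^ 2 = N - a ^ 2 := by linarith
  have e2 : d ^ 2 = E - c ^ 2 := by linarith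
  have e3 : ∀ x : ℝ, x * b * d = x * ((E - (1 - N)) / 2 - a * c) := fun x => by
    rw [mul_assoc]; congr 1; linarith
  rw [e1, e2, e3, e3]
  field_simp
  ring

lemma continuous_lap_s2 {φ : ℂ → ℝ} (hφ : ContDiff ℝ 2 φ) : Continuous (lap φ) := by
  have h : ∀ v : ℂ, Continuous (fun z => fderiv ℝ (fun w => fderiv ℝ φ w v) z v) := fun v => by
    have hφ1 : ContDiff ℝ 1 (fun w => fderiv ℝ φ w v) :=
      (hφ.fderiv_right (by norm_num)).clm_apply contDiff_const
    exact ((hφ1.fderiv_right (m := 0) (by norm_num)).clm_apply contDiff_const).continuous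
  exact continuous_const.mul ((h 1).add (h I))

lemma integrableOn_inv_norm_sub {ζ : ℂ} (hζ : ‖ζ‖ = 1) :
    IntegrableOn (fun z => ‖z - ζ‖⁻¹) (ball (0 : ℂ) 1) := by
  have h : IntegrableOn (fun z : ℂ => ‖z‖⁻¹) (ball (0 : ℂ) 2) := by
    refine integrableOn_ball_of_norm_le_rpow (C := 1) (α := 1) (by simp) (by simp) ?_
      (by fun_prop)
    filter_upwards with z
    rw [Real.rpow_neg_one, one_mul, norm_inv, norm_norm]
  have h2 := ((measurePreserving_sub_right volume ζ).integrableOn_comp_preimage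
    (MeasurableEquiv.subRight ζ).measurableEmbedding).2 h
  refine h2.mono_set fun z hz => ?_
  rw [mem_preimage, mem_ball_zero_iff]
  rw [mem_ball_zero_iff] at hz
  linarith [norm_sub_le z ζ]

/-- The harmonic function paired with `ν` in the limit of `truncKernel`. -/
def cubicKernel (ζ z : ℂ) : ℝ := 4 - 8 * ((1 - conj ζ * z)⁻¹ ^ 3).re

lemma norm_one_sub_conj_mul {ζ : ℂ} (hζ : ‖ζ‖ = 1) (z : ℂ) : ‖1 - conj ζ * z‖ = ‖z - ζ‖ := by
  have h : 1 - conj ζ * z = conj ζ * (ζ - z) := by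
    rw [mul_sub, conj_mul', hζ]; simp
  rw [h, norm_mul, RCLike.norm_conj, hζ, one_mul, norm_sub_rev]

lemma one_sub_normSq_mul_cubicKernel {ζ z : ℂ} (hζ : ‖ζ‖ = 1) (hz : z ≠ ζ) :
    (1 - normSq z) * cubicKernel ζ z =
      12 * (1 - normSq z) ^ 2 * normSq z / normSq (z - ζ) ^ 2
        + 6 * (1 - normSq z) ^ 3 / normSq (z - ζ) ^ 2
        - 8 * (1 - normSq z) ^ 3 * (1 - normSq z) / normSq (z - ζ) ^ 3
        + 4 * (1 - normSq z) ^ 4 / normSq (z - ζ) ^ 3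
        + 12 * (1 - normSq z) * normSq z / normSq (z - ζ)
        - 6 * (1 - normSq z) ^ 2 * (1 - normSq z) / normSq (z - ζ) ^ 2 := by
  have hE0 : normSq (z - ζ) ≠ 0 := by simpa [sub_eq_zero] using hz
  have hζ' : normSq ζ = 1 := by rw [normSq_eq_norm_sq, hζ, one_pow]
  have hs : normSq (1 - conj ζ * z) = normSq (z - ζ) := by
    rw [normSq_eq_norm_sq, normSq_eq_norm_sq, norm_one_sub_conj_mul hζ]
  have hre : (1 - conj ζ * z).re = (1 - normSq z + normSq (z - ζ)) / 2 := by
    rw [normSq_apply] at hζ'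
    simp [normSq_apply]
    linarith
  have him : (1 - conj ζ * z).im ^ 2 = normSq (z - ζ) - (1 - conj ζ * z).re ^ 2 := by
    rw [← hs, normSq_apply]; ring
  have hk : cubicKernel ζ z = 4 - 8 * ((4 * (1 - conj ζ * z).re ^ 3 -
      3 * (1 - conj ζ * z).re * normSq (z - ζ)) / normSq (z - ζ) ^ 3) := by
    unfold cubicKernel
    generalize 1 - conj ζ * z = s at *
    have : (s⁻¹ ^ 3).re = (s.re ^ 3 - 3 * s.re * s.im ^ 2) / normSq s ^ 3 := by
      rw [hs]
      simp only [pow_succ, pow_zero, one_mul, mul_re, mul_im, inv_re, inv_im, hs]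
      field_simp
      ring
    rw [this, him, hs]
    ring
  rw [hk, hre]
  generalize normSq (z - ζ) = E at *
  generalize normSq z = N at *
  field_simp
  ring

/-- The partial sums of the geometric series are dominated by its boundary singularity. -/
lemma norm_geom_sum_le {ζ z : ℂ} (hζ : ‖ζ‖ = 1) (hz : ‖z‖ < 1) (n : ℕ) :
    ‖∑ k ∈ Finset.range n, (conj ζ * z) ^ k‖ ≤ 2 / ‖z - ζ‖ := by
  have hx : ‖conj ζ * z‖ < 1 := by rwa [norm_mul, RCLike.norm_conj, hζ, one_mul]
  have hne : conj ζ * z ≠ 1 := by rintro h; simp [h] at hx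
  rw [geom_sum_eq hne, norm_div, ← norm_one_sub_conj_mul hζ, norm_sub_rev (conj ζ * z) 1]
  gcongr
  calc ‖(conj ζ * z) ^ n - 1‖ ≤ ‖(conj ζ * z) ^ n‖ + ‖(1 : ℂ)‖ := norm_sub_le _ _
    _ ≤ 1 + 1 := by
      rw [norm_one, norm_pow]
      gcongr
      exact pow_le_one₀ (norm_nonneg _) hx.le
    _ = 2 := by norm_num

lemma tendsto_geom_sum {ζ z : ℂ} (hζ : ‖ζ‖ = 1) (hz : ‖z‖ < 1) :
    Filter.Tendsto (fun n : ℕ => ∑ k ∈ Finset.range (n + 1), (conj ζ * z) ^ k) Filter.atTop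
      (nhds (1 - conj ζ * z)⁻¹) := by
  have hx : ‖conj ζ * z‖ < 1 := by rwa [norm_mul, RCLike.norm_conj, hζ, one_mul]
  exact (hasSum_geometric_of_norm_lt_one hx).tendsto_sum_nat.comp (Filter.tendsto_add_atTop_nat 1)

lemma isHarmonicPolynomial_geom_sum (ζ : ℂ) (n : ℕ) :
    IsHarmonicPolynomial fun z =>
      4 - 8 * ((∑ k ∈ Finset.range (n + 1), (conj ζ * z) ^ k) ^ 3).re := by
  refine ⟨4 - 4 * (∑ k ∈ Finset.range (n + 1), (Polynomial.C (conj ζ) * Polynomial.X) ^ k) ^ 3,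
    -4 * (∑ k ∈ Finset.range (n + 1), (Polynomial.C (conj ζ) * Polynomial.X) ^ k) ^ 3,
    fun z => ?_⟩
  simp only [Polynomial.eval_sub, Polynomial.eval_mul, Polynomial.eval_pow,
    Polynomial.eval_finsetSum, Polynomial.eval_C, Polynomial.eval_X, Polynomial.eval_neg,
    Polynomial.eval_ofNat, map_mul, map_neg, map_ofNat]
  push_cast
  rw [re_eq_add_conj]
  ring

lemma norm_sub_le_two {ζ z : ℂ} (hζ : ‖ζ‖ = 1) (hz : ‖z‖ < 1) : ‖z - ζ‖ ≤ 2 := by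
  linarith [norm_sub_le z ζ]

lemma norm_sub_pos {ζ z : ℂ} (hζ : ‖ζ‖ = 1) (hz : ‖z‖ < 1) : 0 < ‖z - ζ‖ := by
  rw [norm_pos_iff, sub_ne_zero]
  rintro rfl
  linarith

lemma setIntegral_cubicKernel_mul_neg {ν : ℂ → ℝ} (hν : ContinuousOn ν (ball (0 : ℂ) 1))
    (hnn : ∀ z ∈ ball (0 : ℂ) 1, 0 ≤ ν z)
    (hrep : ∀ h : ℂ → ℝ, IsHarmonicPolynomial h → h 0 = ∫ z in ball (0 : ℂ) 1, h z * ν z ∂areaM)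
    {ζ : ℂ} (hζ : ‖ζ‖ = 1) {C : ℝ} (hC : ∀ z ∈ ball (0 : ℂ) 1, ν z ≤ C * normSq (z - ζ)) :
    ∫ z in ball (0 : ℂ) 1, cubicKernel ζ z * ν z < 0 := by
  let w : ℕ → ℂ → ℝ := fun n z => 4 - 8 * ((∑ k ∈ Finset.range (n + 1), (conj ζ * z) ^ k) ^ 3).re
  have hconst : ∀ n, ∫ z in ball (0 : ℂ) 1, w n z * ν z = Real.pi * (-4) := by
    intro n
    have h := hrep (w n) (isHarmonicPolynomial_geom_sum ζ n)
    have h0 : w n 0 = -4 := by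
      simp [w, Finset.sum_range_succ']
      norm_num
    rw [h0, areaM, Measure.restrict_smul, integral_smul_measure, ENNReal.toReal_inv,
      ENNReal.toReal_ofReal Real.pi_pos.le, smul_eq_mul] at h
    rw [h, mul_inv_cancel_left₀ Real.pi_ne_zero]
  have hlim : Filter.Tendsto (fun n => ∫ z in ball (0 : ℂ) 1, w n z * ν z) Filter.atTop
      (nhds (∫ z in ball (0 : ℂ) 1, cubicKernel ζ z * ν z)) := by
    refine tendsto_integral_of_dominated_convergence (fun z => 96 * C * ‖z - ζ‖⁻¹) (fun n => ?_)
      ((integrableOn_inv_norm_sub hζ).const_mul _) (fun n => ?_) ?_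
    · refine (ContinuousOn.mul (Continuous.continuousOn ?_) hν).aestronglyMeasurable
        measurableSet_ball
      exact continuous_const.sub (continuous_const.mul (continuous_re.comp (by fun_prop)))
    · filter_upwards [self_mem_ae_restrict measurableSet_ball] with z hz
      have hz1 := mem_ball_zero_iff.1 hz
      have hd := norm_sub_pos hζ hz1
      have hd2 := norm_sub_le_two hζ hz1
      have hw := norm_geom_sum_le hζ hz1 (n + 1)
      have hb : |w n z| ≤ 4 + 8 * (2 / ‖z - ζ‖) ^ 3 := by
        refine (abs_sub _ _).trans ?_
        rw [abs_mul, abs_of_pos (show (0 : ℝ) < 4 by norm_num),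
          abs_of_pos (show (0 : ℝ) < 8 by norm_num)]
        gcongr
        refine (abs_re_le_norm _).trans ?_
        rw [norm_pow]
        gcongr
      have hνC := hC z hz
      rw [normSq_eq_norm_sq] at hνC
      rw [norm_mul, Real.norm_eq_abs, Real.norm_eq_abs, abs_of_nonneg (hnn z hz)]
      generalize ‖z - ζ‖ = d at *
      have hC0 : 0 ≤ C := nonneg_of_mul_nonneg_left ((hnn z hz).trans hνC) (by positivity)
      calc |w n z| * ν z ≤ (4 + 8 * (2 / d) ^ 3) * (C * d ^ 2) :=
            mul_le_mul hb hνC (hnn z hz) (by positivity)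
        _ = C * (4 * d ^ 3 + 64) * d⁻¹ := by field_simp; ring
        _ ≤ C * (4 * 2 ^ 3 + 64) * d⁻¹ := by gcongr
        _ = 96 * C * d⁻¹ := by ring
    · filter_upwards [self_mem_ae_restrict measurableSet_ball] with z hz
      have := tendsto_geom_sum hζ (mem_ball_zero_iff.1 hz)
      exact (((continuous_re.tendsto _).comp (this.pow 3)).const_mul 8 |>.const_sub 4).mul_const _
  simp_rw [hconst] at hlim
  rw [← tendsto_nhds_unique tendsto_const_nhds hlim]
  linarith [Real.pi_pos]

lemma abs_lap_truncKernel_le {ζ z : ℂ} (hζ : ‖ζ‖ = 1) (hz : ‖z‖ < 1) {ε : ℝ} (hε : 0 < ε) :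
    |lap (truncKernel ζ ε) z| ≤ 240 * (1 - normSq z) / ‖z - ζ‖ ^ 3 := by
  have hd := norm_sub_pos hζ hz
  have hd2 := norm_sub_le_two hζ hz
  have hN : normSq z < 1 := by rw [normSq_eq_norm_sq]; nlinarith [norm_nonneg z]
  have hρd : 1 - normSq z ≤ 2 * ‖z - ζ‖ := by
    have : 1 - ‖z‖ ≤ ‖z - ζ‖ := by
      rw [← hζ, norm_sub_rev]; exact norm_sub_norm_le ζ z
    rw [normSq_eq_norm_sq]
    nlinarith [sq_nonneg (1 - ‖z‖)]
  rw [lap_truncKernel (by rw [normSq_eq_norm_sq, hζ, one_pow]) hε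
    (by rw [← sub_ne_zero, ← norm_pos_iff]; exact hd)]
  have hm0 : 0 ≤ max (1 - ε - normSq z) 0 := le_max_right _ _
  have hmρ : max (1 - ε - normSq z) 0 ≤ 1 - normSq z := max_le (by linarith) (by linarith)
  have hN0 := normSq_nonneg z
  rw [normSq_eq_norm_sq (z - ζ)]
  generalize max (1 - ε - normSq z) 0 = m at *
  generalize ‖z - ζ‖ = d at *
  generalize hρ : 1 - normSq z = ρ at *
  generalize normSq z = N at *
  have hmd : m ≤ 2 * d := hmρ.trans hρd
  have hρ0 : 0 ≤ ρ := hm0.trans hmρ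
  have hN1 : N ≤ 1 := hN.le
  have t1 : m * m * N * d ^ 2 ≤ ρ * (2 * d) * 1 * d ^ 2 := by gcongr
  have t2 : m * m * m * d * d ≤ ρ * (2 * d) * (2 * d) * d * 2 := by gcongr
  have t3 : m * m * m * ρ ≤ (2 * d) * (2 * d) * (2 * d) * ρ := by gcongr
  have t4 : m * m * m * m ≤ (2 * d) * (2 * d) * (2 * d) * ρ := by gcongr
  have t5 : m * N * d ^ 3 * d ≤ ρ * 1 * d ^ 3 * 2 := by gcongr
  have t6 : m * m * ρ * d * d ≤ (2 * d) * (2 * d) * ρ * d * 2 := by gcongr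
  have p1 : 0 ≤ m * m * N * d ^ 2 := by positivity
  have p2 : 0 ≤ m * m * m * d * d := by positivity
  have p3 : 0 ≤ m * m * m * ρ := by positivity
  have p4 : 0 ≤ m * m * m * m := by positivity
  have p5 : 0 ≤ m * N * d ^ 3 * d := by positivity
  have p6 : 0 ≤ m * m * ρ * d * d := by positivity
  have hT : 12 * m ^ 2 * N / (d ^ 2) ^ 2 + 6 * m ^ 3 / (d ^ 2) ^ 2 - 8 * m ^ 3 * ρ / (d ^ 2) ^ 3
      + 4 * m ^ 4 / (d ^ 2) ^ 3 + 12 * m * N / d ^ 2 - 6 * m ^ 2 * ρ / (d ^ 2) ^ 2 =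
      (12 * (m * m * N * d ^ 2) + 6 * (m * m * m * d * d) - 8 * (m * m * m * ρ)
        + 4 * (m * m * m * m) + 12 * (m * N * d ^ 3 * d) - 6 * (m * m * ρ * d * d)) / d ^ 6 := by
    field_simp
  have hR : 240 * ρ / d ^ 3 = (240 * (ρ * d ^ 3)) / d ^ 6 := by field_simp
  rw [hT, hR, abs_div, abs_of_pos (show 0 < d ^ 6 by positivity)]
  gcongr
  rw [abs_le]
  ring_nf at t1 t2 t3 t4 t5 t6 p1 p2 p3 p4 p5 p6 ⊢
  constructor <;> linarith

lemma normSq_lt_one_of_mem_ball {z : ℂ} (hz : z ∈ ball (0 : ℂ) 1) : normSq z < 1 := by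
  rw [mem_ball_zero_iff] at hz
  rw [normSq_eq_norm_sq]
  nlinarith [norm_nonneg z]

lemma setIntegral_cubicKernel_mul_nonneg {ν : ℂ → ℝ} (hν : ContDiffOn ℝ 2 ν (ball (0 : ℂ) 1))
    (hnn : ∀ z ∈ ball (0 : ℂ) 1, 0 ≤ ν z)
    (hsub : ∀ z ∈ ball (0 : ℂ) 1, 0 ≤ lap (fun w => ν w / (1 - normSq w)) z)
    {ζ : ℂ} (hζ : ‖ζ‖ = 1) {C : ℝ} (hC : ∀ z ∈ ball (0 : ℂ) 1, ν z ≤ C * normSq (z - ζ)) :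
    0 ≤ ∫ z in ball (0 : ℂ) 1, cubicKernel ζ z * ν z := by
  have hζ' : normSq ζ = 1 := by rw [normSq_eq_norm_sq, hζ, one_pow]
  have hu : ContDiffOn ℝ 2 (fun w => ν w / (1 - normSq w)) (ball (0 : ℂ) 1) :=
    hν.div (contDiff_const.sub contDiff_normSq).contDiffOn fun z hz =>
      (sub_pos.2 (normSq_lt_one_of_mem_ball hz)).ne'
  have hε : ∀ n : ℕ, (0 : ℝ) < 1 / ((n : ℝ) + 1) := fun n => by positivity
  refine ge_of_tendsto' (f := fun n : ℕ => ∫ z in ball (0 : ℂ) 1,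
    ν z / (1 - normSq z) * lap (truncKernel ζ (1 / ((n : ℝ) + 1))) z) (x := Filter.atTop) ?_
    fun n => ?_
  · refine tendsto_integral_of_dominated_convergence (fun z => 240 * C * ‖z - ζ‖⁻¹) (fun n => ?_)
      ((integrableOn_inv_norm_sub hζ).const_mul _) (fun n => ?_) ?_
    · exact (hu.continuousOn.mul (continuous_lap_s2
        (contDiff_truncKernel hζ' (hε n))).continuousOn).aestronglyMeasurable measurableSet_ball
    · filter_upwards [self_mem_ae_restrict measurableSet_ball] with z hz
      have hz1 := mem_ball_zero_iff.1 hz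
      have hρ := sub_pos.2 (normSq_lt_one_of_mem_ball hz)
      have hd := norm_sub_pos hζ hz1
      have hb := abs_lap_truncKernel_le hζ hz1 (hε n)
      have hνC := hC z hz
      rw [normSq_eq_norm_sq] at hνC
      rw [norm_mul, Real.norm_eq_abs, Real.norm_eq_abs,
        abs_of_nonneg (div_nonneg (hnn z hz) hρ.le)]
      calc ν z / (1 - normSq z) * |lap (truncKernel ζ (1 / ((n : ℝ) + 1))) z|
          ≤ (C * ‖z - ζ‖ ^ 2) / (1 - normSq z) * (240 * (1 - normSq z) / ‖z - ζ‖ ^ 3) := by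
            refine mul_le_mul (by gcongr) hb (abs_nonneg _) ?_
            exact div_nonneg ((hnn z hz).trans hνC) hρ.le
        _ = 240 * C * ‖z - ζ‖⁻¹ := by field_simp
    · filter_upwards [self_mem_ae_restrict measurableSet_ball] with z hz
      have hz1 := mem_ball_zero_iff.1 hz
      have hρ := sub_pos.2 (normSq_lt_one_of_mem_ball hz)
      have hzζ : z ≠ ζ := by rw [← sub_ne_zero, ← norm_pos_iff]; exact norm_sub_pos hζ hz1
      have hlim : cubicKernel ζ z * ν z =
          ν z / (1 - normSq z) * ((1 - normSq z) * cubicKernel ζ z) := by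
        field_simp
      simp_rw [hlim, one_sub_normSq_mul_cubicKernel hζ hzζ, fun n => lap_truncKernel hζ' (hε n) hzζ]
      have hm : Filter.Tendsto (fun n : ℕ => max (1 - 1 / ((n : ℝ) + 1) - normSq z) 0)
          Filter.atTop (nhds (1 - normSq z)) := by
        have := ((tendsto_one_div_add_atTop_nhds_zero_nat (𝕜 := ℝ)).const_sub 1).sub_const
          (normSq z) |>.max (tendsto_const_nhds (x := (0 : ℝ)))
        simpa [max_eq_left hρ.le] using this
      exact ((((((((hm.pow 2).const_mul 12).mul_const _).div_const _).add
        (((hm.pow 3).const_mul 6).div_const _)).sub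
        ((((hm.pow 3).const_mul 8).mul_const _).div_const _)).add
        (((hm.pow 4).const_mul 4).div_const _)).add
        (((hm.const_mul 12).mul_const _).div_const _)).sub
        ((((hm.pow 2).const_mul 6).mul_const _).div_const _) |>.const_mul _
  · have hs : tsupport (truncKernel ζ (1 / ((n : ℝ) + 1))) ⊆ ball (0 : ℂ) 1 := fun z hz => by
      have := tsupport_truncKernel_subset ζ _ hz
      rw [mem_ofPred_eq, normSq_eq_norm_sq] at this
      rw [mem_ball_zero_iff]
      nlinarith [hε n, norm_nonneg z]
    refine setIntegral_mul_lap_nonneg isOpen_ball hu hsub (contDiff_truncKernel hζ' (hε n))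
      ((isCompact_closedBall (0 : ℂ) 1).of_isClosed_subset (isClosed_tsupport _)
        (hs.trans ball_subset_closedBall)) hs fun z => ?_
    have := normSq_nonneg (z - ζ)
    unfold truncKernel
    positivity

/-- A nonnegative `C²` function on the closed disk that vanishes at a boundary point `ζ`, with
nonpositive inward normal derivative there, vanishes quadratically at `ζ`. -/
lemma exists_le_mul_normSq_sub {ν : ℂ → ℝ} (hν : ContDiffOn ℝ 2 ν (closedBall (0 : ℂ) 1))
    (hnn : ∀ z ∈ closedBall (0 : ℂ) 1, 0 ≤ ν z) {ζ : ℂ} (hζ : ‖ζ‖ = 1) (h0 : ν ζ = 0)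
    (hd : dnD ν ζ ≤ 0) : ∃ C : ℝ, ∀ z ∈ ball (0 : ℂ) 1, ν z ≤ C * normSq (z - ζ) := by
  have hconv : Convex ℝ (closedBall (0 : ℂ) 1) := convex_closedBall 0 1
  have hζm : ζ ∈ closedBall (0 : ℂ) 1 := by simp [hζ]
  have hdiff : ∀ z ∈ closedBall (0 : ℂ) 1,
      HasFDerivWithinAt ν (fderivWithin ℝ ν (closedBall 0 1) z) (closedBall 0 1) z :=
    fun z hz => (hν.differentiableOn (by norm_num) z hz).hasFDerivWithinAt
  have hmin : ∀ z ∈ closedBall (0 : ℂ) 1, 0 ≤ fderivWithin ℝ ν (closedBall 0 1) ζ (z - ζ) := by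
    intro z hz
    refine IsLocalMinOn.hasFDerivWithinAt_nonneg (IsMinOn.localize fun w hw => ?_) (hdiff ζ hζm)
      (mem_posTangentConeAt_of_segment_subset ?_)
    · simpa [h0] using hnn w hw
    · rw [add_sub_cancel]
      exact hconv.segment_subset hζm hz
  have hL : fderivWithin ℝ ν (closedBall (0 : ℂ) 1) ζ = 0 := by
    unfold dnD at hd
    generalize fderivWithin ℝ ν (closedBall (0 : ℂ) 1) ζ = L at *
    have a0 := hmin 0 (by simp)
    have a1 := hmin (I * ζ) (by simp [hζ])
    have a2 := hmin (-(I * ζ)) (by simp [hζ])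
    simp only [map_sub, map_neg, map_zero] at a0 a1 a2 hd
    have b0 : L ζ = 0 := by linarith
    have b1 : L (I * ζ) = 0 := by linarith
    ext z
    have hz : z = (z * conj ζ).re • ζ + (z * conj ζ).im • (I * ζ) := by
      rw [real_smul, real_smul, ← mul_assoc, ← add_mul, re_add_im, mul_assoc, conj_mul', hζ]
      simp
    rw [hz, map_add, map_smul, map_smul, b0, b1]
    simp
  have hud : UniqueDiffOn ℝ (closedBall (0 : ℂ) 1) :=
    uniqueDiffOn_convex hconv (by
      rw [interior_closedBall _ one_ne_zero]; exact nonempty_ball.2 one_pos)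
  obtain ⟨K, hK⟩ := (hν.fderivWithin (m := 1) hud (by norm_num)).exists_lipschitzOnWith
    one_ne_zero hconv (isCompact_closedBall 0 1)
  refine ⟨K, fun z hz => ?_⟩
  have hzm := ball_subset_closedBall hz
  have hseg := hconv.segment_subset hζm hzm
  have := Convex.norm_image_sub_le_of_norm_hasFDerivWithin_le (C := K * ‖z - ζ‖)
    (fun w hw => (hdiff w (hseg hw)).mono hseg) (fun w hw => ?_) (convex_segment ζ z)
    (left_mem_segment ℝ ζ z) (right_mem_segment ℝ ζ z)
  · rw [h0, sub_zero, Real.norm_eq_abs] at this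
    rw [normSq_eq_norm_sq, sq, ← mul_assoc]
    exact (le_abs_self _).trans this
  · have h := hK.norm_sub_le (hseg hw) hζm
    rw [hL, sub_zero] at h
    refine h.trans ?_
    gcongr
    exact norm_sub_le_of_mem_segment hw

/-- For a nonnegative smooth weight `ν` with `ν/(1-|z|²)` subharmonic, reproducing at the
origin, at every point of the unit circle either `ν > 0`, or `ν = 0` and `∂ₙν > 0`.
In particular, no quadratic bound `ν(z) ≤ C|z-ζ₀|²` can hold near a boundary point `ζ₀`. -/
theorem statement2 (ν : ℂ → ℝ)
    (hν : ContDiffOn ℝ (⊤ : ℕ∞) ν (closedBall (0:ℂ) 1))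
    (hnn : ∀ z ∈ closedBall (0:ℂ) 1, 0 ≤ ν z)
    (hsub : ∀ z ∈ ball (0:ℂ) 1, 0 ≤ lap (fun w => ν w / (1 - normSq w)) z)
    (hrep : ∀ h : ℂ → ℝ, IsHarmonicPolynomial h →
      h 0 = ∫ z in ball (0:ℂ) 1, h z * ν z ∂areaM) :
    (∀ ζ ∈ sphere (0:ℂ) 1, 0 < ν ζ ∨ (ν ζ = 0 ∧ 0 < dnD ν ζ)) ∧
      ∀ ζ₀ ∈ sphere (0:ℂ) 1, ¬ ∃ C : ℝ, ∀ z ∈ ball (0:ℂ) 1, ν z ≤ C * normSq (z - ζ₀) := by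
  have hmem : ∀ {ζ : ℂ}, ζ ∈ sphere (0 : ℂ) 1 → ‖ζ‖ = 1 := fun h => mem_sphere_zero_iff_norm.1 h
  have hν2 : ContDiffOn ℝ 2 ν (closedBall (0 : ℂ) 1) := hν.of_le (WithTop.coe_le_coe.2 le_top)
  have hνb := hν2.mono ball_subset_closedBall
  have hnnb : ∀ z ∈ ball (0 : ℂ) 1, 0 ≤ ν z := fun z hz => hnn z (ball_subset_closedBall hz)
  have key : ∀ ζ₀ ∈ sphere (0 : ℂ) 1,
      ¬ ∃ C : ℝ, ∀ z ∈ ball (0 : ℂ) 1, ν z ≤ C * normSq (z - ζ₀) := by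
    rintro ζ hζ ⟨C, hC⟩
    exact absurd (setIntegral_cubicKernel_mul_nonneg hνb hnnb hsub (hmem hζ) hC)
      (setIntegral_cubicKernel_mul_neg hνb.continuousOn hnnb hrep (hmem hζ) hC).not_ge
  refine ⟨fun ζ hζ => ?_, key⟩
  rcases (hnn ζ (sphere_subset_closedBall hζ)).lt_or_eq with h | h
  · exact Or.inl h
  · refine Or.inr ⟨h.symm, ?_⟩
    by_contra! hd
    exact key ζ hζ (exists_le_mul_normSq_sub hν2 hnn (hmem hζ) h.symm hd)
end
end

section
/- Let v be a C^∞-smooth real-valued function on the closed unit disk and set u(z) = log|z|² + v(z) for z ≠ 0. Suppose that u = 0 on the unit circle, that the inward normal derivative satisfies ∂ₙu ≤ 0 on the unit circle, and that Δ[(1−|z|²)^{−1}Δv](z) ≤ 0 for all z in the open unit disk D. Then u(z) ≤ log|z|² + 3/2 − 2|z|² + (1/2)|z|⁴ < 0 for all z ∈ D with z ≠ 0. -/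
open Complex MeasureTheory Metric Set ComplexConjugate
noncomputable section

/-- The derivative of `u` in the direction `a`. -/
def dirDeriv (a : ℂ) (u : ℂ → ℝ) (z : ℂ) : ℝ := fderiv ℝ u z a

/-- The Euler operator `r ∂/∂r`. -/
def euler (u : ℂ → ℝ) (z : ℂ) : ℝ := z.re * dirDeriv 1 u z + z.im * dirDeriv I u z

/-- The defining function `1 - |z|²` of the unit disk. -/
def sig (z : ℂ) : ℝ := 1 - normSq z

/-- Smoothness in the open unit disk. -/
def SmoothDisk (u : ℂ → ℝ) : Prop := ContDiffOn ℝ (⊤ : ℕ∞) u (ball (0:ℂ) 1)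

lemma lap_eq (u : ℂ → ℝ) (z : ℂ) :
    lap u z = (1/4) * (dirDeriv 1 (dirDeriv 1 u) z + dirDeriv I (dirDeriv I u) z) := rfl

lemma euler_eq (u : ℂ → ℝ) (z : ℂ) : euler u z = fderiv ℝ u z z := by
  have h : z = z.re • (1:ℂ) + z.im • I := by
    simp [Complex.re_add_im]
  have h' := congrArg (fderiv ℝ u z) h
  rw [map_add, map_smul, map_smul] at h'
  exact h'.symm

lemma SmoothDisk.contDiffAt {u : ℂ → ℝ} (hu : SmoothDisk u) {z : ℂ} (hz : z ∈ ball (0:ℂ) 1) :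
    ContDiffAt ℝ (⊤ : ℕ∞) u z :=
  ContDiffOn.contDiffAt hu (isOpen_ball.mem_nhds hz)

lemma SmoothDisk.differentiableAt {u : ℂ → ℝ} (hu : SmoothDisk u) {z : ℂ}
    (hz : z ∈ ball (0:ℂ) 1) : DifferentiableAt ℝ u z :=
  (hu.contDiffAt hz).differentiableAt (by simp)

lemma SmoothDisk.dirDeriv {u : ℂ → ℝ} (hu : SmoothDisk u) (a : ℂ) :
    SmoothDisk (dirDeriv a u) :=
  (ContDiffOn.fderiv_of_isOpen hu isOpen_ball (by simp)).clm_apply contDiffOn_const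

lemma SmoothDisk.add {u v : ℂ → ℝ} (hu : SmoothDisk u) (hv : SmoothDisk v) :
    SmoothDisk (fun z => u z + v z) := ContDiffOn.add hu hv

lemma SmoothDisk.mul {u v : ℂ → ℝ} (hu : SmoothDisk u) (hv : SmoothDisk v) :
    SmoothDisk (fun z => u z * v z) := ContDiffOn.mul hu hv

lemma SmoothDisk.const (c : ℝ) : SmoothDisk (fun _ => c) := contDiffOn_const

lemma SmoothDisk.re : SmoothDisk Complex.re := Complex.reCLM.contDiff.contDiffOn

lemma SmoothDisk.im : SmoothDisk Complex.im := Complex.imCLM.contDiff.contDiffOn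

lemma SmoothDisk.lap {u : ℂ → ℝ} (hu : SmoothDisk u) : SmoothDisk (lap u) :=
  (SmoothDisk.const (1/4)).mul (((hu.dirDeriv 1).dirDeriv 1).add ((hu.dirDeriv I).dirDeriv I))

lemma SmoothDisk.euler {u : ℂ → ℝ} (hu : SmoothDisk u) : SmoothDisk (euler u) :=
  (SmoothDisk.re.mul (hu.dirDeriv 1)).add (SmoothDisk.im.mul (hu.dirDeriv I))

lemma dirDeriv_congr {u v : ℂ → ℝ} (h : EqOn u v (ball (0:ℂ) 1)) (a : ℂ) :
    EqOn (dirDeriv a u) (dirDeriv a v) (ball (0:ℂ) 1) := by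
  intro z hz
  have : u =ᶠ[nhds z] v := h.eventuallyEq_of_mem (isOpen_ball.mem_nhds hz)
  simp only [dirDeriv, this.fderiv_eq]

lemma lap_congr_s3 {u v : ℂ → ℝ} (h : EqOn u v (ball (0:ℂ) 1)) :
    EqOn (lap u) (lap v) (ball (0:ℂ) 1) := by
  intro z hz
  rw [lap_eq, lap_eq, dirDeriv_congr (dirDeriv_congr h 1) 1 hz,
    dirDeriv_congr (dirDeriv_congr h I) I hz]

lemma euler_congr {u v : ℂ → ℝ} (h : EqOn u v (ball (0:ℂ) 1)) :
    EqOn (euler u) (euler v) (ball (0:ℂ) 1) := by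
  intro z hz
  simp only [euler, dirDeriv_congr h 1 hz, dirDeriv_congr h I hz]

lemma dirDeriv_add {u v : ℂ → ℝ} (hu : SmoothDisk u) (hv : SmoothDisk v) (a : ℂ) :
    ∀ ⦃z⦄, z ∈ ball (0:ℂ) 1 →
      dirDeriv a (fun z => u z + v z) z =
      dirDeriv a u z + dirDeriv a v z := by
  intro z hz
  simp only [dirDeriv]
  rw [fderiv_fun_add (hu.differentiableAt hz) (hv.differentiableAt hz)]
  rfl

lemma dirDeriv_mul {u v : ℂ → ℝ} (hu : SmoothDisk u) (hv : SmoothDisk v) (a : ℂ) :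
    ∀ ⦃z⦄, z ∈ ball (0:ℂ) 1 →
      dirDeriv a (fun z => u z * v z) z =
      u z * dirDeriv a v z + v z * dirDeriv a u z := by
  intro z hz
  simp only [dirDeriv]
  rw [fderiv_fun_mul (hu.differentiableAt hz) (hv.differentiableAt hz)]
  rfl

@[simp] lemma dirDeriv_const (a : ℂ) (c : ℝ) : dirDeriv a (fun _ => c) = fun _ => 0 := by
  ext z; simp [dirDeriv]

@[simp] lemma dirDeriv_re (a : ℂ) : dirDeriv a Complex.re = fun _ => a.re := by
  ext z
  have : fderiv ℝ Complex.re z = Complex.reCLM := Complex.reCLM.hasFDerivAt.fderiv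
  simp [dirDeriv, this]

@[simp] lemma dirDeriv_im (a : ℂ) : dirDeriv a Complex.im = fun _ => a.im := by
  ext z
  have : fderiv ℝ Complex.im z = Complex.imCLM := Complex.imCLM.hasFDerivAt.fderiv
  simp [dirDeriv, this]

lemma dirDeriv_dirDeriv {u : ℂ → ℝ} (hu : SmoothDisk u) (a b : ℂ) {z : ℂ}
    (hz : z ∈ ball (0:ℂ) 1) :
    dirDeriv a (dirDeriv b u) z = fderiv ℝ (fderiv ℝ u) z a b := by
  have hd : DifferentiableAt ℝ (fderiv ℝ u) z :=
    ((ContDiffOn.fderiv_of_isOpen (m := (⊤ : ℕ∞)) hu isOpen_ball (by simp)).contDiffAt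
      (isOpen_ball.mem_nhds hz)).differentiableAt (by simp)
  change fderiv ℝ (fun w => fderiv ℝ u w b) z a = _
  rw [fderiv_clm_apply hd (differentiableAt_const b)]
  simp

lemma dirDeriv_comm {u : ℂ → ℝ} (hu : SmoothDisk u) (a b : ℂ) :
    EqOn (dirDeriv a (dirDeriv b u)) (dirDeriv b (dirDeriv a u)) (ball (0:ℂ) 1) := by
  intro z hz
  have hs : IsSymmSndFDerivAt ℝ u z := (hu.contDiffAt hz).isSymmSndFDerivAt
    (by simp only [minSmoothness_of_isRCLikeNormedField]; exact WithTop.coe_le_coe.2 le_top)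
  rw [dirDeriv_dirDeriv hu a b hz, dirDeriv_dirDeriv hu b a hz, hs.eq]

lemma lap_add {u v : ℂ → ℝ} (hu : SmoothDisk u) (hv : SmoothDisk v) :
    ∀ ⦃z⦄, z ∈ ball (0:ℂ) 1 →
      lap (fun z => u z + v z) z =
      lap u z + lap v z := by
  intro z hz
  simp only [lap_eq, dirDeriv_congr (dirDeriv_add hu hv _) _ hz,
    dirDeriv_add (hu.dirDeriv _) (hv.dirDeriv _) _ hz]
  ring

lemma lap_mul {u v : ℂ → ℝ} (hu : SmoothDisk u) (hv : SmoothDisk v) :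
    ∀ ⦃z⦄, z ∈ ball (0:ℂ) 1 →
      lap (fun z => u z * v z) z =
      u z * lap v z + v z * lap u z +
        (1/2) * (dirDeriv 1 u z * dirDeriv 1 v z + dirDeriv I u z * dirDeriv I v z) := by
  intro z hz
  simp only [lap_eq, dirDeriv_congr (dirDeriv_mul hu hv _) _ hz,
    dirDeriv_add (hu.mul (hv.dirDeriv _)) (hv.mul (hu.dirDeriv _)) _ hz,
    dirDeriv_mul hu (hv.dirDeriv _) _ hz, dirDeriv_mul hv (hu.dirDeriv _) _ hz]
  ring

lemma lap_const (c : ℝ) (z : ℂ) : lap (fun _ => c) z = 0 := by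
  simp [lap_eq]

lemma lap_const_mul {u : ℂ → ℝ} (c : ℝ) (hu : SmoothDisk u) :
    ∀ ⦃z⦄, z ∈ ball (0:ℂ) 1 →
      lap (fun z => c * u z) z =
      c * lap u z := by
  intro z hz
  rw [lap_mul (SmoothDisk.const c) hu hz]
  simp [lap_const]

lemma euler_add {u v : ℂ → ℝ} (hu : SmoothDisk u) (hv : SmoothDisk v) :
    ∀ ⦃z⦄, z ∈ ball (0:ℂ) 1 →
      euler (fun z => u z + v z) z =
      euler u z + euler v z := by
  intro z hz
  simp only [euler, dirDeriv_add hu hv _ hz]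
  ring

lemma euler_mul {u v : ℂ → ℝ} (hu : SmoothDisk u) (hv : SmoothDisk v) :
    ∀ ⦃z⦄, z ∈ ball (0:ℂ) 1 →
      euler (fun z => u z * v z) z =
      u z * euler v z + v z * euler u z := by
  intro z hz
  simp only [euler, dirDeriv_mul hu hv _ hz]
  ring

lemma euler_const_mul {u : ℂ → ℝ} (c : ℝ) (hu : SmoothDisk u) :
    ∀ ⦃z⦄, z ∈ ball (0:ℂ) 1 →
      euler (fun z => c * u z) z =
      c * euler u z := by
  intro z hz
  rw [euler_mul (SmoothDisk.const c) hu hz]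
  simp [euler]

lemma lap_euler {u : ℂ → ℝ} (hu : SmoothDisk u) :
    ∀ ⦃z⦄, z ∈ ball (0:ℂ) 1 →
      lap (euler u) z =
      euler (lap u) z + 2 * lap u z := by
  intro z hz
  have hx := hu.dirDeriv 1
  have hy := hu.dirDeriv I
  have h1 := lap_add (SmoothDisk.re.mul hx) (SmoothDisk.im.mul hy) hz
  have h2 : ∀ a : ℂ, dirDeriv a (lap u) z = (1/4) * (dirDeriv 1 (dirDeriv 1 (dirDeriv a u)) z +
      dirDeriv I (dirDeriv I (dirDeriv a u)) z) := by
    intro a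
    have e : lap u = fun z => (fun _ => (1/4 : ℝ)) z *
      (fun z => dirDeriv 1 (dirDeriv 1 u) z + dirDeriv I (dirDeriv I u) z) z := rfl
    rw [e, dirDeriv_mul (SmoothDisk.const _) ((hx.dirDeriv 1).add (hy.dirDeriv I)) a hz,
      dirDeriv_add (hx.dirDeriv 1) (hy.dirDeriv I) a hz,
      dirDeriv_comm hx a 1 hz, dirDeriv_comm hy a I hz,
      dirDeriv_congr (dirDeriv_comm hu a 1) 1 hz, dirDeriv_congr (dirDeriv_comm hu a I) I hz]
    simp
  refine h1.trans ?_
  rw [lap_mul SmoothDisk.re hx hz, lap_mul SmoothDisk.im hy hz]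
  simp only [euler, h2]
  simp [lap_eq]
  ring

lemma sig_eq (z : ℂ) : sig z = 1 + (-1) * (z.re * z.re + z.im * z.im) := by
  simp [sig, normSq_apply]; ring

lemma SmoothDisk.sig : SmoothDisk sig := by
  have : _root_.sig = fun z : ℂ => (fun _ => (1:ℝ)) z +
      (fun _ => (-1:ℝ)) z * (z.re * z.re + z.im * z.im) := funext sig_eq
  rw [this]
  exact (SmoothDisk.const 1).add ((SmoothDisk.const (-1)).mul
    ((SmoothDisk.re.mul SmoothDisk.re).add (SmoothDisk.im.mul SmoothDisk.im)))

lemma sig_pos {z : ℂ} (hz : z ∈ ball (0:ℂ) 1) : 0 < sig z := by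
  have : ‖z‖ < 1 := by simpa using hz
  rw [sig, normSq_eq_norm_sq]
  nlinarith [norm_nonneg z]

lemma dirDeriv_sig (a : ℂ) (z : ℂ) : dirDeriv a sig z = -2 * (a.re * z.re + a.im * z.im) := by
  have hr : HasFDerivAt (fun z : ℂ => z.re) Complex.reCLM z := Complex.reCLM.hasFDerivAt
  have hi : HasFDerivAt (fun z : ℂ => z.im) Complex.imCLM z := Complex.imCLM.hasFDerivAt
  have h := (((hr.mul hr).add (hi.mul hi)).const_mul (-1)).const_add 1
  have e : _root_.sig = fun z : ℂ => 1 + (-1) * (z.re * z.re + z.im * z.im) := funext sig_eq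
  have e' : dirDeriv a _root_.sig z = _ := e ▸ congrArg (fun L : ℂ →L[ℝ] ℝ => L a) h.fderiv
  rw [e']
  simp
  ring

lemma lap_sig {z : ℂ} (hz : z ∈ ball (0:ℂ) 1) : lap sig z = -1 := by
  have h1 : EqOn (dirDeriv 1 sig) (fun z => (-2) * z.re) (ball (0:ℂ) 1) := fun w _ => by
    simp [dirDeriv_sig]
  have h2 : EqOn (dirDeriv I sig) (fun z => (-2) * z.im) (ball (0:ℂ) 1) := fun w _ => by
    simp [dirDeriv_sig]
  rw [lap_eq, dirDeriv_congr h1 1 hz, dirDeriv_congr h2 I hz,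
    dirDeriv_mul (SmoothDisk.const _) SmoothDisk.re _ hz,
    dirDeriv_mul (SmoothDisk.const _) SmoothDisk.im _ hz]
  simp
  norm_num

lemma euler_sig (z : ℂ) : euler sig z = -2 * (1 - sig z) := by
  simp [euler, dirDeriv_sig, sig, normSq_apply]; ring

lemma lap_sig_mul {u : ℂ → ℝ} (hu : SmoothDisk u) :
    ∀ ⦃z⦄, z ∈ ball (0:ℂ) 1 →
      lap (fun z => sig z * u z) z =
      sig z * lap u z - euler u z - u z := by
  intro z hz
  rw [lap_mul SmoothDisk.sig hu hz, lap_sig hz]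
  simp [dirDeriv_sig, euler]
  ring

/-- A power of the defining function of the disk. -/
def sigPow (s : ℝ) (z : ℂ) : ℝ := sig z ^ s

lemma SmoothDisk.sigPow (s : ℝ) : SmoothDisk (sigPow s) := fun _ hz =>
  ((SmoothDisk.sig.contDiffAt hz).rpow_const_of_ne (sig_pos hz).ne').contDiffWithinAt

lemma sigPow_pos (s : ℝ) {z : ℂ} (hz : z ∈ ball (0:ℂ) 1) : 0 < sigPow s z :=
  Real.rpow_pos_of_pos (sig_pos hz) s

lemma dirDeriv_sigPow (a : ℂ) (s : ℝ) :
    ∀ ⦃z⦄, z ∈ ball (0:ℂ) 1 →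
      dirDeriv a (sigPow s) z =
      (s * sigPow (s - 1) z) * dirDeriv a sig z := by
  intro z hz
  have h := (SmoothDisk.sig.differentiableAt hz).hasFDerivAt.rpow_const (p := s)
    (Or.inl (sig_pos hz).ne')
  have e : dirDeriv a (sigPow s) z = _ := congrArg (fun L => L a) h.fderiv
  rw [e]
  simp [dirDeriv, _root_.sigPow]

lemma sigPow_sub_one (s : ℝ) {z : ℂ} (hz : z ∈ ball (0:ℂ) 1) :
    sigPow (s - 1) z = sigPow s z / sig z := Real.rpow_sub_one (sig_pos hz).ne' s

lemma sig_mul_euler_sigPow (s : ℝ) {z : ℂ} (hz : z ∈ ball (0:ℂ) 1) :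
    sig z * euler (sigPow s) z = -2 * s * (1 - sig z) * sigPow s z := by
  have h : euler (sigPow s) z = s * sigPow (s - 1) z * euler sig z := by
    simp only [euler, dirDeriv_sigPow _ s hz]; ring
  have := sig_pos hz
  rw [h, euler_sig, sigPow_sub_one s hz]
  field_simp

lemma sig_sq_mul_lap_sigPow (s : ℝ) {z : ℂ} (hz : z ∈ ball (0:ℂ) 1) :
    sig z ^ 2 * lap (sigPow s) z = s * ((s - 1) * (1 - sig z) - sig z) * sigPow s z := by
  have h1 : ∀ a, EqOn (fun z => (s * sigPow (s - 1) z) * dirDeriv a sig z)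
      (fun z => s * (sigPow (s - 1) z * dirDeriv a sig z)) (ball (0:ℂ) 1) :=
    fun a w _ => by ring
  have h2 : ∀ a, dirDeriv a (dirDeriv a (sigPow s)) z = s * (sigPow (s - 1) z *
      dirDeriv a (dirDeriv a sig) z + dirDeriv a sig z *
      (((s - 1) * sigPow (s - 1 - 1) z) * dirDeriv a sig z)) := by
    intro a
    have hp := SmoothDisk.sigPow (s - 1)
    have hs := SmoothDisk.sig.dirDeriv a
    rw [dirDeriv_congr (dirDeriv_sigPow a s) a hz, dirDeriv_congr (h1 a) a hz,
      dirDeriv_mul (SmoothDisk.const s) (hp.mul hs) a hz, dirDeriv_mul hp hs a hz,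
      dirDeriv_sigPow a (s - 1) hz]
    simp
  have h3 : lap (sigPow s) z = s * (sigPow (s - 1) z * lap sig z +
      (s - 1) * sigPow (s - 1 - 1) z * (1 - sig z)) := by
    rw [lap_eq, h2, h2, lap_eq]
    simp [dirDeriv_sig, sig, normSq_apply]
    ring
  have := sig_pos hz
  rw [h3, lap_sig hz, sigPow_sub_one (s - 1) hz, sigPow_sub_one s hz]
  field_simp
  ring

lemma dirDeriv_dirDeriv_nonneg_of_isLocalMin {h : ℂ → ℝ} (hh : SmoothDisk h) {z : ℂ}
    (hz : z ∈ ball (0:ℂ) 1) (hm : IsLocalMin h z) (a : ℂ) :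
    0 ≤ dirDeriv a (dirDeriv a h) z := by
  have hline : ∀ τ : ℝ, HasDerivAt (fun τ : ℝ => z + τ • a) a τ := fun τ => by
    simpa using ((hasDerivAt_id τ).smul_const a).const_add z
  have hcont : ContinuousAt (fun τ : ℝ => z + τ • a) 0 := (hline 0).continuousAt
  have h0 : z + (0:ℝ) • a = z := by simp
  have hev : ∀ᶠ τ : ℝ in nhds 0, z + τ • a ∈ ball (0:ℂ) 1 :=
    hcont.eventually (isOpen_ball.mem_nhds (by simpa using hz))
  have hder : ∀ {u : ℂ → ℝ}, SmoothDisk u → ∀ τ : ℝ, z + τ • a ∈ ball (0:ℂ) 1 →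
      HasDerivAt (fun τ : ℝ => u (z + τ • a)) (dirDeriv a u (z + τ • a)) τ :=
    fun hu τ hτ => (hu.differentiableAt hτ).hasFDerivAt.comp_hasDerivAt τ (hline τ)
  have hd1 : deriv (fun τ : ℝ => h (z + τ • a)) =ᶠ[nhds 0]
      fun τ => dirDeriv a h (z + τ • a) := hev.mono fun τ hτ => (hder hh τ hτ).deriv
  have hd2 : deriv (deriv fun τ : ℝ => h (z + τ • a)) 0 = dirDeriv a (dirDeriv a h) z := by
    rw [hd1.deriv_eq, (hder (hh.dirDeriv a) 0 (by rwa [h0])).deriv, h0]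
  have hmin : IsLocalMin (fun τ : ℝ => h (z + τ • a)) 0 := by
    have hm' : ∀ᶠ w in nhds (z + (0:ℝ) • a), h z ≤ h w := by rwa [h0]
    filter_upwards [hcont.eventually hm'] with τ hτ
    rwa [h0]
  by_contra! hneg
  have hmax := isLocalMax_of_deriv_deriv_neg (hd2 ▸ hneg) hmin.deriv_eq_zero
    (hder hh 0 (by rwa [h0])).continuousAt
  have hconst : (fun τ : ℝ => h (z + τ • a)) =ᶠ[nhds 0] fun _ => h (z + (0:ℝ) • a) := by
    filter_upwards [hmin, hmax] with τ h1 h2 using le_antisymm h2 h1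
  have := hconst.deriv.deriv_eq
  simp only [hd2, deriv_const', deriv_const] at this
  linarith

lemma lap_nonneg_of_isLocalMin {h : ℂ → ℝ} (hh : SmoothDisk h) {z : ℂ}
    (hz : z ∈ ball (0:ℂ) 1) (hm : IsLocalMin h z) : 0 ≤ lap h z := by
  have h1 := dirDeriv_dirDeriv_nonneg_of_isLocalMin hh hz hm 1
  have h2 := dirDeriv_dirDeriv_nonneg_of_isLocalMin hh hz hm I
  rw [lap_eq]
  linarith

lemma euler_eq_zero_of_isLocalMin {h : ℂ → ℝ} {z : ℂ} (hm : IsLocalMin h z) :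
    euler h z = 0 := by
  rw [euler_eq, hm.fderiv_eq_zero]; rfl

/-- Comparison at a point where `a * u + b * v` attains its minimum value zero. -/
lemma jet_of_touching {u v : ℂ → ℝ} (hu : SmoothDisk u) (hv : SmoothDisk v) (a b : ℝ) {z : ℂ}
    (hz : z ∈ ball (0:ℂ) 1) (hnn : ∀ w ∈ ball (0:ℂ) 1, 0 ≤ a * u w + b * v w)
    (h0 : a * u z + b * v z = 0) :
    a * euler u z + b * euler v z = 0 ∧ 0 ≤ a * lap u z + b * lap v z := by
  have hau := (SmoothDisk.const a).mul hu
  have hbv := (SmoothDisk.const b).mul hv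
  have hm : IsLocalMin (fun w => a * u w + b * v w) z := by
    filter_upwards [isOpen_ball.mem_nhds hz] with w hw
    rw [h0]
    exact hnn w hw
  have h1 := euler_eq_zero_of_isLocalMin hm
  have h2 := lap_nonneg_of_isLocalMin (hau.add hbv) hz hm
  rw [euler_add hau hbv hz, euler_const_mul a hu hz, euler_const_mul b hv hz] at h1
  rw [lap_add hau hbv hz, lap_const_mul a hu hz, lap_const_mul b hv hz] at h2
  exact ⟨h1, h2⟩

/-- A continuous function on the disk that is bounded near the circle by a function tending to
zero, and is positive somewhere, attains its maximum. -/
lemma exists_isMaxOn_of_le_sigPow {Φ : ℂ → ℝ} (hΦ : ContinuousOn Φ (ball (0:ℂ) 1)) {K s : ℝ}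
    (hs : 0 < s) (hK : ∀ z ∈ ball (0:ℂ) 1, z ≠ 0 → Φ z ≤ K * sigPow s z) {z₁ : ℂ}
    (hz₁ : z₁ ∈ ball (0:ℂ) 1) (hpos : 0 < Φ z₁) :
    ∃ z ∈ ball (0:ℂ) 1, IsMaxOn Φ (ball (0:ℂ) 1) z := by
  have hc : ContinuousAt (fun r : ℝ => K * (1 - r ^ 2) ^ s) 1 := by
    exact continuousAt_const.mul (ContinuousAt.rpow_const (by fun_prop) (Or.inr hs.le))
  have hev : ∀ᶠ r : ℝ in nhdsWithin 1 (Iio 1), K * (1 - r ^ 2) ^ s < Φ z₁ := by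
    refine (hc.eventually (gt_mem_nhds ?_)).filter_mono nhdsWithin_le_nhds
    simpa [Real.zero_rpow hs.ne'] using hpos
  obtain ⟨ρ, hρ1, hρ⟩ := mem_nhdsLT_iff_exists_Ioo_subset.1 hev
  obtain ⟨R, hR1, hR2⟩ := exists_between
    (max_lt (max_lt (show ρ < 1 from hρ1) one_pos) (show ‖z₁‖ < 1 by simpa using hz₁))
  have hR0 : 0 < R := lt_of_le_of_lt (le_trans (le_max_right ρ 0) (le_max_left _ _)) hR1
  have hRρ : ρ < R := lt_of_le_of_lt (le_trans (le_max_left ρ 0) (le_max_left _ _)) hR1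
  have hRz : ‖z₁‖ < R := lt_of_le_of_lt (le_max_right _ _) hR1
  have hsub : closedBall (0:ℂ) R ⊆ ball (0:ℂ) 1 := closedBall_subset_ball hR2
  have hz₁R : z₁ ∈ closedBall (0:ℂ) R := by simpa using hRz.le
  obtain ⟨z, hz, hmax⟩ := (isCompact_closedBall (0:ℂ) R).exists_isMaxOn ⟨z₁, hz₁R⟩
    (hΦ.mono hsub)
  refine ⟨z, hsub hz, fun w hw => ?_⟩
  by_cases hwR : w ∈ closedBall (0:ℂ) R
  · exact hmax hwR
  have hw1 : ‖w‖ < 1 := by simpa using hw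
  have hwR' : R < ‖w‖ := by simpa using hwR
  have hw0 : w ≠ 0 := norm_pos_iff.1 (hR0.trans hwR')
  have h1 := hK w hw hw0
  have h2 : K * (1 - ‖w‖ ^ 2) ^ s < Φ z₁ := hρ ⟨hRρ.trans hwR', hw1⟩
  rw [sigPow, sig, normSq_eq_norm_sq] at h1
  exact (h1.trans h2.le).trans (hmax hz₁R)

/-- Maximum principle for a cooperative system, by comparison with the strict supersolution
`((1 - |z|²) ^ (3/4), (27/16) (1 - |z|²) ^ (-1/4))`. -/
lemma nonpos_of_cooperative_system {g y : ℂ → ℝ} (hg : SmoothDisk g) (hy : SmoothDisk y)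
    (h1 : ∀ z ∈ ball (0:ℂ) 1, sig z * lap g z = y z - euler g z + g z)
    (h2 : ∀ z ∈ ball (0:ℂ) 1,
      sig z ^ 2 * lap y z ≤ sig z * euler y z + (2 + sig z) * y z + 4 * g z)
    {K : ℝ} (hgK : ∀ z ∈ ball (0:ℂ) 1, z ≠ 0 → g z ≤ K * sig z)
    (hyK : ∀ z ∈ ball (0:ℂ) 1, z ≠ 0 → -K ≤ y z) {z : ℂ} (hz : z ∈ ball (0:ℂ) 1) :
    g z ≤ 0 := by
  by_contra! hpos
  set p := sigPow (3/4) with hp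
  set q := sigPow (-(1/4)) with hq
  have hps : SmoothDisk p := SmoothDisk.sigPow _
  have hqs : SmoothDisk q := SmoothDisk.sigPow _
  have hp0 : ∀ w ∈ ball (0:ℂ) 1, 0 < p w := fun w hw => sigPow_pos _ hw
  have hq0 : ∀ w ∈ ball (0:ℂ) 1, 0 < q w := fun w hw => sigPow_pos _ hw
  have hpq : ∀ w ∈ ball (0:ℂ) 1, p w = sig w * q w := fun w hw => by
    have h := sigPow_sub_one (3/4) hw
    rw [show (3/4 - 1 : ℝ) = -(1/4) by norm_num] at h
    rw [hq, h, mul_div_cancel₀ _ (sig_pos hw).ne']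
  have hr : ∀ w ∈ ball (0:ℂ) 1, sigPow (1/4) w * q w = 1 := fun w hw => by
    rw [hq, sigPow, sigPow, ← Real.rpow_add (sig_pos hw)]; norm_num
  set Φ : ℂ → ℝ := fun w => max (g w / p w) (-y w / (27/16 * q w))
  have hcont : ContinuousOn Φ (ball (0:ℂ) 1) := by
    refine ContinuousOn.sup (hg.continuousOn.div hps.continuousOn fun w hw => (hp0 w hw).ne')
      (hy.continuousOn.neg.div (continuousOn_const.mul hqs.continuousOn) fun w hw => ?_)
    have := hq0 w hw
    positivity
  have hbound : ∀ w ∈ ball (0:ℂ) 1, w ≠ 0 → Φ w ≤ |K| * sigPow (1/4) w := by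
    intro w hw hw0
    have hqw := hq0 w hw
    have hrw := hr w hw
    have hsw := sig_pos hw
    refine max_le ?_ ?_
    · rw [div_le_iff₀ (hp0 w hw), hpq w hw]
      calc g w ≤ K * sig w := hgK w hw hw0
        _ ≤ |K| * sig w := by gcongr; exact le_abs_self K
        _ = |K| * sigPow (1/4) w * (sig w * q w) := by
          linear_combination (-|K| * sig w) * hrw
    · rw [div_le_iff₀ (by positivity)]
      have e : |K| * sigPow (1/4) w * (27/16 * q w) = 27/16 * |K| := by
        linear_combination (27/16 * |K|) * hrw
      rw [e]
      linarith [hyK w hw hw0, le_abs_self K, abs_nonneg K]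
  obtain ⟨a, ha, hmax⟩ := exists_isMaxOn_of_le_sigPow hcont (by norm_num) hbound hz
    (lt_of_lt_of_le (div_pos hpos (hp0 z hz)) (le_max_left _ _))
  set l := Φ a
  have hlpos : 0 < l :=
    lt_of_lt_of_le (lt_of_lt_of_le (div_pos hpos (hp0 z hz)) (le_max_left _ _)) (hmax hz)
  have hgl : ∀ w ∈ ball (0:ℂ) 1, 0 ≤ (-1) * g w + l * p w := fun w hw => by
    have := (div_le_iff₀ (hp0 w hw)).1 ((le_max_left _ _).trans (hmax hw))
    linarith
  have hyl : ∀ w ∈ ball (0:ℂ) 1, 0 ≤ 1 * y w + (27/16 * l) * q w := fun w hw => by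
    have hqw := hq0 w hw
    have := (div_le_iff₀ (show 0 < 27/16 * q w by positivity)).1
      ((le_max_right _ _).trans (hmax hw))
    linarith
  have hsa := sig_pos ha
  have hqa := hq0 a ha
  have hs1 : sig a ≤ 1 := by rw [sig]; linarith [normSq_nonneg a]
  have ep := sig_mul_euler_sigPow (3/4) ha
  have eq := sig_mul_euler_sigPow (-(1/4)) ha
  have lp := sig_sq_mul_lap_sigPow (3/4) ha
  have lq := sig_sq_mul_lap_sigPow (-(1/4)) ha
  rw [← hp] at ep lp
  rw [← hq] at eq lq
  have hlq : 0 < l * q a := mul_pos hlpos hqa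
  rcases max_choice (g a / p a) (-y a / (27/16 * q a)) with hc | hc
  · have h0 : (-1) * g a + l * p a = 0 := by
      have : l = g a / p a := hc
      rw [this, div_mul_cancel₀ _ (hp0 a ha).ne']; ring
    obtain ⟨j1, j2⟩ := jet_of_touching hg hps (-1) l ha hgl h0
    have hya := hyl a ha
    have h1a := h1 a ha
    have hpa := hpq a ha
    have k1 : sig a * ((-1) * (sig a * lap g a) + l * (sig a * lap p a)) ≥ 0 := by
      have := mul_nonneg (mul_pos hsa hsa).le j2
      nlinarith
    have k2 : sig a * (y a + 27/16 * l * q a) ≥ 0 := mul_nonneg hsa.le (by linarith)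
    have k3 : sig a * ((-1) * (sig a * lap g a) + l * (sig a * lap p a)) +
        sig a * (y a + 27/16 * l * q a) = - (1/16) * (sig a ^ 2) * (l * q a) := by
      rw [h1a]
      linear_combination (-sig a) * j1 + sig a * h0 + l * lp + l * ep +
        l * (-(3/2) * (1 - sig a) - sig a + 3/4 * (-(1/4) * (1 - sig a) - sig a)) * hpa
    nlinarith [mul_pos (pow_pos hsa 2) hlq]
  · have h0 : 1 * y a + (27/16 * l) * q a = 0 := by
      have : l = -y a / (27/16 * q a) := hc
      have hne : 27/16 * q a ≠ 0 := by positivity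
      have h := div_mul_cancel₀ (-y a) hne
      rw [← this] at h
      linarith
    obtain ⟨j1, j2⟩ := jet_of_touching hy hqs 1 (27/16 * l) ha hyl h0
    have hga := hgl a ha
    have h2a := h2 a ha
    have hpa := hpq a ha
    have k1 := mul_nonneg (sq_nonneg (sig a)) j2
    have k2 : 0 ≤ (l * q a) * (-(945/256) + 781/256 * sig a) := by
      have e : (l * q a) * (-(945/256) + 781/256 * sig a) =
          sig a ^ 2 * (1 * lap y a + 27/16 * l * lap q a) +
          (sig a * euler y a + (2 + sig a) * y a + 4 * g a - sig a ^ 2 * lap y a) +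
          4 * ((-1) * g a + l * p a) := by
        linear_combination (-(27/16) * l) * lq + (27/16 * l) * eq - sig a * j1 -
          (2 + sig a) * h0 - 4 * l * hpa
      rw [e]
      linarith
    nlinarith

lemma SmoothDisk.sig_inv : SmoothDisk (fun z => (_root_.sig z)⁻¹) :=
  ContDiffOn.inv SmoothDisk.sig fun _ hz => (sig_pos hz).ne'

/-- The fourth order inequality for `f`, rewritten as a second order inequality for
`Δf + 2 r∂ᵣ(f / (1 - |z|²))`. -/
lemma sig_sq_mul_lap_le {f : ℂ → ℝ} (hf : SmoothDisk f)
    (hw : ∀ z ∈ ball (0:ℂ) 1, lap (fun w => (sig w)⁻¹ * lap f w) z ≤ 0) {z : ℂ}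
    (hz : z ∈ ball (0:ℂ) 1) :
    let g := fun w => (sig w)⁻¹ * f w
    let y := fun w => lap f w + 2 * euler g w
    sig z * lap g z = y z - euler g z + g z ∧
      sig z ^ 2 * lap y z ≤ sig z * euler y z + (2 + sig z) * y z + 4 * g z := by
  intro g y
  set k := fun w => (sig w)⁻¹ * lap f w
  have hgs : SmoothDisk g := SmoothDisk.sig_inv.mul hf
  have hks : SmoothDisk k := SmoothDisk.sig_inv.mul hf.lap
  have hσ := SmoothDisk.sig
  have ef : EqOn f (fun w => sig w * g w) (ball (0:ℂ) 1) := fun w hw => by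
    simp only [g]; rw [mul_inv_cancel_left₀ (sig_pos hw).ne']
  have ek : EqOn (lap f) (fun w => sig w * k w) (ball (0:ℂ) 1) := fun w hw => by
    simp only [k]; rw [mul_inv_cancel_left₀ (sig_pos hw).ne']
  have elf : ∀ w ∈ ball (0:ℂ) 1, lap f w = sig w * lap g w - euler g w - g w := fun w hw =>
    (lap_congr_s3 ef hw).trans (lap_sig_mul hgs hw)
  have eg : EqOn (fun w => sig w * lap g w) (fun w => lap f w + (euler g w + g w))
      (ball (0:ℂ) 1) := fun w hw => by
    simp only [elf w hw]; ring
  have r1 := euler_congr eg hz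
  rw [euler_mul hσ hgs.lap hz, euler_add hf.lap (hgs.euler.add hgs) hz,
    euler_add hgs.euler hgs hz, euler_sig] at r1
  have r2 := euler_congr ek hz
  rw [euler_mul hσ hks hz, euler_sig] at r2
  have h2s : SmoothDisk (fun w => 2 * euler g w) := (SmoothDisk.const 2).mul hgs.euler
  have r3 : euler y z = euler (lap f) z + 2 * euler (euler g) z := by
    rw [euler_add hf.lap h2s hz, euler_const_mul 2 hgs.euler hz]
  have r4 : lap y z = lap (lap f) z + 2 * (euler (lap g) z + 2 * lap g z) := by
    rw [lap_add hf.lap h2s hz, lap_const_mul 2 hgs.euler hz, lap_euler hgs hz]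
  have r5 : lap (lap f) z = sig z * lap k z - euler k z - k z :=
    (lap_congr_s3 ek hz).trans (lap_sig_mul hks hz)
  have ekz : lap f z = sig z * k z := ek hz
  have elz := elf z hz
  have hy : y z = lap f z + 2 * euler g z := rfl
  refine ⟨by rw [hy, elz]; ring, ?_⟩
  have key : sig z ^ 2 * lap y z = sig z ^ 3 * lap k z +
      (sig z * euler y z + (2 + sig z) * y z + 4 * g z) := by
    rw [r4, r5, r3, hy]
    linear_combination (2 * sig z) * r1 + sig z * r2 - 4 * elz + (2 - sig z) * ekz
  have := mul_nonpos_of_nonneg_of_nonpos (pow_pos (sig_pos hz) 3).le (hw z hz)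
  rw [key]
  linarith

lemma boundary_bounds {f : ℂ → ℝ} (hf : ContDiffOn ℝ (⊤ : ℕ∞) f (closedBall (0:ℂ) 1))
    (hbd : ∀ z ∈ sphere (0:ℂ) 1, f z = 0)
    (hn : ∀ z ∈ sphere (0:ℂ) 1, 0 ≤ fderivWithin ℝ f (closedBall (0:ℂ) 1) z z) :
    ∃ K : ℝ, 0 ≤ K ∧ ∀ z ∈ ball (0:ℂ) 1, z ≠ 0 → f z ≤ K * sig z ^ 2 ∧ -K ≤ lap f z ∧
      -(K * sig z ^ 2) ≤ sig z * euler f z + 2 * (1 - sig z) * f z := by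
  have hconv : Convex ℝ (closedBall (0:ℂ) 1) := convex_closedBall _ _
  have hcomp := isCompact_closedBall (0:ℂ) 1
  have hud : UniqueDiffOn ℝ (closedBall (0:ℂ) 1) := uniqueDiffOn_convex hconv
    ⟨0, by rw [interior_closedBall _ one_ne_zero]; simp⟩
  set D := fderivWithin ℝ f (closedBall (0:ℂ) 1)
  have hDs : ContDiffOn ℝ (⊤ : ℕ∞) D (closedBall (0:ℂ) 1) := hf.fderivWithin hud (by simp)
  have hfs : SmoothDisk f := hf.mono ball_subset_closedBall
  obtain ⟨L, hL⟩ := hDs.exists_lipschitzOnWith (by simp) hconv hcomp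
  obtain ⟨M, hM⟩ := hcomp.exists_bound_of_continuousOn hDs.continuousOn
  have hM0 : 0 ≤ M := (norm_nonneg _).trans (hM 0 (by simp))
  have hDf : ∀ z ∈ ball (0:ℂ) 1, fderiv ℝ f z = D z := fun z hz =>
    (fderivWithin_of_mem_nhds (Filter.mem_of_superset (isOpen_ball.mem_nhds hz)
      ball_subset_closedBall)).symm
  have hLf : LipschitzOnWith L (fderiv ℝ f) (ball (0:ℂ) 1) := fun z hz w hw => by
    rw [hDf z hz, hDf w hw]
    exact hL (ball_subset_closedBall hz) (ball_subset_closedBall hw)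
  have hdd : ∀ z ∈ ball (0:ℂ) 1, ∀ a : ℂ, ‖a‖ = 1 → |dirDeriv a (dirDeriv a f) z| ≤ L := by
    intro z hz a ha
    have h1 := norm_fderiv_le_of_lipschitzOn ℝ (isOpen_ball.mem_nhds hz) hLf
    have h2 := (fderiv ℝ (fderiv ℝ f) z).le_opNorm₂ a a
    rw [ha, mul_one, mul_one] at h2
    rw [dirDeriv_dirDeriv hfs a a hz, ← Real.norm_eq_abs]
    exact h2.trans h1
  refine ⟨M + 2 * L, by positivity, fun z hz hz0 => ?_⟩
  have hr1 : ‖z‖ < 1 := by simpa using hz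
  have hr0 : 0 < ‖z‖ := norm_pos_iff.2 hz0
  set r := ‖z‖ with hr
  set e : ℂ := (r⁻¹ : ℝ) • z with he
  have hre : z = r • e := by rw [he, smul_smul, mul_inv_cancel₀ hr0.ne', one_smul]
  have hen : ‖e‖ = 1 := by
    rw [he, norm_smul, norm_inv, Real.norm_of_nonneg hr0.le, ← hr, inv_mul_cancel₀ hr0.ne']
  have hes : e ∈ sphere (0:ℂ) 1 := by simpa using hen
  have hec := sphere_subset_closedBall hes
  have hzc := ball_subset_closedBall hz
  obtain ⟨ζ, hζ, hmv⟩ := domain_mvt (f := f) (f' := D)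
    (fun x hx => ((hf.differentiableOn (by simp)) x hx).hasFDerivWithinAt) hconv hzc hec
  have hζc : ζ ∈ closedBall (0:ℂ) 1 := hconv.segment_subset hzc hec hζ
  have hez : e - z = (1 - r) • e := by rw [sub_smul, one_smul, ← hre]
  have hezn : ‖e - z‖ = 1 - r := by
    rw [hez, norm_smul, hen, mul_one, Real.norm_of_nonneg (by linarith)]
  have hζz : ‖z - ζ‖ ≤ 1 - r := by
    rw [← hezn]; simpa [norm_sub_rev] using norm_sub_le_of_mem_segment hζ
  have hζe : ‖e - ζ‖ ≤ 1 - r := by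
    rw [← hezn, norm_sub_rev e z]
    rw [segment_symm] at hζ
    simpa [norm_sub_rev] using norm_sub_le_of_mem_segment hζ
  have hLip : ∀ x ∈ closedBall (0:ℂ) 1, ‖x - ζ‖ ≤ 1 - r →
      |D x e - D ζ e| ≤ L * (1 - r) := by
    intro x hx hxζ
    have h1 := hL.norm_sub_le hx hζc
    have h2 := (D x - D ζ).le_opNorm e
    rw [hen, mul_one] at h2
    calc |D x e - D ζ e| ≤ ‖D x - D ζ‖ := h2
      _ ≤ L * ‖x - ζ‖ := h1
      _ ≤ L * (1 - r) := by gcongr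
  have hfz : f z = -((1 - r) * D ζ e) := by
    rw [hez, map_smul, hbd e hes, smul_eq_mul] at hmv
    linarith
  have heul : euler f z = r * D z e := by
    rw [euler_eq, hDf z hz, he, map_smul, smul_eq_mul, mul_inv_cancel_left₀ hr0.ne']
  have hsig : sig z = 1 - r ^ 2 := by rw [sig, normSq_eq_norm_sq]
  have hDz : |D z e| ≤ M := by
    have := (D z).le_opNorm e
    rw [hen, mul_one] at this
    exact this.trans (hM z hzc)
  have l1 := abs_le.1 (hLip z hzc hζz)
  have l2 := abs_le.1 (hLip e hec hζe)
  have l3 := hn e hes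
  have l4 := abs_le.1 hDz
  have hs : 1 - r ≤ sig z := by rw [hsig]; nlinarith
  have hsq : (1 - r) ^ 2 ≤ sig z ^ 2 := by gcongr
  have hL0 : (0:ℝ) ≤ L := L.2
  refine ⟨?_, ?_, ?_⟩
  · have : f z ≤ (1 - r) ^ 2 * L := by rw [hfz]; nlinarith
    nlinarith [mul_nonneg hL0 (sq_nonneg (sig z)), mul_nonneg hM0 (sq_nonneg (sig z))]
  · have h1 := abs_le.1 (hdd z hz 1 (by simp))
    have hI := abs_le.1 (hdd z hz I (by simp))
    rw [lap_eq]
    linarith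
  · have e1 : sig z * euler f z + 2 * (1 - sig z) * f z =
        (1 - r) * (r * ((1 - r) * D z e + 2 * r * (D z e - D ζ e))) := by
      rw [heul, hfz, hsig]; ring
    have h2 : -((M + 2 * L) * (1 - r)) ≤ (1 - r) * D z e + 2 * r * (D z e - D ζ e) := by
      have a1 : -(M * (1 - r)) ≤ (1 - r) * D z e := by nlinarith
      have a2 : -(L * (1 - r)) ≤ r * (D z e - D ζ e) := by
        have : 0 ≤ L * (1 - r) := mul_nonneg hL0 (by linarith)
        nlinarith
      linarith
    have hnn : 0 ≤ (M + 2 * L) * (1 - r) := mul_nonneg (by positivity) (by linarith)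
    have h3 : -((M + 2 * L) * (1 - r)) ≤
        r * ((1 - r) * D z e + 2 * r * (D z e - D ζ e)) := by
      have b1 := mul_le_mul_of_nonneg_left h2 hr0.le
      have b2 := mul_le_mul_of_nonneg_right hr1.le hnn
      linarith
    rw [e1]
    calc -((M + 2 * L) * sig z ^ 2) ≤ -((M + 2 * L) * (1 - r) ^ 2) := by gcongr
      _ = (1 - r) * -((M + 2 * L) * (1 - r)) := by ring
      _ ≤ _ := mul_le_mul_of_nonneg_left h3 (by linarith)

/-- A function on the closed disk vanishing on the circle, with nonpositive inward normal
derivative and superharmonic weighted Laplacian, is nonpositive. -/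
lemma nonpos_of_weighted_bilaplacian {f : ℂ → ℝ}
    (hf : ContDiffOn ℝ (⊤ : ℕ∞) f (closedBall (0:ℂ) 1))
    (hbd : ∀ z ∈ sphere (0:ℂ) 1, f z = 0)
    (hn : ∀ z ∈ sphere (0:ℂ) 1, 0 ≤ fderivWithin ℝ f (closedBall (0:ℂ) 1) z z)
    (hw : ∀ z ∈ ball (0:ℂ) 1, lap (fun w => (sig w)⁻¹ * lap f w) z ≤ 0) {z : ℂ}
    (hz : z ∈ ball (0:ℂ) 1) : f z ≤ 0 := by
  have hfs : SmoothDisk f := hf.mono ball_subset_closedBall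
  obtain ⟨K, hK0, hK⟩ := boundary_bounds hf hbd hn
  set g := fun w => (sig w)⁻¹ * f w
  have hgs : SmoothDisk g := SmoothDisk.sig_inv.mul hfs
  have ef : EqOn f (fun w => sig w * g w) (ball (0:ℂ) 1) := fun w hw => by
    simp only [g]; rw [mul_inv_cancel_left₀ (sig_pos hw).ne']
  have hgz : g z ≤ 0 := by
    refine nonpos_of_cooperative_system (y := fun w => lap f w + 2 * euler g w) (K := 3 * K) hgs
      (hfs.lap.add ((SmoothDisk.const 2).mul hgs.euler))
      (fun w h => (sig_sq_mul_lap_le hfs hw h).1) (fun w h => (sig_sq_mul_lap_le hfs hw h).2)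
      (fun w h h0 => ?_) (fun w h h0 => ?_) hz
    · have h1 := (hK w h h0).1
      have hs := sig_pos h
      rw [ef h] at h1
      have : g w ≤ K * sig w := le_of_mul_le_mul_left (by linarith) hs
      nlinarith
    · obtain ⟨-, h2, h3⟩ := hK w h h0
      have hs := sig_pos h
      have e1 : euler f w = _ := (euler_congr ef h).trans (euler_mul SmoothDisk.sig hgs h)
      have e2 : sig w * euler f w + 2 * (1 - sig w) * f w = sig w ^ 2 * euler g w := by
        rw [e1, ef h, euler_sig]; ring
      rw [e2] at h3
      have : -K ≤ euler g w := le_of_mul_le_mul_left (by linarith) (pow_pos hs 2)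
      linarith
  rw [ef hz]
  exact mul_nonpos_of_nonneg_of_nonpos (sig_pos hz).le hgz

/-- The radial profile of the extremal function. -/
def logDefect (t : ℝ) : ℝ := Real.log t + 3/2 - 2 * t + (1/2) * t ^ 2

lemma hasDerivAt_logDefect {t : ℝ} (ht : t ≠ 0) : HasDerivAt logDefect (t⁻¹ - 2 + t) t := by
  have h := (((Real.hasDerivAt_log ht).add_const (3/2)).sub ((hasDerivAt_id t).const_mul 2)).add
    ((hasDerivAt_pow 2 t).const_mul (1/2))
  exact h.congr_deriv (by norm_num; ring)

lemma logDefect_neg {t : ℝ} (ht0 : 0 < t) (ht1 : t < 1) : logDefect t < 0 := by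
  have hs := Real.hasSum_pow_div_log_of_abs_lt_one (x := 1 - t)
    (by rw [abs_of_pos (by linarith)]; linarith)
  have h := sum_le_hasSum (Finset.range 3) (fun i _ => by
    have : 0 < 1 - t := by linarith
    positivity) hs
  simp only [Finset.sum_range_succ, Finset.sum_range_zero] at h
  rw [sub_sub_cancel] at h
  norm_num at h
  have h3 : 0 < (1 - t) ^ 3 := pow_pos (by linarith) 3
  rw [logDefect]
  nlinarith

/-- If `u = log|z|² + v` with `v` smooth on the closed disk, `u` vanishes on the circle,
`∂ₙu ≤ 0` on the circle, and `Δ[(1-|z|²)⁻¹Δv] ≤ 0` in the open disk, then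
`u(z) ≤ log|z|² + 3/2 - 2|z|² + |z|⁴/2 < 0` in the punctured open disk. -/
theorem statement3 (v u : ℂ → ℝ)
    (hv : ContDiffOn ℝ (⊤ : ℕ∞) v (closedBall (0:ℂ) 1))
    (hu : ∀ z : ℂ, z ≠ 0 → u z = Real.log (normSq z) + v z)
    (hbd : ∀ z ∈ sphere (0:ℂ) 1, u z = 0)
    (hn : ∀ z ∈ sphere (0:ℂ) 1, dnD u z ≤ 0)
    (hμ : ∀ z ∈ ball (0:ℂ) 1, lap (fun w => (1 - normSq w)⁻¹ * lap v w) z ≤ 0) :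
    ∀ z ∈ ball (0:ℂ) 1, z ≠ 0 →
      u z ≤ Real.log (normSq z) + 3/2 - 2 * normSq z + (1/2) * normSq z ^ 2 ∧
      Real.log (normSq z) + 3/2 - 2 * normSq z + (1/2) * normSq z ^ 2 < 0 := by
  have hσc : ContDiff ℝ (⊤ : ℕ∞) sig := by
    have e : sig = fun z : ℂ => 1 + (-1) * (Complex.reCLM z * Complex.reCLM z +
        Complex.imCLM z * Complex.imCLM z) := funext sig_eq
    rw [e]
    fun_prop
  set P : ℂ → ℝ := fun z => (-1) * sig z + (-(1/2)) * (sig z * sig z) with hP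
  have hPc : ContDiff ℝ (⊤ : ℕ∞) P :=
    (contDiff_const.mul hσc).add (contDiff_const.mul (hσc.mul hσc))
  set f : ℂ → ℝ := fun z => v z + P z with hf
  have hfc : ContDiffOn ℝ (⊤ : ℕ∞) f (closedBall (0:ℂ) 1) := hv.add hPc.contDiffOn
  have hfu : ∀ z : ℂ, z ≠ 0 → f z = u z - logDefect (normSq z) := fun z hz => by
    rw [hf, hP, hu z hz]
    simp only [logDefect, sig]
    ring
  have hfbd : ∀ z ∈ sphere (0:ℂ) 1, f z = 0 := fun z hz => by
    have h1 : normSq z = 1 := by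
      rw [normSq_eq_norm_sq, mem_sphere_zero_iff_norm.1 hz, one_pow]
    rw [hfu z (ne_zero_of_mem_unit_sphere ⟨z, hz⟩), hbd z hz, h1]
    norm_num [logDefect]
  have hvs : SmoothDisk v := hv.mono ball_subset_closedBall
  have hσs := SmoothDisk.sig
  have hlapP : ∀ z ∈ ball (0:ℂ) 1, lap P z = 2 * sig z := fun z hz => by
    rw [lap_add ((SmoothDisk.const (-1)).mul hσs)
        ((SmoothDisk.const (-(1/2))).mul (hσs.mul hσs)) hz,
      lap_const_mul _ hσs hz, lap_const_mul _ (hσs.mul hσs) hz, lap_sig_mul hσs hz, lap_sig hz,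
      euler_sig]
    ring
  have hfw : ∀ z ∈ ball (0:ℂ) 1, lap (fun w => (sig w)⁻¹ * lap f w) z ≤ 0 := fun z hz => by
    have e : EqOn (fun w => (sig w)⁻¹ * lap f w) (fun w => (sig w)⁻¹ * lap v w + 2)
        (ball (0:ℂ) 1) := fun w hw => by
      have := sig_pos hw
      simp only [hf]
      rw [lap_add hvs hPc.contDiffOn hw, hlapP w hw]
      field_simp
    rw [lap_congr_s3 e hz, lap_add (SmoothDisk.sig_inv.mul hvs.lap) (SmoothDisk.const 2) hz, lap_const,
      add_zero]
    exact hμ z hz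
  have hfn : ∀ z ∈ sphere (0:ℂ) 1, 0 ≤ fderivWithin ℝ f (closedBall (0:ℂ) 1) z z := fun z hz => by
    have hz0 : z ≠ 0 := ne_zero_of_mem_unit_sphere ⟨z, hz⟩
    have hzc := sphere_subset_closedBall hz
    have h1 : normSq z = 1 := by
      rw [normSq_eq_norm_sq, mem_sphere_zero_iff_norm.1 hz, one_pow]
    have hud : UniqueDiffWithinAt ℝ (closedBall (0:ℂ) 1) z :=
      uniqueDiffOn_convex (convex_closedBall _ _)
        ⟨0, by rw [interior_closedBall _ one_ne_zero]; simp⟩ z hzc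
    have hdf := ((hfc.differentiableOn (by simp)) z hzc).hasFDerivWithinAt
    have hdn : HasFDerivAt (fun w => normSq w) (fderiv ℝ (fun w => normSq w) z) z := by
      have e : (fun w => normSq w) = fun w => 1 - sig w := by ext w; simp [sig]
      rw [e]
      exact ((hσc.differentiable (by simp)) z |>.const_sub 1).hasFDerivAt
    have hdl : HasDerivAt logDefect 0 (normSq z) := by
      rw [h1]; exact (hasDerivAt_logDefect one_ne_zero).congr_deriv (by norm_num)
    have hsum := hdf.add (hdl.comp_hasFDerivAt z hdn).hasFDerivWithinAt
    have hev : u =ᶠ[nhdsWithin z (closedBall (0:ℂ) 1)] f + logDefect ∘ fun w => normSq w := by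
      filter_upwards [mem_nhdsWithin_of_mem_nhds (isOpen_ne.mem_nhds hz0)] with w hw
      simp [hfu w hw]
    have hdu := hsum.congr_of_eventuallyEq hev (by simp [hfu z hz0])
    have h := hn z hz
    rw [dnD, hdu.fderivWithin hud] at h
    simpa using h
  intro z hz hz0
  have hneg := nonpos_of_weighted_bilaplacian hfc hfbd hfn hfw hz
  rw [hfu z hz0] at hneg
  have ht1 : normSq z < 1 := by
    have := sig_pos hz
    rw [sig] at this
    linarith
  have hL := logDefect_neg (normSq_pos.2 hz0) ht1
  rw [logDefect] at hneg hL
  exact ⟨by linarith, hL⟩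
end
end
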